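/- (Orbital stability of the ground states.) Assume the Jellium and Wiener conditions. For every ε > 0 there exists δ > 0 with the following property: for every classical solution (ψ, Φ, q) of the Schrödinger–Poisson–Newton system on ℝ satisfying ∫_{T_N}|ψ(x,0)|² dx = Z·N³ and d(ψ(·,0), q(·,0), q̇(·,0)) < δ, one has d(ψ(·,t), q(·,t), q̇(·,t)) < ε for all t ∈ ℝ. -/

import Mathlib

noncomputable section

namespace SPN

open MeasureTheory Finset
open scoped Real

/-- Points of `ℝ³`. -/
abbrev V3 : Type := Fin 3 → ℝ

/-- Euclidean dot product on `ℝ³`. -/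
def dotP (v w : V3) : ℝ := ∑ i, v i * w i

/-- Squared Euclidean norm on `ℝ³`. -/
def nsqV (v : V3) : ℝ := ∑ i, v i ^ 2

/-- The fundamental cube `[0,N)³` of the torus `T_N = ℝ³/(N·ℤ³)`. -/
def cubeN (N : ℕ) : Set V3 := {x | ∀ i, x i ∈ Set.Ico (0 : ℝ) (N : ℝ)}

/-- `N·ℤ³`-periodicity of a function on `ℝ³`. -/
def IsPerN {α : Type*} (N : ℕ) (f : V3 → α) : Prop :=
  ∀ (x : V3) (k : Fin 3 → ℤ), f (x + fun i => (N : ℝ) * (k i : ℝ)) = f x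

/-- Index set for `Γ_N = {0,…,N−1}³`. -/
abbrev GammaIdx (N : ℕ) : Type := Fin 3 → Fin N

/-- The lattice point of `Γ_N` associated to an index. -/
def embG {N : ℕ} (n : GammaIdx N) : V3 := fun i => ((n i : ℕ) : ℝ)

/-- Fourier coefficient `f̂(ξ) = ∫_{T_N} e^{iξ·x} f(x) dx`. -/
def fCoeff (N : ℕ) (f : V3 → ℂ) (ξ : V3) : ℂ :=
  ∫ x in cubeN N, Complex.exp (Complex.I * ((dotP ξ x : ℝ) : ℂ)) * f x

/-- Fourier coefficient of a real-valued function. -/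
def fCoeffR (N : ℕ) (f : V3 → ℝ) (ξ : V3) : ℂ :=
  fCoeff N (fun x => ((f x : ℝ) : ℂ)) ξ

/-- The point `(2π/N)·k` of the dual lattice `Γ*_N`. -/
def xiN (N : ℕ) (k : Fin 3 → ℤ) : V3 := fun i => (2 * π / (N : ℝ)) * (k i : ℝ)

/-- The Jellium condition: `σ̂(ξ) = 0` for all `ξ ∈ Γ*_1 \ {0}`. -/
def JelliumCond (N : ℕ) (σ : V3 → ℝ) : Prop :=
  ∀ k : Fin 3 → ℤ, k ≠ 0 → fCoeffR N σ (fun i => 2 * π * (k i : ℝ)) = 0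

/-- `(2π/N)·k ∈ Γ*_1`, i.e. every coordinate of `k` is divisible by `N`. -/
def inGamma1 (N : ℕ) (k : Fin 3 → ℤ) : Prop := ∀ i, (N : ℤ) ∣ k i

/-- `|∇φ(x)|²` for a complex-valued function. -/
def gradSq (φ : V3 → ℂ) (x : V3) : ℝ :=
  ∑ i, Complex.normSq (fderiv ℝ φ x (Pi.single i 1))

/-- Gradient of a real-valued function on `ℝ³`. -/
def gradV (f : V3 → ℝ) (x : V3) : V3 := fun i => fderiv ℝ f x (Pi.single i 1)

/-- Total charge density `ρ(x) = ∑_n σ(x−n−q(n)) − e|ψ(x)|²`. -/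
def rhoT (N : ℕ) (σ : V3 → ℝ) (e : ℝ) (ψ : V3 → ℂ) (q : GammaIdx N → V3) (x : V3) : ℝ :=
  (∑ n : GammaIdx N, σ (x - embG n - q n)) - e * Complex.normSq (ψ x)

/-- `∑_{ξ∈Γ*_N\{0}} |f̂(ξ)|²/|ξ|²`. -/
def dualSum (N : ℕ) (f : V3 → ℝ) : ℝ :=
  ∑' k : Fin 3 → ℤ, if k = 0 then 0 else
    Complex.normSq (fCoeffR N f (xiN N k)) / nsqV (xiN N k)

/-- The energy functional `E(ψ,q,p)`. -/
def energyE (N : ℕ) (σ : V3 → ℝ) (e M : ℝ) (ψ : V3 → ℂ) (q p : GammaIdx N → V3) : ℝ :=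
  (1 / 2) * (∫ x in cubeN N, gradSq ψ x)
    + (2 * (N : ℝ) ^ 3)⁻¹ * dualSum N (rhoT N σ e ψ q)
    + (2 * M)⁻¹ * ∑ n : GammaIdx N, nsqV (p n)

/-- The matrix `Σ(θ) = ∑_{m∈ℤ³} (ξξᵀ/|ξ|²)|σ̂(ξ)|²`, `ξ = θ + 2πm`. -/
def SigMat (N : ℕ) (σ : V3 → ℝ) (θ : V3) : Matrix (Fin 3) (Fin 3) ℝ :=
  Matrix.of fun a b => ∑' m : Fin 3 → ℤ,
    ((θ a + 2 * π * (m a : ℝ)) * (θ b + 2 * π * (m b : ℝ))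
        / nsqV (fun i => θ i + 2 * π * (m i : ℝ)))
      * Complex.normSq (fCoeffR N σ (fun i => θ i + 2 * π * (m i : ℝ)))

/-- The Wiener condition: `Σ(θ)` is positive definite for all `θ ∈ Γ*_N \ Γ*_1`. -/
def WienerCond (N : ℕ) (σ : V3 → ℝ) : Prop :=
  ∀ k : Fin 3 → ℤ, ¬ inGamma1 N k → (SigMat N σ (xiN N k)).PosDef

/-- First-order ionic density `σ⁽¹⁾(x) = −∑_n κ(n)·∇σ(x−n−r)`. -/
def sigma1F (N : ℕ) (σ : V3 → ℝ) (r : V3) (κ : GammaIdx N → V3) (x : V3) : ℝ :=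
  - ∑ n : GammaIdx N, dotP (κ n) (gradV σ (x - embG n - r))

/-- First-order charge density `ρ⁽¹⁾(x) = σ⁽¹⁾(x) − 2e√Z·Re(e^{−iα}φ(x))`. -/
def rho1F (N : ℕ) (σ : V3 → ℝ) (e Z α : ℝ) (r : V3) (κ : GammaIdx N → V3)
    (φ : V3 → ℂ) (x : V3) : ℝ :=
  sigma1F N σ r κ x - 2 * e * Real.sqrt Z * (Complex.exp (-Complex.I * (α : ℂ)) * φ x).re

/-- The quadratic form `B(φ,κ,p)` (half of the energy Hessian). -/
def BformQ (N : ℕ) (σ : V3 → ℝ) (e Z M α : ℝ) (r : V3)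
    (φ : V3 → ℂ) (κ p : GammaIdx N → V3) : ℝ :=
  (1 / 2) * (∫ x in cubeN N, gradSq φ x)
    + (2 * (N : ℝ) ^ 3)⁻¹ * dualSum N (rho1F N σ e Z α r κ φ)
    + (2 * M)⁻¹ * ∑ n : GammaIdx N, nsqV (p n)

/-- Second-order charge density `ρ⁽²⁾`. -/
def rho2F (N : ℕ) (σ : V3 → ℝ) (e : ℝ) (r : V3) (κ : GammaIdx N → V3)
    (φ : V3 → ℂ) (x : V3) : ℝ :=
  (∑ n : GammaIdx N,
      (σ (x - embG n - r - κ n) - σ (x - embG n - r)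
        + dotP (κ n) (gradV σ (x - embG n - r))))
    - e * Complex.normSq (φ x)

/-- The pairing `(f, Gg) = N⁻³ ∑_{ξ∈Γ*_N\{0}} Re(f̂(ξ)·conj(ĝ(ξ)))/|ξ|²`. -/
def GPair (N : ℕ) (f g : V3 → ℝ) : ℝ :=
  ((N : ℝ) ^ 3)⁻¹ * ∑' k : Fin 3 → ℤ, if k = 0 then 0 else
    (fCoeffR N f (xiN N k) * (starRingEnd ℂ) (fCoeffR N g (xiN N k))).re / nsqV (xiN N k)

/-- The distance to the solitary manifold of ground states. -/
def distS (N : ℕ) (Z : ℝ) (ψ : V3 → ℂ) (q p : GammaIdx N → V3) : ℝ :=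
  ⨅ (α : ℝ) (r : V3),
    (Real.sqrt (∫ x in cubeN N,
        (Complex.normSq (ψ x - Complex.exp (Complex.I * (α : ℂ)) * ((Real.sqrt Z : ℝ) : ℂ))
          + gradSq ψ x))
      + Real.sqrt (∑ n : GammaIdx N, ⨅ k : Fin 3 → ℤ,
          nsqV (fun i => q n i - r i - (N : ℝ) * (k i : ℝ)))
      + Real.sqrt (∑ n : GammaIdx N, nsqV (p n)))

/-- The discrete Fourier transform `κ̂(θ) ∈ ℂ³` of `κ : Γ_N → ℝ³`. -/
def hatK (N : ℕ) (κ : GammaIdx N → V3) (θ : V3) (a : Fin 3) : ℂ :=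
  ∑ n : GammaIdx N, Complex.exp (Complex.I * ((dotP θ (embG n) : ℝ) : ℂ)) * ((κ n a : ℝ) : ℂ)

/-- Laplacian of a complex-valued function on `ℝ³`. -/
def lapC (f : V3 → ℂ) (x : V3) : ℂ :=
  ∑ i, fderiv ℝ (fun y => fderiv ℝ f y (Pi.single i 1)) x (Pi.single i 1)

/-- Laplacian of a real-valued function on `ℝ³`. -/
def lapR (f : V3 → ℝ) (x : V3) : ℝ :=
  ∑ i, fderiv ℝ (fun y => fderiv ℝ f y (Pi.single i 1)) x (Pi.single i 1)

/-- A classical solution of the Schrödinger–Poisson–Newton system on `ℝ`. -/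
structure IsSPN (N : ℕ) (σ : V3 → ℝ) (e M : ℝ)
    (ψ : V3 → ℝ → ℂ) (Φ : V3 → ℝ → ℝ) (q : ℝ → GammaIdx N → V3) : Prop where
  per_psi : ∀ t : ℝ, IsPerN N (fun x => ψ x t)
  per_Phi : ∀ t : ℝ, IsPerN N (fun x => Φ x t)
  regx_psi : ∀ t : ℝ, ContDiff ℝ 2 (fun x => ψ x t)
  regt_psi : ∀ x : V3, ContDiff ℝ 1 (fun t => ψ x t)
  regx_Phi : ∀ t : ℝ, ContDiff ℝ 2 (fun x => Φ x t)
  regt_Phi : ∀ x : V3, ContDiff ℝ 1 (fun t => Φ x t)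
  reg_q : ContDiff ℝ 2 q
  schrodinger : ∀ (x : V3) (t : ℝ),
    Complex.I * deriv (fun s => ψ x s) t =
      -(1 / 2 : ℂ) * lapC (fun y => ψ y t) x - ((e : ℝ) : ℂ) * ((Φ x t : ℝ) : ℂ) * ψ x t
  poisson : ∀ (x : V3) (t : ℝ),
    - lapR (fun y => Φ y t) x =
      (∑ n : GammaIdx N, σ (x - embG n - q t n)) - e * Complex.normSq (ψ x t)
  newton : ∀ (n : GammaIdx N) (t : ℝ) (i : Fin 3),
    M * deriv (fun s => deriv (fun u => q u n i) s) t =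
      - ∫ x in cubeN N, fderiv ℝ (fun y => Φ y t) x (Pi.single i 1) * σ (x - embG n - q t n)

section part1

section basics

variable {E : Type*} [NormedAddCommGroup E]

lemma cubeN_eq (N : ℕ) : cubeN N = Set.pi Set.univ (fun _ : Fin 3 => Set.Ico (0 : ℝ) (N : ℝ)) := by
  ext x; simp [cubeN]

lemma measurableSet_cubeN (N : ℕ) : MeasurableSet (cubeN N) := by
  rw [cubeN_eq]; exact MeasurableSet.univ_pi fun _ => measurableSet_Ico

lemma cubeN_subset (N : ℕ) : cubeN N ⊆ Set.Icc (0 : V3) (fun _ => (N : ℝ)) := by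
  intro x hx
  exact ⟨fun i => (hx i).1, fun i => (hx i).2.le⟩

lemma volume_cubeN (N : ℕ) : volume (cubeN N) = ENNReal.ofReal ((N : ℝ) ^ 3) := by
  rw [cubeN_eq, Real.volume_pi_Ico]
  simp [ENNReal.ofReal_pow]

lemma volume_real_cubeN (N : ℕ) : volume.real (cubeN N) = (N : ℝ) ^ 3 := by
  rw [measureReal_def, volume_cubeN, ENNReal.toReal_ofReal (by positivity)]

instance finite_cubeN (N : ℕ) : IsFiniteMeasure (volume.restrict (cubeN N)) := by
  constructor
  rw [Measure.restrict_apply_univ, volume_cubeN]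
  exact ENNReal.ofReal_lt_top

lemma intQ (N : ℕ) {f : V3 → E} (hf : Continuous f) : IntegrableOn f (cubeN N) :=
  (hf.continuousOn.integrableOn_compact isCompact_Icc).mono_set (cubeN_subset N)

lemma bddQ (N : ℕ) {f : V3 → E} (hf : Continuous f) : ∃ C, 0 ≤ C ∧ ∀ x ∈ cubeN N, ‖f x‖ ≤ C := by
  obtain ⟨C, hC⟩ := (isCompact_Icc (a := (0 : V3)) (b := fun _ => (N : ℝ))).exists_bound_of_continuousOn
    hf.continuousOn
  exact ⟨max C 0, le_max_right _ _, fun x hx => (hC x (cubeN_subset N hx)).trans (le_max_left _ _)⟩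

lemma const_int (N : ℕ) [NormedSpace ℝ E] [CompleteSpace E] (c : E) :
    ∫ _ in cubeN N, c = ((N : ℝ) ^ 3) • c := by
  rw [setIntegral_const, volume_real_cubeN]

/-- lattice subgroup -/
def latN (N : ℕ) : AddSubgroup V3 where
  carrier := {v | ∃ k : Fin 3 → ℤ, v = fun i => (N : ℝ) * (k i : ℝ)}
  add_mem' := by
    rintro _ _ ⟨k, rfl⟩ ⟨l, rfl⟩
    exact ⟨k + l, by ext i; simp; ring⟩
  zero_mem' := ⟨0, by ext i; simp⟩
  neg_mem' := by
    rintro _ ⟨k, rfl⟩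
    exact ⟨-k, by ext i; simp⟩

instance (N : ℕ) : Countable (latN N) := by
  have : (latN N : Set V3) = Set.range (fun k : Fin 3 → ℤ => fun i => (N : ℝ) * (k i : ℝ)) := by
    ext v; constructor
    · rintro ⟨k, rfl⟩; exact ⟨k, rfl⟩
    · rintro ⟨k, rfl⟩; exact ⟨k, rfl⟩
  have h : (latN N : Set V3).Countable := this ▸ Set.countable_range _
  exact h.to_subtype

lemma fundDom (N : ℕ) (hN : 0 < N) : IsAddFundamentalDomain (latN N) (cubeN N) volume := by
  have hN' : (0 : ℝ) < N := by exact_mod_cast hN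
  apply IsAddFundamentalDomain.mk' (measurableSet_cubeN N).nullMeasurableSet
  intro x
  have key : ∀ k : Fin 3 → ℤ, ((fun i => (N : ℝ) * (k i : ℝ)) + x ∈ cubeN N) ↔
      ∀ i, k i = - ⌊x i / N⌋ := by
    intro k
    simp only [cubeN, Set.mem_ofPred_eq, Pi.add_apply]
    refine forall_congr' fun i => ?_
    have e1 : k i = - ⌊x i / N⌋ ↔ ⌊x i / N⌋ = - k i := by constructor <;> intro h <;> omega
    rw [e1, Int.floor_eq_iff, Set.mem_Ico, le_div_iff₀ hN', div_lt_iff₀ hN']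
    push_cast
    constructor <;> rintro ⟨h1, h2⟩ <;> constructor <;> nlinarith
  refine ⟨⟨_, ⟨fun i => - ⌊x i / N⌋, rfl⟩⟩, ?_, ?_⟩
  · exact (key _).2 fun i => rfl
  · rintro ⟨_, k, rfl⟩ h
    have := (key k).1 h
    ext i
    simp [this i]

open Pointwise in
lemma shift_int [NormedSpace ℝ E] (N : ℕ) (hN : 0 < N) {f : V3 → E} (hf : IsPerN N f) (v : V3) :
    ∫ x in cubeN N, f (x + v) = ∫ x in cubeN N, f x := by
  have h1 := fundDom N hN
  have h2 : IsAddFundamentalDomain (latN N) (v +ᵥ cubeN N) volume := h1.vadd_of_comm v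
  have h3 : ∫ x in v +ᵥ cubeN N, f x = ∫ x in cubeN N, f x := by
    refine h2.setIntegral_eq h1 ?_
    rintro ⟨_, k, rfl⟩ x
    have := hf x k
    rw [← this]
    congr 1
    rw [add_comm]; rfl
  rw [← h3]
  have h4 : MeasurePreserving (fun x : V3 => x + v) volume volume := measurePreserving_add_right _ v
  have h5 : MeasurableEmbedding (fun x : V3 => x + v) := measurableEmbedding_addRight v
  have := h4.setIntegral_image_emb h5 f (cubeN N)
  rw [← this]
  congr 2
  ext y
  rw [Set.mem_vadd_set]
  simp only [Set.mem_image, vadd_eq_add, add_comm]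

end basics

section ff
variable {E : Type*} [NormedAddCommGroup E] [NormedSpace ℝ E]

/-- differentiation under the integral for separately continuous integrands. -/
lemma ff_eq (N : ℕ) {f g : V3 → ℝ → ℝ} {a b K : ℝ}
    (hfc : ∀ t, Continuous fun x => f x t)
    (hd : ∀ x, ∀ t ∈ Set.uIcc a b, HasDerivAt (f x) (g x t) t)
    (hgt : ∀ x, Continuous (g x)) (hgx : ∀ t, Continuous fun x => g x t)
    (hK : ∀ t ∈ Set.uIcc a b, ∫ x in cubeN N, |g x t| ≤ K) :
    IntervalIntegrable (fun t => ∫ x in cubeN N, g x t) volume a b ∧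
    (∫ x in cubeN N, f x b) - (∫ x in cubeN N, f x a) = ∫ t in a..b, ∫ x in cubeN N, g x t := by
  have hm : Measurable (Function.uncurry fun (t : ℝ) (x : V3) => g x t) :=
    measurable_uncurry_of_continuous_of_measurable (u := fun (t : ℝ) (x : V3) => g x t)
      (fun x => hgt x) (fun t => (hgx t).measurable)
  have hI : Integrable (Function.uncurry fun (t : ℝ) (x : V3) => g x t)
      ((volume.restrict (Set.uIoc a b)).prod (volume.restrict (cubeN N))) := by
    rw [integrable_prod_iff hm.aestronglyMeasurable]
    refine ⟨Filter.Eventually.of_forall fun t => intQ N (hgx t), ?_⟩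
    have hm2 : AEStronglyMeasurable (fun t => ∫ x in cubeN N, ‖g x t‖)
        (volume.restrict (Set.uIoc a b)) :=
      (hm.norm.stronglyMeasurable.integral_prod_right (ν := volume.restrict (cubeN N))).aestronglyMeasurable
    have : IsFiniteMeasure (volume.restrict (Set.uIoc a b)) := by
      constructor
      rw [Measure.restrict_apply_univ, Set.uIoc]; simp
    refine Integrable.mono' (g := fun _ => K) (integrable_const K) hm2 ?_
    refine (ae_restrict_iff' measurableSet_uIoc).2 (Filter.Eventually.of_forall fun t ht => ?_)
    rw [Real.norm_of_nonneg (integral_nonneg fun x => norm_nonneg _)]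
    exact hK t (Set.uIoc_subset_uIcc ht)
  have h1 : IntervalIntegrable (fun t => ∫ x in cubeN N, g x t) volume a b := by
    rw [intervalIntegrable_iff]
    exact hI.integral_prod_left
  refine ⟨h1, ?_⟩
  rw [← integral_sub (intQ N (hfc b)) (intQ N (hfc a))]
  have h2 : ∀ x, f x b - f x a = ∫ t in a..b, g x t := by
    intro x
    rw [intervalIntegral.integral_eq_sub_of_hasDerivAt (fun t ht => hd x t ht)
      ((hgt x).intervalIntegrable a b)]
  simp_rw [h2]
  rw [intervalIntegral_integral_swap ?_]
  exact hI

lemma ff_le (N : ℕ) {f g : V3 → ℝ → ℝ} {a b K B : ℝ}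
    (hfc : ∀ t, Continuous fun x => f x t)
    (hd : ∀ x, ∀ t ∈ Set.uIcc a b, HasDerivAt (f x) (g x t) t)
    (hgt : ∀ x, Continuous (g x)) (hgx : ∀ t, Continuous fun x => g x t)
    (hK : ∀ t ∈ Set.uIcc a b, ∫ x in cubeN N, |g x t| ≤ K)
    (hB : ∀ t ∈ Set.uIcc a b, |∫ x in cubeN N, g x t| ≤ B) :
    |(∫ x in cubeN N, f x b) - (∫ x in cubeN N, f x a)| ≤ B * |b - a| := by
  rw [(ff_eq N hfc hd hgt hgx hK).2]
  rw [← Real.norm_eq_abs]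
  refine intervalIntegral.norm_integral_le_of_norm_le_const fun t ht => ?_
  exact hB t (Set.uIoc_subset_uIcc ht)

end ff

section ibp
variable {E : Type*} [NormedAddCommGroup E] [InnerProductSpace ℝ E]

/-- partial derivative -/
def pd (i : Fin 3) (f : V3 → E) (x : V3) : E := fderiv ℝ f x (Pi.single i 1)

/-- L2 norm on the cube -/
def nrm (N : ℕ) (f : V3 → E) : ℝ := Real.sqrt (∫ x in cubeN N, ‖f x‖ ^ 2)

/-- squared gradient norm -/
def gsq (N : ℕ) (f : V3 → E) : ℝ := ∫ x in cubeN N, ∑ i, ‖pd i f x‖ ^ 2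

lemma cont_pd {f : V3 → E} (hf : ContDiff ℝ 1 f) (i : Fin 3) : Continuous (pd i f) := by
  unfold pd
  exact (hf.continuous_fderiv one_ne_zero).clm_apply continuous_const

lemma contDiff_pd {f : V3 → E} (hf : ContDiff ℝ 2 f) (i : Fin 3) : ContDiff ℝ 1 (pd i f) := by
  unfold pd
  exact (hf.fderiv_right (m := 1) le_rfl).clm_apply contDiff_const

lemma per_pd {N : ℕ} {f : V3 → E} (hp : IsPerN N f) (i : Fin 3) : IsPerN N (pd i f) := by
  intro x k
  unfold pd
  rw [← fderiv_comp_add_right]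
  congr 2
  ext y
  exact hp y k

lemma per_add_fun {α : Type*} {N : ℕ} {f : V3 → α} (hp : IsPerN N f) (v : V3) :
    IsPerN N (fun x => f (x + v)) := by
  intro x k
  have := hp (x + v) k
  simp only at this ⊢
  rw [← this]; congr 1; abel

lemma per_comp {α β : Type*} {N : ℕ} {f : V3 → α} (hp : IsPerN N f) (g : α → β) :
    IsPerN N (fun x => g (f x)) := fun x k => by simp only [hp x k]

lemma per_comp2 {α β γ : Type*} {N : ℕ} {f : V3 → α} {f' : V3 → β} (hp : IsPerN N f)
    (hp' : IsPerN N f') (g : α → β → γ) :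
    IsPerN N (fun x => g (f x) (f' x)) := fun x k => by simp only [hp x k, hp' x k]

lemma hasDeriv_shift {f : V3 → E} (hf : ContDiff ℝ 1 f) (v x : V3) (t : ℝ) :
    HasDerivAt (fun s : ℝ => f (x + s • v)) (fderiv ℝ f (x + t • v) v) t := by
  have h1 : HasDerivAt (fun s : ℝ => x + s • v) v t := by
    simpa using ((hasDerivAt_id t).smul_const v).const_add x
  exact ((hf.differentiable one_ne_zero _).hasFDerivAt).comp_hasDerivAt t h1

lemma int_pd_zero (N : ℕ) (hN : 0 < N) {f : V3 → ℝ} (hf : ContDiff ℝ 1 f) (hp : IsPerN N f)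
    (i : Fin 3) : ∫ x in cubeN N, pd i f x = 0 := by
  have hc := cont_pd hf i
  have hpp := per_pd hp i
  have h := (ff_eq N (f := fun x t => f (x + t • Pi.single i 1))
    (g := fun x t => pd i f (x + t • Pi.single i 1)) (a := 0) (b := 1)
    (K := ∫ x in cubeN N, |pd i f x|)
    (fun t => by have := hf.continuous; fun_prop)
    (fun x t _ => hasDeriv_shift hf _ x t)
    (fun x => by fun_prop) (fun t => by fun_prop)
    (fun t _ => (shift_int N hN (f := fun x => |pd i f x|) (per_comp hpp _) _).le)).2
  simp_rw [shift_int N hN hpp, shift_int N hN hp] at h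
  simpa using h.symm

lemma pd_inner {f g : V3 → E} (hf : ContDiff ℝ 1 f) (hg : ContDiff ℝ 1 g) (i : Fin 3) (x : V3) :
    pd i (fun y => inner ℝ (f y) (g y)) x = inner ℝ (f x) (pd i g x) + inner ℝ (pd i f x) (g x) := by
  unfold pd
  rw [fderiv_inner_apply ℝ (hf.differentiable one_ne_zero x) (hg.differentiable one_ne_zero x)]

lemma ibp1 (N : ℕ) (hN : 0 < N) {f g : V3 → E} (hf : ContDiff ℝ 1 f) (hg : ContDiff ℝ 1 g)
    (hpf : IsPerN N f) (hpg : IsPerN N g) (i : Fin 3) :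
    ∫ x in cubeN N, inner ℝ (f x) (pd i g x) = - ∫ x in cubeN N, inner ℝ (pd i f x) (g x) := by
  have h := int_pd_zero N hN (hf.inner ℝ hg) (per_comp2 hpf hpg _) i
  simp_rw [pd_inner hf hg] at h
  have hc1 := cont_pd hf i
  have hc2 := cont_pd hg i
  have hc3 := hf.continuous
  have hc4 := hg.continuous
  rw [integral_add (intQ N (by fun_prop)) (intQ N (by fun_prop))] at h
  linarith

/-- generic Laplacian -/
def lapE (f : V3 → E) (x : V3) : E := ∑ i, pd i (pd i f) x

lemma cont_lap {f : V3 → E} (hf : ContDiff ℝ 2 f) : Continuous (lapE f) := by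
  unfold lapE
  exact continuous_finsetSum _ fun i _ => cont_pd (contDiff_pd hf i) i

lemma green (N : ℕ) (hN : 0 < N) {f g : V3 → E} (hf : ContDiff ℝ 1 f) (hg : ContDiff ℝ 2 g)
    (hpf : IsPerN N f) (hpg : IsPerN N g) :
    ∫ x in cubeN N, inner ℝ (f x) (lapE g x)
      = - ∫ x in cubeN N, ∑ i, inner ℝ (pd i f x) (pd i g x) := by
  unfold lapE
  simp_rw [inner_sum]
  have hc1 := fun i => cont_pd hf i
  have hc2 := fun i => cont_pd (hg.of_le one_le_two) i
  have hc3 := hf.continuous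
  have hc4 := fun i => cont_pd (contDiff_pd hg i) i
  rw [integral_finsetSum _ fun i _ => intQ N (by fun_prop),
    integral_finsetSum _ fun i _ => intQ N (by fun_prop), ← Finset.sum_neg_distrib]
  exact Finset.sum_congr rfl fun i _ => ibp1 N hN hf (contDiff_pd hg i) hpf (per_pd hpg i) i

end ibp

end part1

section part2

section l2
variable {E : Type*} [NormedAddCommGroup E] [InnerProductSpace ℝ E]

lemma nrm_nonneg (N : ℕ) (f : V3 → E) : 0 ≤ nrm N f := Real.sqrt_nonneg _

lemma nrm_sq (N : ℕ) (f : V3 → E) : nrm N f ^ 2 = ∫ x in cubeN N, ‖f x‖ ^ 2 :=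
  Real.sq_sqrt (integral_nonneg fun _ => by positivity)

lemma gsq_nonneg (N : ℕ) (f : V3 → E) : 0 ≤ gsq N f :=
  integral_nonneg fun _ => Finset.sum_nonneg fun _ _ => by positivity

lemma cs_real (N : ℕ) {f g : V3 → ℝ} (hf : Continuous f) (hg : Continuous g) :
    |∫ x in cubeN N, f x * g x| ≤ nrm N f * nrm N g := by
  have h : ∀ l : ℝ, 0 ≤ (∫ x in cubeN N, ‖g x‖ ^ 2) * (l * l) + (-2 * ∫ x in cubeN N, f x * g x) * l
      + ∫ x in cubeN N, ‖f x‖ ^ 2 := by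
    intro l
    have h0 : 0 ≤ ∫ x in cubeN N, (f x - l * g x) ^ 2 := integral_nonneg fun _ => by positivity
    have h1 : ∫ x in cubeN N, (f x - l * g x) ^ 2 = ∫ x in cubeN N,
        ((l * l) * ‖g x‖ ^ 2 + (-2 * l) * (f x * g x) + ‖f x‖ ^ 2) := by
      congr 1; ext x; simp only [Real.norm_eq_abs, sq_abs]; ring
    rw [integral_add (intQ N (by fun_prop)) (intQ N (by fun_prop)),
      integral_add (intQ N (by fun_prop)) (intQ N (by fun_prop)), integral_const_mul,
      integral_const_mul] at h1
    linarith
  have := discrim_le_zero h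
  rw [discrim] at this
  rw [nrm, nrm, ← Real.sqrt_mul (integral_nonneg fun _ => by positivity)]
  apply Real.abs_le_sqrt
  linarith

lemma cs_norm (N : ℕ) {F : Type*} [NormedAddCommGroup F] [InnerProductSpace ℝ F]
    {f : V3 → E} {g : V3 → F} (hf : Continuous f) (hg : Continuous g) :
    ∫ x in cubeN N, ‖f x‖ * ‖g x‖ ≤ nrm N f * nrm N g := by
  have := cs_real N hf.norm hg.norm
  simp only [nrm, norm_norm] at this ⊢
  exact (le_abs_self _).trans this

lemma cs_inner (N : ℕ) {f g : V3 → E} (hf : Continuous f) (hg : Continuous g) :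
    |∫ x in cubeN N, inner ℝ (f x) (g x)| ≤ nrm N f * nrm N g := by
  refine le_trans ?_ (cs_norm N hf hg)
  refine (abs_integral_le_integral_abs).trans ?_
  refine integral_mono (intQ N (by fun_prop)) (intQ N (by fun_prop)) fun x => ?_
  exact abs_real_inner_le_norm _ _

lemma nrm_mono (N : ℕ) {F : Type*} [NormedAddCommGroup F] [InnerProductSpace ℝ F]
    {f : V3 → E} {g : V3 → F} (hf : Continuous f) (hg : Continuous g)
    (h : ∀ x, ‖f x‖ ≤ ‖g x‖) : nrm N f ≤ nrm N g := by
  refine Real.sqrt_le_sqrt (integral_mono (intQ N (by fun_prop)) (intQ N (by fun_prop)) fun x => ?_)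
  have := h x
  simp only
  gcongr

lemma nrm_congr (N : ℕ) {F : Type*} [NormedAddCommGroup F] [InnerProductSpace ℝ F]
    {f : V3 → E} {g : V3 → F} 
    (h : ∀ x, ‖f x‖ = ‖g x‖) : nrm N f = nrm N g := by
  simp only [nrm, h]

lemma nrm_add_sq (N : ℕ) {f g : V3 → E} (hf : Continuous f) (hg : Continuous g) :
    nrm N (fun x => f x + g x) ^ 2 = nrm N f ^ 2 + 2 * (∫ x in cubeN N, inner ℝ (f x) (g x))
      + nrm N g ^ 2 := by
  simp only [nrm_sq]
  rw [← integral_const_mul, ← integral_add (intQ N (by fun_prop)) (intQ N (by fun_prop)),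
    ← integral_add (intQ N (by fun_prop)) (intQ N (by fun_prop))]
  congr 1; ext x
  exact norm_add_sq_real _ _

lemma nrm_sub_sq (N : ℕ) {f g : V3 → E} (hf : Continuous f) (hg : Continuous g) :
    nrm N (fun x => f x - g x) ^ 2 = nrm N f ^ 2 - 2 * (∫ x in cubeN N, inner ℝ (f x) (g x))
      + nrm N g ^ 2 := by
  simp only [nrm_sq]
  rw [← integral_const_mul, ← integral_sub (intQ N (by fun_prop)) (intQ N (by fun_prop)),
    ← integral_add (intQ N (by fun_prop)) (intQ N (by fun_prop))]
  congr 1; ext x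
  exact norm_sub_sq_real _ _

lemma nrm_add_le (N : ℕ) {f g : V3 → E} (hf : Continuous f) (hg : Continuous g) :
    nrm N (fun x => f x + g x) ≤ nrm N f + nrm N g := by
  refine abs_le_of_sq_le_sq' ?_ (add_nonneg (nrm_nonneg N f) (nrm_nonneg N g)) |>.2
  rw [nrm_add_sq N hf hg]
  have := (abs_le.1 (cs_inner N hf hg)).2
  nlinarith

lemma nrm_sub_le (N : ℕ) {f g : V3 → E} (hf : Continuous f) (hg : Continuous g) :
    nrm N (fun x => f x - g x) ≤ nrm N f + nrm N g := by
  refine abs_le_of_sq_le_sq' ?_ (add_nonneg (nrm_nonneg N f) (nrm_nonneg N g)) |>.2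
  rw [nrm_sub_sq N hf hg]
  have := (abs_le.1 (cs_inner N hf hg)).1
  nlinarith

lemma nrm_const_mul (N : ℕ) (f : V3 → E) (c : ℝ) : nrm N (fun x => c • f x) = |c| * nrm N f := by
  unfold nrm
  simp only [norm_smul, mul_pow, Real.norm_eq_abs, sq_abs]
  rw [integral_const_mul, Real.sqrt_mul (sq_nonneg c), Real.sqrt_sq_eq_abs]

lemma int_norm_le (N : ℕ) {f : V3 → E} (hf : Continuous f) :
    ∫ x in cubeN N, ‖f x‖ ≤ Real.sqrt ((N : ℝ) ^ 3) * nrm N f := by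
  have := cs_norm N (f := fun _ : V3 => (1 : ℝ)) continuous_const hf
  simp only [norm_one, one_mul] at this
  refine this.trans (le_of_eq ?_)
  congr 1
  simp [nrm, volume_real_cubeN]

/-- fourth-power norm -/
def n4 (N : ℕ) (f : V3 → E) : ℝ := Real.sqrt (nrm N (fun x => ‖f x‖ ^ 2))

lemma n4_nonneg (N : ℕ) (f : V3 → E) : 0 ≤ n4 N f := Real.sqrt_nonneg _

lemma nrm_mul_le (N : ℕ) {F : Type*} [NormedAddCommGroup F] [InnerProductSpace ℝ F]
    {f : V3 → E} {g : V3 → F} (hf : Continuous f) (hg : Continuous g) :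
    nrm N (fun x => ‖f x‖ * ‖g x‖) ≤ n4 N f * n4 N g := by
  rw [n4, n4, ← Real.sqrt_mul (nrm_nonneg _ _)]
  refine Real.sqrt_le_sqrt ?_
  have := cs_norm N (f := fun x => ‖f x‖ ^ 2) (g := fun x => ‖g x‖ ^ 2) (by fun_prop) (by fun_prop)
  simpa [mul_pow] using this

lemma holder3 (N : ℕ) {F G : Type*} [NormedAddCommGroup F] [InnerProductSpace ℝ F]
    [NormedAddCommGroup G] [InnerProductSpace ℝ G]
    {f : V3 → E} {g : V3 → F} {h : V3 → G} (hf : Continuous f) (hg : Continuous g)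
    (hh : Continuous h) :
    ∫ x in cubeN N, ‖f x‖ * (‖g x‖ * ‖h x‖) ≤ nrm N f * (n4 N g * n4 N h) := by
  have h1 := cs_norm N (f := f) (g := fun x => ‖g x‖ * ‖h x‖) hf (by fun_prop)
  simp only [norm_mul, norm_norm] at h1
  exact h1.trans (mul_le_mul_of_nonneg_left (nrm_mul_le N hg hh) (nrm_nonneg _ _))

lemma fderiv_eq_sum (f : V3 → E) (x v : V3) :
    fderiv ℝ f x v = ∑ i, v i • pd i f x := by
  have hv : v = ∑ i, v i • (Pi.single i 1 : V3) := by
    ext j; simp [Finset.sum_apply, Pi.single_apply]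
  conv_lhs => rw [hv]
  simp [pd]

lemma norm_fderiv_sq_le (f : V3 → E) (x v : V3) :
    ‖fderiv ℝ f x v‖ ^ 2 ≤ (∑ i, v i ^ 2) * ∑ i, ‖pd i f x‖ ^ 2 := by
  rw [fderiv_eq_sum]
  have h1 : ‖∑ i, v i • pd i f x‖ ≤ ∑ i, |v i| * ‖pd i f x‖ := by
    refine (norm_sum_le _ _).trans (le_of_eq ?_)
    simp [norm_smul]
  have h2 := Finset.sum_mul_sq_le_sq_mul_sq Finset.univ (fun i => |v i|) (fun i => ‖pd i f x‖)
  simp only [sq_abs] at h2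
  refine le_trans ?_ h2
  gcongr

lemma shift_nrm (N : ℕ) (hN : 0 < N) {f : V3 → E} (hf : ContDiff ℝ 1 f) (hp : IsPerN N f) (v : V3) :
    nrm N (fun x => f (x + v) - f x) ≤ nrm N (fun x => fderiv ℝ f x v) := by
  set φ : V3 → E := fun x => f (x + v) - f x with hφ
  set D : V3 → E := fun x => fderiv ℝ f x v with hD
  have hDc : Continuous D := (hf.continuous_fderiv one_ne_zero).clm_apply continuous_const
  have hDp : IsPerN N D := by
    have : D = fun x => ∑ i, v i • pd i f x := by ext x; exact fderiv_eq_sum f x v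
    rw [this]
    intro x k
    simp only [per_pd hp _ x k]
  have hfc := hf.continuous
  have hφc : Continuous φ := by fun_prop
  have hDs : ∀ t : ℝ, nrm N (fun x => D (x + t • v)) = nrm N D := by
    intro t
    unfold nrm
    congr 1
    exact shift_int N hN (f := fun x => ‖D x‖ ^ 2) (per_comp hDp fun y => ‖y‖ ^ 2) _
  have h := ff_le N (f := fun x t => inner ℝ (φ x) (f (x + t • v)))
    (g := fun x t => inner ℝ (φ x) (D (x + t • v))) (a := 0) (b := 1)
    (K := nrm N φ * nrm N D) (B := nrm N φ * nrm N D)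
    (fun t => by fun_prop)
    (fun x t _ => by
      have := (hasDerivAt_const t (φ x)).inner ℝ (hasDeriv_shift hf v x t)
      simpa using this)
    (fun x => by fun_prop) (fun t => by fun_prop)
    (fun t _ => by
      rw [← hDs t]
      refine le_trans ?_ (cs_norm N hφc (g := fun x => D (x + t • v)) (by fun_prop))
      exact integral_mono (intQ N (by fun_prop)) (intQ N (by fun_prop)) fun x =>
        abs_real_inner_le_norm _ _)
    (fun t _ => by
      rw [← hDs t]
      exact cs_inner N hφc (by fun_prop))
  have h2 : nrm N φ ^ 2 ≤ nrm N φ * nrm N D := by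
    rw [nrm_sq]
    rw [← integral_sub (intQ N (by fun_prop)) (intQ N (by fun_prop))] at h
    refine le_trans (le_of_eq ?_) ((le_abs_self _).trans (h.trans (by simp)))
    congr 1; ext x
    simp only [one_smul, zero_smul, add_zero]
    rw [← inner_sub_right, ← real_inner_self_eq_norm_sq]
  by_contra hlt
  push Not at hlt
  have : 0 < nrm N φ := lt_of_le_of_lt (nrm_nonneg N D) hlt
  nlinarith

variable [CompleteSpace E]

/-- mean value -/
def avg (N : ℕ) (f : V3 → E) : E := ((N : ℝ) ^ 3)⁻¹ • ∫ x in cubeN N, f x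

lemma poincare (N : ℕ) (hN : 0 < N) {f : V3 → E} (hf : ContDiff ℝ 1 f) (hp : IsPerN N f) :
    nrm N (fun x => f x - avg N f) ≤ 2 * N * Real.sqrt (gsq N f) := by
  have hN' : (0 : ℝ) < N := by exact_mod_cast hN
  have hfc := hf.continuous
  set w : ℝ := (N : ℝ) ^ 3 with hw
  have hw0 : 0 < w := by positivity
  have hcg : Continuous fun x => ∑ i, ‖pd i f x‖ ^ 2 := by
    have := fun i => cont_pd hf i
    fun_prop
  -- pointwise bound
  have hpt : ∀ x, ‖f x - avg N f‖ ^ 2 ≤ w⁻¹ * ∫ v in cubeN N, ‖f (x + v) - f x‖ ^ 2 := by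
    intro x
    have e1 : w • (avg N f - f x) = ∫ v in cubeN N, (f (x + v) - f x) := by
      rw [integral_sub (intQ N (by fun_prop)) (intQ N (by fun_prop)), const_int]
      have : ∫ v in cubeN N, f (x + v) = ∫ v in cubeN N, f v := by
        simp_rw [add_comm x]; exact shift_int N hN hp x
      rw [this, smul_sub, avg, smul_smul, mul_inv_cancel₀ hw0.ne', one_smul]
    have e2 : w * ‖f x - avg N f‖ ≤ Real.sqrt w * nrm N (fun v => f (x + v) - f x) := by
      calc w * ‖f x - avg N f‖ = ‖w • (avg N f - f x)‖ := by
            rw [norm_smul, Real.norm_of_nonneg hw0.le, norm_sub_rev]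
        _ = ‖∫ v in cubeN N, (f (x + v) - f x)‖ := by rw [e1]
        _ ≤ ∫ v in cubeN N, ‖f (x + v) - f x‖ := norm_integral_le_integral_norm _
        _ ≤ _ := int_norm_le N (by fun_prop)
    have e3 := pow_le_pow_left₀ (by positivity) e2 2
    rw [mul_pow, mul_pow, Real.sq_sqrt hw0.le, nrm_sq] at e3
    rw [inv_mul_eq_div, le_div_iff₀ hw0]
    nlinarith
  have hI : Integrable (Function.uncurry fun (x v : V3) => ‖f (x + v) - f x‖ ^ 2)
      ((volume.restrict (cubeN N)).prod (volume.restrict (cubeN N))) := by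
    rw [Measure.prod_restrict]
    have hc : Continuous (Function.uncurry fun (x v : V3) => ‖f (x + v) - f x‖ ^ 2) := by
      unfold Function.uncurry; fun_prop
    exact (hc.continuousOn.integrableOn_compact (isCompact_Icc.prod isCompact_Icc)).mono_set
      (Set.prod_mono (cubeN_subset N) (cubeN_subset N))
  have hint : ∫ x in cubeN N, (w⁻¹ * ∫ v in cubeN N, ‖f (x + v) - f x‖ ^ 2)
      = w⁻¹ * ∫ v in cubeN N, ∫ x in cubeN N, ‖f (x + v) - f x‖ ^ 2 := by
    rw [integral_const_mul]
    congr 1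
    exact integral_integral_swap (f := fun x v => ‖f (x + v) - f x‖ ^ 2) hI
  have hin : ∀ v ∈ cubeN N, ∫ x in cubeN N, ‖f (x + v) - f x‖ ^ 2 ≤ (3 * N ^ 2) * gsq N f := by
    intro v hv
    rw [← nrm_sq]
    have h1 := pow_le_pow_left₀ (nrm_nonneg _ _) (shift_nrm N hN hf hp v) 2
    refine h1.trans ?_
    rw [nrm_sq, gsq, ← integral_const_mul]
    have hDc : Continuous fun x => fderiv ℝ f x v :=
      (hf.continuous_fderiv one_ne_zero).clm_apply continuous_const
    refine integral_mono (intQ N (by fun_prop)) (intQ N (by fun_prop)) fun x => ?_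
    refine (norm_fderiv_sq_le f x v).trans ?_
    refine mul_le_mul_of_nonneg_right ?_ (Finset.sum_nonneg fun _ _ => by positivity)
    rw [Fin.sum_univ_three]
    have h0 := hv 0
    have h1 := hv 1
    have h2 := hv 2
    simp only [Set.mem_Ico] at h0 h1 h2
    nlinarith
  have hcont : Continuous fun x => ∫ v in cubeN N, ‖f (x + v) - f x‖ ^ 2 := by
    have : ∀ x, ∫ v in cubeN N, ‖f (x + v) - f x‖ ^ 2 = (∫ v in cubeN N, ‖f v‖ ^ 2)
        - 2 * inner ℝ (f x) (∫ v in cubeN N, f v) + w * ‖f x‖ ^ 2 := by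
      intro x
      have e : ∀ v, ‖f (x + v) - f x‖ ^ 2 = ‖f (v + x)‖ ^ 2 - 2 * inner ℝ (f x) (f (v + x)) + ‖f x‖ ^ 2 := by
        intro v; rw [norm_sub_sq_real, add_comm x v, real_inner_comm]
      simp_rw [e]
      rw [integral_add (intQ N (by fun_prop)) (intQ N (by fun_prop)),
        integral_sub (intQ N (by fun_prop)) (intQ N (by fun_prop)), integral_const_mul,
        shift_int N hN (f := fun x => ‖f x‖ ^ 2) (per_comp hp fun y => ‖y‖ ^ 2),
        integral_inner (𝕜 := ℝ) (intQ N (by fun_prop)), shift_int N hN hp, const_int]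
      simp [hw]
    simp_rw [this]
    fun_prop
  have hcont2 : IntegrableOn (fun v => ∫ x in cubeN N, ‖f (x + v) - f x‖ ^ 2) (cubeN N) :=
    hI.integral_prod_right
  have hfin : nrm N (fun x => f x - avg N f) ^ 2 ≤ 3 * N ^ 2 * gsq N f := by
    rw [nrm_sq]
    calc _ ≤ ∫ x in cubeN N, (w⁻¹ * ∫ v in cubeN N, ‖f (x + v) - f x‖ ^ 2) :=
          integral_mono (intQ N (by fun_prop)) (intQ N (by fun_prop)) hpt
      _ = w⁻¹ * ∫ v in cubeN N, ∫ x in cubeN N, ‖f (x + v) - f x‖ ^ 2 := hint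
      _ ≤ w⁻¹ * ∫ v in cubeN N, (3 * N ^ 2) * gsq N f := by
          gcongr ?_ * ?_
          refine setIntegral_mono_on hcont2 (intQ N (by fun_prop)) (measurableSet_cubeN N) hin
      _ = _ := by
          rw [const_int, smul_eq_mul, ← mul_assoc, inv_mul_cancel₀ hw0.ne', one_mul]
  refine abs_le_of_sq_le_sq' ?_ (by positivity) |>.2
  rw [mul_pow, Real.sq_sqrt (gsq_nonneg _ _)]
  nlinarith [gsq_nonneg N f, sq_nonneg (N : ℝ), mul_nonneg (sq_nonneg (N : ℝ)) (gsq_nonneg N f)]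

end l2

end part2

section part3

section sob
variable {E : Type*} [NormedAddCommGroup E] [InnerProductSpace ℝ E]

lemma lint_shift (N : ℕ) {g : V3 → ENNReal} (hg : IsPerN N g) (k : Fin 3 → ℤ) :
    ∫⁻ x in {x : V3 | x - (fun i => (N : ℝ) * (k i : ℝ)) ∈ cubeN N}, g x = ∫⁻ x in cubeN N, g x := by
  set v : V3 := fun i => (N : ℝ) * (k i : ℝ) with hv
  have hset : MeasurableSet {x : V3 | x - v ∈ cubeN N} :=
    (measurable_id.sub_const v) (measurableSet_cubeN N)
  rw [← lintegral_indicator hset, ← lintegral_indicator (measurableSet_cubeN N)]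
  rw [← lintegral_add_right_eq_self _ v]
  congr 1
  ext x
  simp only [Set.indicator, hg x k, hv]
  have : (x + v ∈ {x : V3 | x - v ∈ cubeN N}) ↔ x ∈ cubeN N := by
    change x + v - v ∈ cubeN N ↔ _
    rw [add_sub_cancel_right]
  by_cases h : x ∈ cubeN N
  · rw [if_pos h, if_pos (this.2 h)]
  · rw [if_neg h, if_neg (fun h' => h (this.1 h'))]

lemma lint_box (N : ℕ) (hN : 0 < N) {g : V3 → ENNReal} (hg : IsPerN N g) :
    ∃ s : Finset (Fin 3 → ℤ), s.card = 64 ∧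
    ∫⁻ x in Metric.ball (0 : V3) (2 * N), g x ≤ s.card * ∫⁻ x in cubeN N, g x := by
  have hN' : (0 : ℝ) < N := by exact_mod_cast hN
  let s : Finset (Fin 3 → ℤ) := Fintype.piFinset fun _ => Finset.Ico (-2 : ℤ) 2
  refine ⟨s, by simp [s], ?_⟩
  let A : (Fin 3 → ℤ) → Set V3 := fun k => {x : V3 | x - (fun i => (N : ℝ) * (k i : ℝ)) ∈ cubeN N}
  have hsub : Metric.ball (0 : V3) (2 * N) ⊆ ⋃ k ∈ s, A k := by
    intro x hx
    rw [mem_ball_zero_iff, pi_norm_lt_iff (by positivity)] at hx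
    simp only [Set.mem_iUnion]
    refine ⟨fun i => ⌊x i / N⌋, ?_, ?_⟩
    · simp only [s, Fintype.mem_piFinset, Finset.mem_Ico]
      intro i
      have h := abs_lt.1 (hx i)
      constructor
      · rw [Int.le_floor, le_div_iff₀ hN']; push_cast; linarith
      · rw [Int.floor_lt, div_lt_iff₀ hN']; push_cast; linarith
    · intro i
      have h1 := Int.floor_le (x i / N)
      have h2 := Int.lt_floor_add_one (x i / N)
      rw [le_div_iff₀ hN'] at h1
      rw [div_lt_iff₀ hN'] at h2
      simp only [Pi.sub_apply, Set.mem_Ico]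
      constructor <;> nlinarith
  calc ∫⁻ x in Metric.ball (0 : V3) (2 * N), g x ≤ ∫⁻ x in ⋃ k ∈ s, A k, g x :=
        lintegral_mono_set hsub
    _ ≤ ∑ k ∈ s, ∫⁻ x in A k, g x := by
        induction s using Finset.induction_on with
        | empty => simp
        | insert a s ha ih =>
          rw [Finset.sum_insert ha, Finset.set_biUnion_insert]
          exact (lintegral_union_le _ _ _).trans (add_le_add le_rfl (ih))
    _ = _ := by
        simp_rw [A, lint_shift N hg]; simp

lemma n4_pow (N : ℕ) (f : V3 → E) : n4 N f ^ 4 = ∫ x in cubeN N, ‖f x‖ ^ 4 := by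
  have : n4 N f ^ 4 = (n4 N f ^ 2) ^ 2 := by ring
  rw [this, n4, Real.sq_sqrt (nrm_nonneg _ _), nrm_sq]
  congr 1; ext x; rw [Real.norm_of_nonneg (by positivity)]; ring

theorem sobolev (E : Type*) [NormedAddCommGroup E] [InnerProductSpace ℝ E] [FiniteDimensional ℝ E]
    (N : ℕ) (hN : 0 < N) : ∃ C : ℝ, 0 ≤ C ∧ ∀ f : V3 → E, ContDiff ℝ 1 f → IsPerN N f →
      n4 N f ≤ C * (nrm N f + Real.sqrt (gsq N f)) := by
  have hN' : (0 : ℝ) < N := by exact_mod_cast hN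
  let χ : ContDiffBump (0 : V3) := ⟨N, 2 * N, hN', by linarith⟩
  have hχ : ContDiff ℝ 1 χ := χ.contDiff
  obtain ⟨L, hL⟩ : ∃ L : ℝ, ∀ x, ‖fderiv ℝ χ x‖ ≤ L := by
    exact (hχ.continuous_fderiv one_ne_zero).bounded_above_of_compact_support
      (χ.hasCompactSupport.fderiv (𝕜 := ℝ))
  have hL0 : 0 ≤ L := (norm_nonneg _).trans (hL 0)
  let A : NNReal := eLpNormLESNormFDerivOfLeConst E (volume : Measure V3)
    (Metric.ball (0 : V3) (2 * N)) 2 4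
  set D : ℝ := 6 + 2 * L ^ 2 with hD
  refine ⟨(A : ℝ) * Real.sqrt (64 * D), by positivity, fun f hf hp => ?_⟩
  have hfc := hf.continuous
  have hcg : ∀ i, Continuous (pd i f) := cont_pd hf
  let G : V3 → ℝ := fun x => D * (‖f x‖ ^ 2 + ∑ i, ‖pd i f x‖ ^ 2)
  have hGc : Continuous G := by simp only [G]; fun_prop
  have hG0 : ∀ x, 0 ≤ G x := fun x => by simp only [G]; positivity
  have hGp : IsPerN N G := fun x k => by
    simp only [G, hp x k]; congr 2
    exact Finset.sum_congr rfl fun i _ => by rw [per_pd hp i x k]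
  let u : V3 → E := fun x => χ x • f x
  have hu : ContDiff ℝ 1 u := hχ.smul hf
  have hsupp : u.support ⊆ Metric.ball (0 : V3) (2 * N) := by
    intro x hx
    have : x ∈ Function.support χ := by
      intro h; apply hx; simp [u, h]
    rwa [χ.support_eq] at this
  have key := eLpNorm_le_eLpNorm_fderiv_of_le (volume : Measure V3) (F := E) hu hsupp
    (p := 2) (q := 4) (by norm_num) (by simp; norm_num) (by simp; norm_num) Metric.isBounded_ball
  -- bound on derivative
  have hDu : ∀ x, ‖fderiv ℝ u x‖ ^ 2 ≤ G x := by
    intro x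
    have e1 : fderiv ℝ u x = χ x • fderiv ℝ f x + (fderiv ℝ χ x).smulRight (f x) :=
      fderiv_fun_smul (hχ.differentiable one_ne_zero x) (hf.differentiable one_ne_zero x)
    have e2 : ‖fderiv ℝ f x‖ ^ 2 ≤ 3 * ∑ i, ‖pd i f x‖ ^ 2 := by
      have : ‖fderiv ℝ f x‖ ≤ Real.sqrt (3 * ∑ i, ‖pd i f x‖ ^ 2) := by
        refine ContinuousLinearMap.opNorm_le_bound _ (Real.sqrt_nonneg _) fun v => ?_
        have h := norm_fderiv_sq_le f x v
        refine abs_le_of_sq_le_sq' ?_ (by positivity) |>.2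
        rw [mul_pow, Real.sq_sqrt (by positivity)]
        refine h.trans ?_
        have : ∑ i, v i ^ 2 ≤ 3 * ‖v‖ ^ 2 := by
          have : ∀ i, v i ^ 2 ≤ ‖v‖ ^ 2 := fun i => by
            rw [← sq_abs]; exact pow_le_pow_left₀ (abs_nonneg _) (norm_le_pi_norm v i) 2
          rw [Fin.sum_univ_three]; linarith [this 0, this 1, this 2]
        have h0 : 0 ≤ ∑ i, ‖pd i f x‖ ^ 2 := by positivity
        nlinarith
      calc ‖fderiv ℝ f x‖ ^ 2 ≤ _ := pow_le_pow_left₀ (norm_nonneg _) this 2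
        _ = _ := Real.sq_sqrt (by positivity)
    have e3 : ‖fderiv ℝ u x‖ ≤ ‖fderiv ℝ f x‖ + L * ‖f x‖ := by
      rw [e1]
      refine (norm_add_le _ _).trans (add_le_add ?_ ?_)
      · rw [norm_smul, Real.norm_of_nonneg χ.nonneg]
        exact mul_le_of_le_one_left (norm_nonneg _) χ.le_one
      · rw [ContinuousLinearMap.norm_smulRight_apply]
        exact mul_le_mul_of_nonneg_right (hL x) (norm_nonneg _)
    have e4 := pow_le_pow_left₀ (norm_nonneg _) e3 2
    have h0 : 0 ≤ ∑ i, ‖pd i f x‖ ^ 2 := by positivity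
    have h1 := sq_nonneg ‖f x‖
    simp only [G, hD]
    nlinarith [sq_nonneg (‖fderiv ℝ f x‖ - L * ‖f x‖), mul_nonneg (sq_nonneg L) h0]
  have hDz : ∀ x, x ∉ Metric.ball (0 : V3) (2 * N) → fderiv ℝ u x = 0 := by
    intro x hx
    have hx' : χ x = 0 := by
      by_contra h
      exact hx (by rw [← χ.support_eq (c := (0:V3))]; exact h)
    have : IsLocalMin χ x := Filter.Eventually.of_forall fun y => by rw [hx']; exact χ.nonneg
    have e1 : fderiv ℝ u x = χ x • fderiv ℝ f x + (fderiv ℝ χ x).smulRight (f x) :=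
      fderiv_fun_smul (hχ.differentiable one_ne_zero x) (hf.differentiable one_ne_zero x)
    rw [e1, hx', this.fderiv_eq_zero]; simp
  have hlin : ∫⁻ x, ‖fderiv ℝ u x‖ₑ ^ (2 : ℝ) ≤ 64 * ENNReal.ofReal (∫ x in cubeN N, G x) := by
    obtain ⟨s, hs, hle⟩ := lint_box N hN (g := fun x => ENNReal.ofReal (G x)) (per_comp hGp _)
    rw [hs] at hle
    rw [ofReal_integral_eq_lintegral_ofReal (intQ N hGc) (Filter.Eventually.of_forall hG0)]
    refine le_trans ?_ hle
    rw [← lintegral_indicator Metric.isOpen_ball.measurableSet]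
    refine lintegral_mono fun x => ?_
    by_cases hx : x ∈ Metric.ball (0 : V3) (2 * N)
    · simp only [Set.indicator_of_mem hx]
      rw [← ofReal_norm, ENNReal.ofReal_rpow_of_nonneg (norm_nonneg _) (by norm_num)]
      exact ENNReal.ofReal_le_ofReal (by simpa using hDu x)
    · have h0 : ‖fderiv ℝ u x‖ₑ = 0 := by
        rw [← ofReal_norm, hDz x hx, norm_zero, ENNReal.ofReal_zero]
      rw [h0, ENNReal.zero_rpow_of_pos (by norm_num)]; exact zero_le
  have hlow : ENNReal.ofReal (n4 N f ^ 4) ≤ ∫⁻ x, ‖u x‖ₑ ^ (4 : ℝ) := by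
    rw [n4_pow, ofReal_integral_eq_lintegral_ofReal (intQ N (by fun_prop))
      (Filter.Eventually.of_forall fun x => by positivity)]
    rw [← lintegral_indicator (measurableSet_cubeN N)]
    refine lintegral_mono fun x => ?_
    by_cases hx : x ∈ cubeN N
    · simp only [Set.indicator_of_mem hx]
      have hx1 : χ x = 1 := by
        apply χ.one_of_mem_closedBall
        rw [mem_closedBall_zero_iff, pi_norm_le_iff_of_nonneg hN'.le]
        intro i
        have := hx i
        rw [Real.norm_of_nonneg this.1]; exact this.2.le
      simp only [u, hx1, one_smul]
      rw [← ofReal_norm, ENNReal.ofReal_rpow_of_nonneg (norm_nonneg _) (by norm_num)]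
      exact ENNReal.ofReal_le_ofReal (by norm_cast)
    · simp [Set.indicator_of_notMem hx]
  have p4 := eLpNorm_nnreal_pow_eq_lintegral (f := u) (μ := volume) (p := 4) (by norm_num)
  have p2 := eLpNorm_nnreal_pow_eq_lintegral (f := fderiv ℝ u) (μ := volume) (p := 2) (by norm_num)
  norm_num at p4 p2 
  norm_num at hlow hlin
  rw [← p2] at hlin
  rw [← p4] at hlow
  set X := eLpNorm u 4 volume
  set W := eLpNorm (fderiv ℝ u) 2 volume
  have key' : X ≤ A * W := key
  have k4 : X ^ 4 ≤ (A : ENNReal) ^ 4 * (W ^ 2) ^ 2 := by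
    calc X ^ 4 ≤ (A * W) ^ 4 := by gcongr
      _ = _ := by ring
  have k5 : ENNReal.ofReal (n4 N f ^ 4) ≤
      ENNReal.ofReal ((A : ℝ) ^ 4 * (64 * ∫ x in cubeN N, G x) ^ 2) := by
    have hI0 : 0 ≤ ∫ x in cubeN N, G x := integral_nonneg hG0
    rw [ENNReal.ofReal_mul (by positivity), ENNReal.ofReal_pow (NNReal.coe_nonneg A),
      ENNReal.ofReal_pow (p := 64 * _) (by positivity), ENNReal.ofReal_mul (by norm_num)]
    have hA : ENNReal.ofReal (A : ℝ) = A := ENNReal.ofReal_coe_nnreal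
    rw [hA]
    have h1 : ENNReal.ofReal (n4 N f ^ 4) ≤ X ^ 4 := hlow
    refine h1.trans (k4.trans ?_)
    gcongr
    simpa using hlin
  have hI0 : 0 ≤ ∫ x in cubeN N, G x := integral_nonneg hG0
  have k6 := (ENNReal.ofReal_le_ofReal_iff (by positivity)).1 k5
  have hGI : ∫ x in cubeN N, G x = D * (nrm N f ^ 2 + gsq N f) := by
    simp only [G]
    rw [integral_const_mul, integral_add (intQ N (by fun_prop)) (intQ N (by fun_prop)), nrm_sq, gsq]
  rw [hGI] at k6
  have hg0 := gsq_nonneg N f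
  have hn0 := nrm_nonneg N f
  refine (pow_le_pow_iff_left₀ (n4_nonneg _ _) (by positivity) (n := 4) (by norm_num)).1 ?_
  refine k6.trans ?_
  have e : ((A : ℝ) * Real.sqrt (64 * D) * (nrm N f + Real.sqrt (gsq N f))) ^ 4
      = (A : ℝ) ^ 4 * ((Real.sqrt (64 * D)) ^ 2) ^ 2 * ((nrm N f + Real.sqrt (gsq N f)) ^ 2) ^ 2 := by ring
  rw [e, Real.sq_sqrt (by positivity), mul_assoc, ← mul_pow]
  have h : nrm N f ^ 2 + gsq N f ≤ (nrm N f + Real.sqrt (gsq N f)) ^ 2 := by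
    have := Real.sq_sqrt hg0
    have := Real.sqrt_nonneg (gsq N f)
    nlinarith
  have hD0 : 0 ≤ D := by positivity
  refine mul_le_mul_of_nonneg_left ?_ (by positivity)
  refine pow_le_pow_left₀ (by positivity) ?_ 2
  rw [mul_assoc]
  exact mul_le_mul_of_nonneg_left (mul_le_mul_of_nonneg_left h hD0) (by norm_num)

end sob

end part3

section part4

section static
variable {E : Type*} [NormedAddCommGroup E] [InnerProductSpace ℝ E]

lemma per_bdd (N : ℕ) (hN : 0 < N) {F : Type*} [NormedAddCommGroup F] {f : V3 → F}
    (hf : Continuous f) (hp : IsPerN N f) : ∃ C, 0 ≤ C ∧ ∀ x, ‖f x‖ ≤ C := by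
  have hN' : (0 : ℝ) < N := by exact_mod_cast hN
  obtain ⟨C, h0, hC⟩ := bddQ N hf
  refine ⟨C, h0, fun x => ?_⟩
  have := hp x (fun i => -⌊x i / N⌋)
  rw [← this]
  apply hC
  intro i
  have h1 := Int.floor_le (x i / N)
  have h2 := Int.lt_floor_add_one (x i / N)
  rw [le_div_iff₀ hN'] at h1
  rw [div_lt_iff₀ hN'] at h2
  simp only [Pi.add_apply, Set.mem_Ico]
  push_cast
  constructor <;> nlinarith

lemma per_fderiv {N : ℕ} {f : V3 → E} (hp : IsPerN N f) : IsPerN N (fderiv ℝ f) := by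
  intro x k
  rw [← fderiv_comp_add_right]
  congr 1
  ext y
  exact hp y k

lemma per_lip (N : ℕ) (hN : 0 < N) {f : V3 → E}
    (hf : ContDiff ℝ 1 f) (hp : IsPerN N f) : ∃ C, 0 ≤ C ∧ ∀ x y, ‖f x - f y‖ ≤ C * ‖x - y‖ := by
  obtain ⟨C, h0, hC⟩ := per_bdd N hN (hf.continuous_fderiv one_ne_zero) (per_fderiv hp)
  refine ⟨C, h0, fun x y => ?_⟩
  exact Convex.norm_image_sub_le_of_norm_fderiv_le (s := Set.univ)
    (fun z _ => hf.differentiable one_ne_zero z) (fun z _ => hC z) convex_univ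
    (Set.mem_univ _) (Set.mem_univ _)

lemma pd_sub {f g : V3 → E} (hf : ContDiff ℝ 1 f) (hg : ContDiff ℝ 1 g) (i : Fin 3) :
    pd i (fun x => f x - g x) = fun x => pd i f x - pd i g x := by
  ext x; unfold pd
  rw [fderiv_fun_sub (hf.differentiable one_ne_zero x) (hg.differentiable one_ne_zero x)]; rfl

lemma pd_add {f g : V3 → E} (hf : ContDiff ℝ 1 f) (hg : ContDiff ℝ 1 g) (i : Fin 3) :
    pd i (fun x => f x + g x) = fun x => pd i f x + pd i g x := by
  ext x; unfold pd
  rw [fderiv_fun_add (hf.differentiable one_ne_zero x) (hg.differentiable one_ne_zero x)]; rfl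

lemma lap_sub {f g : V3 → E} (hf : ContDiff ℝ 2 f) (hg : ContDiff ℝ 2 g) (x : V3) :
    lapE (fun x => f x - g x) x = lapE f x - lapE g x := by
  unfold lapE
  simp_rw [pd_sub (hf.of_le one_le_two) (hg.of_le one_le_two),
    pd_sub (contDiff_pd hf _) (contDiff_pd hg _)]
  rw [Finset.sum_sub_distrib]

lemma lap_add {f g : V3 → E} (hf : ContDiff ℝ 2 f) (hg : ContDiff ℝ 2 g) (x : V3) :
    lapE (fun x => f x + g x) x = lapE f x + lapE g x := by
  unfold lapE
  simp_rw [pd_add (hf.of_le one_le_two) (hg.of_le one_le_two),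
    pd_add (contDiff_pd hf _) (contDiff_pd hg _)]
  rw [Finset.sum_add_distrib]

lemma gsq_eq (N : ℕ) (hN : 0 < N) {f : V3 → E} (hf : ContDiff ℝ 2 f) (hp : IsPerN N f) :
    gsq N f = - ∫ x in cubeN N, inner ℝ (f x) (lapE f x) := by
  rw [green N hN (hf.of_le one_le_two) hf hp hp, neg_neg, gsq]
  simp_rw [real_inner_self_eq_norm_sq]

/-- total ion density -/
def stot {N : ℕ} (σ : V3 → ℝ) (q : GammaIdx N → V3) (x : V3) : ℝ :=
  ∑ n : GammaIdx N, σ (x - embG n - q n)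

/-- a static Poisson state with normalised potential -/
structure PS (N : ℕ) (σ : V3 → ℝ) (e : ℝ) (ψ : V3 → ℂ) (Φ : V3 → ℝ) (q : GammaIdx N → V3) :
    Prop where
  c2ψ : ContDiff ℝ 2 ψ
  perψ : IsPerN N ψ
  c2Φ : ContDiff ℝ 2 Φ
  perΦ : IsPerN N Φ
  mean : ∫ x in cubeN N, Φ x = 0
  poi : ∀ x, - lapE Φ x = stot σ q x - e * ‖ψ x‖ ^ 2

lemma cont_stot {N : ℕ} {σ : V3 → ℝ} (hσ : Continuous σ) (q : GammaIdx N → V3) :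
    Continuous (stot σ q) := by
  unfold stot; fun_prop

lemma poincare0 (N : ℕ) (hN : 0 < N) {f : V3 → ℝ} (hf : ContDiff ℝ 1 f) (hp : IsPerN N f)
    (h0 : ∫ x in cubeN N, f x = 0) : nrm N f ≤ 2 * N * Real.sqrt (gsq N f) := by
  have := poincare N hN hf hp
  simpa [avg, h0] using this

/-- Poisson stability -/
lemma poisson_stab (N : ℕ) (hN : 0 < N) (σ : V3 → ℝ) (hσ : ContDiff ℝ 2 σ) (hσp : IsPerN N σ)
    (e : ℝ) (he : 0 < e) : ∃ C, 0 ≤ C ∧ ∀ ψ Φ q ψ' Φ' q', PS N σ e ψ Φ q → PS N σ e ψ' Φ' q' →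
      Real.sqrt (gsq N (fun x => Φ x - Φ' x)) ≤
          C * (‖q - q'‖ + nrm N (fun x => ψ x - ψ' x) * (n4 N ψ + n4 N ψ')) ∧
      nrm N (fun x => Φ x - Φ' x) ≤
          C * (‖q - q'‖ + nrm N (fun x => ψ x - ψ' x) * (n4 N ψ + n4 N ψ')) ∧
      n4 N (fun x => Φ x - Φ' x) ≤
          C * (‖q - q'‖ + nrm N (fun x => ψ x - ψ' x) * (n4 N ψ + n4 N ψ')) := by
  obtain ⟨S, hS0, hS⟩ := sobolev ℝ N hN
  obtain ⟨L, hL0, hL⟩ := per_lip N hN (hσ.of_le one_le_two) hσp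
  set A : ℝ := (Fintype.card (GammaIdx N)) * L * Real.sqrt ((N : ℝ) ^ 3) * (2 * N) with hA
  set B : ℝ := e * (S * (2 * N + 1)) with hB
  have hA0 : 0 ≤ A := by positivity
  have hB0 : 0 ≤ B := by positivity
  set C : ℝ := (A + B) * (1 + 2 * N + S * (2 * N + 1)) with hC
  refine ⟨C, by positivity, ?_⟩
  intro ψ Φ q ψ' Φ' q' h h'
  set u : V3 → ℝ := fun x => Φ x - Φ' x with hu
  have hu2 : ContDiff ℝ 2 u := h.c2Φ.sub h'.c2Φ
  have hu1 := hu2.of_le one_le_two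
  have hup : IsPerN N u := per_comp2 h.perΦ h'.perΦ fun a b => a - b
  have huc := hu2.continuous
  have cψ := h.c2ψ.continuous
  have cψ' := h'.c2ψ.continuous
  have cσ := hσ.continuous
  have hc1 := cont_stot cσ q
  have hc2 := cont_stot cσ q'
  have hmean : ∫ x in cubeN N, u x = 0 := by
    rw [hu, integral_sub (intQ N h.c2Φ.continuous) (intQ N h'.c2Φ.continuous), h.mean, h'.mean, sub_zero]
  have hpo := poincare0 N hN hu1 hup hmean
  have hso := hS u hu1 hup
  set g := Real.sqrt (gsq N u) with hg
  have hg0 : 0 ≤ g := Real.sqrt_nonneg _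
  have hgg : gsq N u = g ^ 2 := (Real.sq_sqrt (gsq_nonneg _ _)).symm
  have hn4 : n4 N u ≤ S * (2 * N + 1) * g := by
    refine hso.trans ?_
    rw [mul_assoc]
    exact mul_le_mul_of_nonneg_left (by linarith) hS0
  set w := nrm N (fun x => ψ x - ψ' x) with hw
  have hw0 : 0 ≤ w := nrm_nonneg _ _
  set P := n4 N ψ + n4 N ψ' with hP
  have hP0 : 0 ≤ P := add_nonneg (n4_nonneg _ _) (n4_nonneg _ _)
  have hst : ∀ x, |stot σ q x - stot σ q' x| ≤ Fintype.card (GammaIdx N) * L * ‖q - q'‖ := by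
    intro x
    unfold stot
    rw [← Finset.sum_sub_distrib]
    refine (Finset.abs_sum_le_sum_abs _ _).trans ?_
    calc _ ≤ ∑ n : GammaIdx N, L * ‖q - q'‖ := by
          refine Finset.sum_le_sum fun n _ => ?_
          refine (hL _ _).trans (mul_le_mul_of_nonneg_left ?_ hL0)
          have : x - embG n - q n - (x - embG n - q' n) = -((q - q') n) := by
            simp only [Pi.sub_apply]; abel
          rw [this, norm_neg]
          exact norm_le_pi_norm _ n
      _ = _ := by simp; ring
  have key : gsq N u ≤ (A * ‖q - q'‖ + B * (w * P)) * g := by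
    have e1 : gsq N u = (∫ x in cubeN N, u x * (stot σ q x - stot σ q' x))
        - e * ∫ x in cubeN N, u x * (‖ψ x‖ ^ 2 - ‖ψ' x‖ ^ 2) := by
      rw [gsq_eq N hN hu2 hup, ← integral_const_mul,
        ← integral_sub (intQ N (by fun_prop)) (intQ N (by fun_prop)), ← integral_neg]
      congr 1; ext x
      rw [lap_sub h.c2Φ h'.c2Φ]
      have p1 := h.poi x
      have p2 := h'.poi x
      simp only [RCLike.inner_apply, conj_trivial]
      linear_combination u x * p1 - u x * p2
    have e2 : |∫ x in cubeN N, u x * (stot σ q x - stot σ q' x)| ≤ A * ‖q - q'‖ * g := by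
      refine abs_integral_le_integral_abs.trans ?_
      calc _ ≤ ∫ x in cubeN N, (Fintype.card (GammaIdx N) * L * ‖q - q'‖) * ‖u x‖ := by
            refine integral_mono (intQ N (by fun_prop)) (intQ N (by fun_prop)) fun x => ?_
            simp only
            rw [abs_mul, mul_comm]
            exact mul_le_mul_of_nonneg_right (hst x) (abs_nonneg _)
        _ = (Fintype.card (GammaIdx N) * L * ‖q - q'‖) * ∫ x in cubeN N, ‖u x‖ := integral_const_mul _ _
        _ ≤ (Fintype.card (GammaIdx N) * L * ‖q - q'‖) * (Real.sqrt ((N : ℝ) ^ 3) * (2 * N * g)) := by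
            refine mul_le_mul_of_nonneg_left ?_ (by positivity)
            exact (int_norm_le N huc).trans (mul_le_mul_of_nonneg_left hpo (Real.sqrt_nonneg _))
        _ = _ := by rw [hA]; ring
    have e3 : |∫ x in cubeN N, u x * (‖ψ x‖ ^ 2 - ‖ψ' x‖ ^ 2)| ≤ w * (n4 N u * P) := by
      refine abs_integral_le_integral_abs.trans ?_
      calc _ ≤ ∫ x in cubeN N, (‖ψ x - ψ' x‖ * (‖u x‖ * ‖ψ x‖) + ‖ψ x - ψ' x‖ * (‖u x‖ * ‖ψ' x‖)) := by
            refine integral_mono (intQ N (by fun_prop)) (intQ N (by fun_prop)) fun x => ?_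
            simp only
            have : ‖ψ x‖ ^ 2 - ‖ψ' x‖ ^ 2 = (‖ψ x‖ - ‖ψ' x‖) * (‖ψ x‖ + ‖ψ' x‖) := by ring
            rw [this, abs_mul, abs_mul, Real.norm_eq_abs (u x),
              abs_of_nonneg (add_nonneg (norm_nonneg (ψ x)) (norm_nonneg (ψ' x)))]
            have h1 := abs_norm_sub_norm_le (ψ x) (ψ' x)
            have h2 : 0 ≤ |u x| * (‖ψ x‖ + ‖ψ' x‖) := by positivity
            nlinarith
        _ = _ := integral_add (intQ N (by fun_prop)) (intQ N (by fun_prop))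
        _ ≤ w * (n4 N u * n4 N ψ) + w * (n4 N u * n4 N ψ') :=
            add_le_add (holder3 N (by fun_prop) huc cψ) (holder3 N (by fun_prop) huc cψ')
        _ = _ := by rw [hP]; ring
    have e4 := (abs_le.1 e2).2
    have e5 := (abs_le.1 e3).1
    have e6 : w * (n4 N u * P) ≤ w * (S * (2 * N + 1) * g * P) := by gcongr
    rw [e1, hB]
    nlinarith
  have hfin : g ≤ (A + B) * (‖q - q'‖ + w * P) := by
    rw [hgg] at key
    have h1 : g ≤ A * ‖q - q'‖ + B * (w * P) := by
      by_contra hcon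
      push Not at hcon
      have : 0 < g := lt_of_le_of_lt (by positivity) hcon
      nlinarith
    have : 0 ≤ w * P := by positivity
    have := norm_nonneg (q - q')
    nlinarith
  have hT0 : 0 ≤ ‖q - q'‖ + w * P := by positivity
  have hg1 : 0 ≤ S * (2 * N + 1) := by positivity
  have hN0 : (0:ℝ) ≤ 2 * N := by positivity
  have hc : ∀ r : ℝ, 0 ≤ r → r ≤ 1 + 2 * N + S * (2 * N + 1) → r * g ≤ C * (‖q - q'‖ + w * P) := by
    intro r hr hr'
    calc r * g ≤ (1 + 2 * N + S * (2 * N + 1)) * ((A + B) * (‖q - q'‖ + w * P)) := by gcongr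
      _ = _ := by rw [hC]; ring
  refine ⟨?_, ?_, ?_⟩
  · simpa using hc 1 zero_le_one (by linarith)
  · exact hpo.trans (hc _ hN0 (by linarith))
  · exact hn4.trans (hc _ hg1 (by linarith))

/-- right-hand side of the Schrodinger equation -/
def rhsS (e : ℝ) (ψ : V3 → ℂ) (Φ : V3 → ℝ) (x : V3) : ℂ :=
  Complex.I * ((1 / 2 : ℝ) • lapE ψ x + (e * Φ x) • ψ x)

lemma cont_rhs {e : ℝ} {ψ : V3 → ℂ} {Φ : V3 → ℝ} (h : ContDiff ℝ 2 ψ) (h' : Continuous Φ) :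
    Continuous (rhsS e ψ Φ) := by
  have := cont_lap h
  have := h.continuous
  unfold rhsS; fun_prop

lemma inner_I (z w : ℂ) : inner ℝ z (Complex.I * w) = - inner ℝ (Complex.I * z) w := by
  simp [Complex.inner]; ring

lemma inner_I_self (z : ℂ) : inner ℝ z (Complex.I * z) = 0 := by
  simp [Complex.inner]; ring

lemma pd_I {f : V3 → ℂ} (hf : ContDiff ℝ 1 f) (i : Fin 3) (x : V3) :
    pd i (fun x => Complex.I * f x) x = Complex.I * pd i f x := by
  unfold pd
  rw [fderiv_const_mul (hf.differentiable one_ne_zero x)]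
  rfl

lemma skew (N : ℕ) (hN : 0 < N) {w : V3 → ℂ} (hw : ContDiff ℝ 2 w) (hp : IsPerN N w)
    {V : V3 → ℝ} (hV : Continuous V) (e : ℝ) :
    ∫ x in cubeN N, inner ℝ (w x) (rhsS e w V x) = 0 := by
  have hwc := hw.continuous
  have hl := cont_lap hw
  have hw1 := hw.of_le one_le_two
  have h1 : ∀ x, inner ℝ (w x) (rhsS e w V x) = -(1 / 2) * inner ℝ (Complex.I * w x) (lapE w x) := by
    intro x
    unfold rhsS
    rw [mul_add, inner_add_right, mul_smul_comm, mul_smul_comm, inner_smul_right, inner_smul_right,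
      inner_I_self, inner_I]
    ring
  simp_rw [h1]
  rw [integral_const_mul, green N hN (f := fun x => Complex.I * w x) (contDiff_const.mul hw1) hw
    (per_comp hp _) hp]
  simp_rw [pd_I hw1, real_inner_comm, inner_I_self]
  simp

/-- H1 bound from L2 bounds of `ψ` and its time derivative -/
lemma h1_static (N : ℕ) (hN : 0 < N) (σ : V3 → ℝ) (hσ : ContDiff ℝ 2 σ) (hσp : IsPerN N σ)
    (e : ℝ) (he : 0 < e) : ∃ C, 0 ≤ C ∧ ∀ ψ Φ q, PS N σ e ψ Φ q →
      (1 / 2) * gsq N ψ + (1 / 2) * gsq N Φ ≤ nrm N ψ * nrm N (rhsS e ψ Φ) + C := by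
  obtain ⟨b, hb0, hb⟩ := per_bdd N hN hσ.continuous hσp
  set A : ℝ := (Fintype.card (GammaIdx N)) * b * (Real.sqrt ((N : ℝ) ^ 3) * (2 * N)) with hA
  refine ⟨A ^ 2 / 2, by positivity, ?_⟩
  intro ψ Φ q h
  have cψ := h.c2ψ.continuous
  have cΦ := h.c2Φ.continuous
  have cs := cont_stot hσ.continuous q
  have cl := cont_lap h.c2ψ
  have cr : Continuous (rhsS e ψ Φ) := cont_rhs h.c2ψ cΦ
  have e1 : (1 / 2) * gsq N ψ + gsq N Φ = (∫ x in cubeN N, inner ℝ (ψ x) (Complex.I * rhsS e ψ Φ x))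
      + ∫ x in cubeN N, Φ x * stot σ q x := by
    rw [gsq_eq N hN h.c2ψ h.perψ, gsq_eq N hN h.c2Φ h.perΦ]
    have cl' := cont_lap h.c2Φ
    rw [← integral_neg, ← integral_neg, ← integral_const_mul,
      ← integral_add (intQ N (by fun_prop)) (intQ N (by fun_prop)),
      ← integral_add (intQ N (by fun_prop)) (intQ N (by fun_prop))]
    congr 1; ext x
    unfold rhsS
    rw [← mul_assoc, Complex.I_mul_I, neg_one_mul, inner_neg_right, inner_add_right,
      inner_smul_right, inner_smul_right, real_inner_self_eq_norm_sq]
    have p := h.poi x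
    have : inner ℝ (Φ x) (lapE Φ x) = Φ x * lapE Φ x := by simp [mul_comm]
    rw [this]
    linear_combination Φ x * p
  have e2 := (abs_le.1 (cs_inner N cψ (g := fun x => Complex.I * rhsS e ψ Φ x) (by fun_prop))).2
  have e3 : nrm N (fun x => Complex.I * rhsS e ψ Φ x) = nrm N (rhsS e ψ Φ) :=
    nrm_congr N fun x => by simp
  rw [e3] at e2
  set g := Real.sqrt (gsq N Φ) with hg
  have hgg : gsq N Φ = g ^ 2 := (Real.sq_sqrt (gsq_nonneg _ _)).symm
  have hst : ∀ x, |stot σ q x| ≤ Fintype.card (GammaIdx N) * b := by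
    intro x
    unfold stot
    refine (Finset.abs_sum_le_sum_abs _ _).trans ?_
    refine (Finset.sum_le_sum fun n _ => hb _).trans (by simp)
  have e4 : ∫ x in cubeN N, Φ x * stot σ q x ≤ A * g := by
    calc _ ≤ ∫ x in cubeN N, (Fintype.card (GammaIdx N) * b) * ‖Φ x‖ := by
            refine integral_mono (intQ N (by fun_prop)) (intQ N (by fun_prop)) fun x => ?_
            refine (le_abs_self _).trans ?_
            simp only
            rw [abs_mul, mul_comm]
            exact mul_le_mul_of_nonneg_right (hst x) (abs_nonneg _)
      _ = (Fintype.card (GammaIdx N) * b) * ∫ x in cubeN N, ‖Φ x‖ := integral_const_mul _ _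
      _ ≤ (Fintype.card (GammaIdx N) * b) * (Real.sqrt ((N : ℝ) ^ 3) * (2 * N * g)) := by
            refine mul_le_mul_of_nonneg_left ?_ (by positivity)
            exact (int_norm_le N cΦ).trans (mul_le_mul_of_nonneg_left
              (poincare0 N hN (h.c2Φ.of_le one_le_two) h.perΦ h.mean) (Real.sqrt_nonneg _))
      _ = _ := by rw [hA]; ring
  rw [hgg] at e1 ⊢
  nlinarith [sq_nonneg (A - g)]

end static

end part4

section part5
open Filter Topology

section time
variable {E : Type*} [NormedAddCommGroup E] [InnerProductSpace ℝ E]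

lemma fatou_nrm (N : ℕ) {f : ℕ → V3 → E} {g : V3 → E} (hf : ∀ n, Continuous (f n))
    (hg : Continuous g) (hl : ∀ x, Tendsto (fun n => f n x) atTop (𝓝 (g x)))
    {m : ℕ → ℝ} {m0 : ℝ} (hm : ∀ n, nrm N (f n) ≤ m n) (hml : Tendsto m atTop (𝓝 m0)) :
    nrm N g ≤ m0 := by
  have hm0 : 0 ≤ m0 := ge_of_tendsto' hml fun n => (nrm_nonneg _ _).trans (hm n)
  have h1 : ∀ h : V3 → E, Continuous h →
      ENNReal.ofReal (nrm N h ^ 2) = ∫⁻ x in cubeN N, ENNReal.ofReal (‖h x‖ ^ 2) := by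
    intro h hh
    rw [nrm_sq, ofReal_integral_eq_lintegral_ofReal (intQ N (by fun_prop))
      (Eventually.of_forall fun x => by positivity)]
  have h2 : ∫⁻ x in cubeN N, ENNReal.ofReal (‖g x‖ ^ 2)
      ≤ liminf (fun n => ∫⁻ x in cubeN N, ENNReal.ofReal (‖f n x‖ ^ 2)) atTop := by
    refine le_trans (le_of_eq ?_) (lintegral_liminf_le fun n => ?_)
    · congr 1; ext x
      refine (Tendsto.liminf_eq ?_).symm
      exact (ENNReal.continuous_ofReal.tendsto _).comp ((hl x).norm.pow 2)
    · have := hf n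
      exact (ENNReal.continuous_ofReal.comp (by fun_prop)).measurable
  have h3 : liminf (fun n => ∫⁻ x in cubeN N, ENNReal.ofReal (‖f n x‖ ^ 2)) atTop
      ≤ ENNReal.ofReal (m0 ^ 2) := by
    have : Tendsto (fun n => ENNReal.ofReal (m n ^ 2)) atTop (𝓝 (ENNReal.ofReal (m0 ^ 2))) :=
      (ENNReal.continuous_ofReal.tendsto _).comp (hml.pow 2)
    rw [← this.liminf_eq]
    refine liminf_le_liminf (Eventually.of_forall fun n => ?_)
    rw [← h1 _ (hf n)]
    exact ENNReal.ofReal_le_ofReal (pow_le_pow_left₀ (nrm_nonneg _ _) (hm n) 2)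
  rw [← h1 g hg] at h2
  have h4 := (ENNReal.ofReal_le_ofReal_iff (by positivity)).1 (h2.trans h3)
  exact (pow_le_pow_iff_left₀ (nrm_nonneg _ _) hm0 two_ne_zero).1 h4

lemma min_conv (N : ℕ) {f : ℝ → V3 → E} {g : V3 → E} {l : Filter ℝ} [l.IsCountablyGenerated]
    (hf : ∀ t, Continuous (f t)) (hg : Continuous g) (hl : ∀ x, Tendsto (fun t => f t x) l (𝓝 (g x)))
    (R : ℝ) (hR : 0 ≤ R) :
    Tendsto (fun t => ∫ x in cubeN N, min R ‖f t x - g x‖) l (𝓝 0) := by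
  have := tendsto_integral_filter_of_dominated_convergence (μ := volume.restrict (cubeN N))
    (F := fun t x => min R ‖f t x - g x‖) (f := fun _ => (0 : ℝ)) (l := l) (fun _ => R)
    (Eventually.of_forall fun t => by
      have := hf t
      exact (Continuous.aestronglyMeasurable (by fun_prop)))
    (Eventually.of_forall fun t => Eventually.of_forall fun x => by
      rw [Real.norm_of_nonneg (le_min hR (norm_nonneg _))]; exact min_le_left _ _)
    (integrable_const _)
    (Eventually.of_forall fun x => by
      have h := ((hl x).sub_const (g x)).norm
      rw [sub_self, norm_zero] at h
      have := (tendsto_const_nhds (x := R)).min h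
      rwa [min_eq_right hR] at this)
  simpa using this

lemma l1_conv (N : ℕ) {f : ℝ → V3 → E} {g : V3 → E} {l : Filter ℝ} [l.IsCountablyGenerated]
    (hf : ∀ t, Continuous (f t)) (hg : Continuous g) (hl : ∀ x, Tendsto (fun t => f t x) l (𝓝 (g x)))
    {K : ℝ} (hK : ∀ᶠ t in l, nrm N (f t) ≤ K) (hgK : nrm N g ≤ K) :
    Tendsto (fun t => ∫ x in cubeN N, ‖f t x - g x‖) l (𝓝 0) := by
  have hK0 : 0 ≤ K := (nrm_nonneg _ _).trans hgK
  rw [Metric.tendsto_nhds]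
  intro ε hε
  set R : ℝ := (4 * K ^ 2 + 1) * 2 / ε with hR
  have hR0 : 0 < R := by positivity
  have h1 := (Metric.tendsto_nhds.1 (min_conv N hf hg hl R hR0.le)) (ε / 2) (by positivity)
  filter_upwards [h1, hK] with t ht hKt
  have hft := hf t
  have h0 : 0 ≤ ∫ x in cubeN N, min R ‖f t x - g x‖ :=
    integral_nonneg fun x => le_min hR0.le (norm_nonneg _)
  rw [Real.dist_eq, sub_zero, abs_of_nonneg h0] at ht
  rw [Real.dist_eq, sub_zero, abs_of_nonneg (integral_nonneg fun x => norm_nonneg _)]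
  calc ∫ x in cubeN N, ‖f t x - g x‖
      ≤ ∫ x in cubeN N, (min R ‖f t x - g x‖ + R⁻¹ * ‖f t x - g x‖ ^ 2) := by
        refine integral_mono (intQ N (by fun_prop)) (intQ N (by fun_prop)) fun x => ?_
        simp only
        set y := ‖f t x - g x‖
        have hy : 0 ≤ y := norm_nonneg _
        rcases le_total R y with h | h
        · rw [min_eq_left h]
          have : y ≤ R⁻¹ * y ^ 2 := by
            rw [inv_mul_eq_div, le_div_iff₀ hR0]; nlinarith
          linarith
        · rw [min_eq_right h]
          have : 0 ≤ R⁻¹ * y ^ 2 := by positivity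
          linarith
    _ = (∫ x in cubeN N, min R ‖f t x - g x‖) + R⁻¹ * nrm N (fun x => f t x - g x) ^ 2 := by
        rw [integral_add (intQ N (by fun_prop)) (intQ N (by fun_prop)), integral_const_mul, nrm_sq]
    _ < ε := by
        have h3 := pow_le_pow_left₀ (nrm_nonneg _ _) (nrm_sub_le N hft hg) 2
        have h4 : (nrm N (f t) + nrm N g) ^ 2 ≤ (2 * K) ^ 2 :=
          pow_le_pow_left₀ (add_nonneg (nrm_nonneg _ _) (nrm_nonneg _ _)) (by linarith) 2
        have h5 : R⁻¹ * nrm N (fun x => f t x - g x) ^ 2 ≤ ε / 2 := by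
          rw [inv_mul_eq_div, div_le_iff₀ hR0, hR]
          have : ε / 2 * ((4 * K ^ 2 + 1) * 2 / ε) = 4 * K ^ 2 + 1 := by field_simp
          rw [this]; nlinarith
        linarith

lemma weak_conv (N : ℕ) {f : ℝ → V3 → E} {g : V3 → E} {l : Filter ℝ} [l.IsCountablyGenerated]
    (hf : ∀ t, Continuous (f t)) (hg : Continuous g) (hl : ∀ x, Tendsto (fun t => f t x) l (𝓝 (g x)))
    {K : ℝ} (hK : ∀ᶠ t in l, nrm N (f t) ≤ K) (hgK : nrm N g ≤ K) {φ : V3 → E} (hφ : Continuous φ) :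
    Tendsto (fun t => ∫ x in cubeN N, inner ℝ (φ x) (f t x)) l (𝓝 (∫ x in cubeN N, inner ℝ (φ x) (g x))) := by
  obtain ⟨b, hb0, hb⟩ := bddQ N hφ
  rw [tendsto_iff_dist_tendsto_zero]
  have h := (l1_conv N hf hg hl hK hgK).const_mul b
  rw [mul_zero] at h
  refine squeeze_zero (fun _ => dist_nonneg) (fun t => ?_) h
  have := hf t
  rw [Real.dist_eq, ← integral_sub (intQ N (by fun_prop)) (intQ N (by fun_prop)), ← integral_const_mul]
  refine abs_integral_le_integral_abs.trans ?_
  refine setIntegral_mono_on (intQ N (by fun_prop)) (intQ N (by fun_prop)) (measurableSet_cubeN N)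
    fun x hx => ?_
  rw [← inner_sub_right]
  exact (abs_real_inner_le_norm _ _).trans (mul_le_mul_of_nonneg_right (hb x hx) (norm_nonneg _))

lemma halving {ι : Type*} {I : Set ι} {z w : ι → ℝ} {a A0 : ℝ} (ha : 0 ≤ a) (hA0 : 0 ≤ A0)
    (h0 : ∀ i ∈ I, z i ≤ A0 * w i)
    (hs : ∀ A, 0 ≤ A → (∀ i ∈ I, z i ≤ A * w i) → ∀ i ∈ I, z i ≤ (a + A / 2) * w i) :
    ∀ i ∈ I, z i ≤ 2 * a * w i := by
  have hn : ∀ n : ℕ, ∃ A, 0 ≤ A ∧ A = 2 * a + (A0 - 2 * a) * (1 / 2) ^ n ∧ ∀ i ∈ I, z i ≤ A * w i := by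
    intro n
    induction n with
    | zero => exact ⟨A0, hA0, by ring, h0⟩
    | succ k ih =>
      obtain ⟨A, h1, h2, h3⟩ := ih
      exact ⟨a + A / 2, by positivity, by rw [h2]; ring, hs A h1 h3⟩
  intro i hi
  have hlim : Tendsto (fun n : ℕ => (2 * a + (A0 - 2 * a) * (1 / 2 : ℝ) ^ n) * w i) atTop
      (𝓝 ((2 * a + (A0 - 2 * a) * 0) * w i)) :=
    ((tendsto_const_nhds.add ((tendsto_pow_atTop_nhds_zero_of_lt_one (by norm_num)
      (by norm_num)).const_mul _)).mul_const _)
  rw [mul_zero, add_zero] at hlim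
  refine ge_of_tendsto' hlim fun n => ?_
  obtain ⟨A, _, h2, h3⟩ := hn n
  rw [← h2]; exact h3 i hi

end time

end part5

section part6
open Filter Topology

section ls

lemma rhs_diff {e : ℝ} {ψ ψ' : V3 → ℂ} {Φ Φ' : V3 → ℝ} (h : ContDiff ℝ 2 ψ) (h' : ContDiff ℝ 2 ψ')
    (x : V3) : rhsS e ψ Φ x - rhsS e ψ' Φ' x = rhsS e (fun x => ψ x - ψ' x) Φ x
      + Complex.I * ((e * (Φ x - Φ' x)) • ψ' x) := by
  unfold rhsS
  rw [lap_sub h h']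
  simp only [Complex.real_smul]
  push_cast
  ring

lemma skew_diff (N : ℕ) (hN : 0 < N) (σ : V3 → ℝ) (hσ : ContDiff ℝ 2 σ) (hσp : IsPerN N σ)
    (e : ℝ) (he : 0 < e) : ∃ C, 0 ≤ C ∧ ∀ B, ∀ ψ Φ q ψ' Φ' q', PS N σ e ψ Φ q → PS N σ e ψ' Φ' q' →
      n4 N ψ ≤ B → n4 N ψ' ≤ B →
      |∫ x in cubeN N, inner ℝ (ψ x - ψ' x) (rhsS e ψ Φ x - rhsS e ψ' Φ' x)|
        ≤ C * (B * (1 + 2 * B)) * nrm N (fun x => ψ x - ψ' x) *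
          (‖q - q'‖ + nrm N (fun x => ψ x - ψ' x)) := by
  obtain ⟨C, hC0, hC⟩ := poisson_stab N hN σ hσ hσp e he
  refine ⟨e * C, by positivity, ?_⟩
  intro B ψ Φ q ψ' Φ' q' h h' hB hB'
  have hB0 : 0 ≤ B := (n4_nonneg _ _).trans hB
  have h4 := (hC _ _ _ _ _ _ h h').2.2
  have cψ := h.c2ψ.continuous
  have cψ' := h'.c2ψ.continuous
  have cΦ := h.c2Φ.continuous
  have cΦ' := h'.c2Φ.continuous
  have hw2 : ContDiff ℝ 2 (fun x => ψ x - ψ' x) := h.c2ψ.sub h'.c2ψ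
  have cr : Continuous (rhsS e (fun x => ψ x - ψ' x) Φ) := cont_rhs hw2 cΦ
  simp_rw [rhs_diff h.c2ψ h'.c2ψ, inner_add_right]
  rw [integral_add (intQ N (by fun_prop)) (intQ N (by fun_prop)),
    skew N hN hw2 (per_comp2 h.perψ h'.perψ fun a b => a - b) cΦ, zero_add]
  set w := nrm N (fun x => ψ x - ψ' x) with hw
  have hw0 : 0 ≤ w := nrm_nonneg _ _
  calc _ ≤ ∫ x in cubeN N, e * (‖ψ x - ψ' x‖ * (‖Φ x - Φ' x‖ * ‖ψ' x‖)) := by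
        refine abs_integral_le_integral_abs.trans ?_
        refine integral_mono (intQ N (by fun_prop)) (intQ N (by fun_prop)) fun x => ?_
        refine (abs_real_inner_le_norm _ _).trans (le_of_eq ?_)
        rw [norm_mul, Complex.norm_I, norm_smul, norm_mul, Real.norm_of_nonneg he.le]; ring
    _ = e * ∫ x in cubeN N, (‖ψ x - ψ' x‖ * (‖Φ x - Φ' x‖ * ‖ψ' x‖)) := integral_const_mul _ _
    _ ≤ e * (w * (C * (‖q - q'‖ + w * (B + B)) * B)) := by
        refine mul_le_mul_of_nonneg_left ?_ he.le
        refine (holder3 N (by fun_prop) (g := fun x => Φ x - Φ' x) (by fun_prop) cψ').trans ?_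
        refine mul_le_mul_of_nonneg_left ?_ hw0
        refine mul_le_mul (h4.trans ?_) hB' (n4_nonneg _ _) (by positivity)
        gcongr
    _ ≤ _ := by
        have h1 : ‖q - q'‖ + w * (B + B) ≤ (1 + 2 * B) * (‖q - q'‖ + w) := by
          have := norm_nonneg (q - q')
          nlinarith [mul_nonneg hB0 this]
        calc e * (w * (C * (‖q - q'‖ + w * (B + B)) * B))
            ≤ e * (w * (C * ((1 + 2 * B) * (‖q - q'‖ + w)) * B)) := by gcongr
          _ = _ := by ring

/-- local solution in normalised gauge -/
structure LS (N : ℕ) (σ : V3 → ℝ) (e : ℝ) (ψ dψ : V3 → ℝ → ℂ) (Φ : V3 → ℝ → ℝ)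
    (q : ℝ → GammaIdx N → V3) (S : Set ℝ) (K L : ℝ) : Prop where
  conv : S.OrdConnected
  ps : ∀ t ∈ S, PS N σ e (fun x => ψ x t) (fun x => Φ x t) (q t)
  sch : ∀ t ∈ S, ∀ x, dψ x t = rhsS e (fun x => ψ x t) (fun x => Φ x t) x
  hd : ∀ x t, HasDerivAt (ψ x) (dψ x t) t
  ct : ∀ x, Continuous (dψ x)
  cx : ∀ t, Continuous fun x => ψ x t
  cdx : ∀ t, Continuous fun x => dψ x t
  b0 : ∀ t ∈ S, nrm N (fun x => ψ x t) ≤ K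
  b1 : ∀ t ∈ S, nrm N (fun x => dψ x t) ≤ K
  lip : ∀ t ∈ S, ∀ s ∈ S, ‖q t - q s‖ ≤ L * |t - s|
  L0 : 0 ≤ L
  K0 : 0 ≤ K

lemma y_eq (N : ℕ) {u du : V3 → ℝ → ℂ} {a b K : ℝ} (hd : ∀ x t, HasDerivAt (u x) (du x t) t)
    (ct : ∀ x, Continuous (du x)) (cx : ∀ t, Continuous fun x => u x t)
    (cdx : ∀ t, Continuous fun x => du x t)
    (hu : ∀ t ∈ Set.uIcc a b, nrm N (fun x => u x t) ≤ K)
    (hdu : ∀ t ∈ Set.uIcc a b, nrm N (fun x => du x t) ≤ K) :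
    IntervalIntegrable (fun t => ∫ x in cubeN N, 2 * inner ℝ (u x t) (du x t)) volume a b ∧
    nrm N (fun x => u x b) ^ 2 - nrm N (fun x => u x a) ^ 2 =
      ∫ t in a..b, ∫ x in cubeN N, 2 * inner ℝ (u x t) (du x t) := by
  have cu : ∀ x, Continuous (u x) := fun x => continuous_iff_continuousAt.2 fun t => (hd x t).continuousAt
  have := ff_eq N (f := fun x t => ‖u x t‖ ^ 2) (g := fun x t => 2 * inner ℝ (u x t) (du x t))
    (a := a) (b := b) (K := 2 * K ^ 2) (fun t => by have := cx t; fun_prop)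
    (fun x t _ => (hd x t).norm_sq)
    (fun x => by have := ct x; have := cu x; fun_prop)
    (fun t => by have := cx t; have := cdx t; fun_prop)
    (fun t ht => by
      have c1 := cx t
      have c2 := cdx t
      have h1 := cs_norm N c1 c2
      have h2 : nrm N (fun x => u x t) * nrm N (fun x => du x t) ≤ K * K :=
        mul_le_mul (hu t ht) (hdu t ht) (nrm_nonneg _ _) ((nrm_nonneg _ _).trans (hu t ht))
      calc _ ≤ ∫ x in cubeN N, 2 * (‖u x t‖ * ‖du x t‖) := by
            refine integral_mono (intQ N (by fun_prop)) (intQ N (by fun_prop)) fun x => ?_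
            simp only
            rw [abs_mul, abs_two]
            exact mul_le_mul_of_nonneg_left (abs_real_inner_le_norm _ _) zero_le_two
        _ = 2 * ∫ x in cubeN N, (‖u x t‖ * ‖du x t‖) := integral_const_mul _ _
        _ ≤ _ := by nlinarith)
  simpa only [nrm_sq] using this

lemma y_le (N : ℕ) {u du : V3 → ℝ → ℂ} {a b K B : ℝ} (hd : ∀ x t, HasDerivAt (u x) (du x t) t)
    (ct : ∀ x, Continuous (du x)) (cx : ∀ t, Continuous fun x => u x t)
    (cdx : ∀ t, Continuous fun x => du x t)
    (hu : ∀ t ∈ Set.uIcc a b, nrm N (fun x => u x t) ≤ K)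
    (hdu : ∀ t ∈ Set.uIcc a b, nrm N (fun x => du x t) ≤ K)
    (hB : ∀ t ∈ Set.uIcc a b, |∫ x in cubeN N, inner ℝ (u x t) (du x t)| ≤ B) :
    |nrm N (fun x => u x b) ^ 2 - nrm N (fun x => u x a) ^ 2| ≤ 2 * B * |b - a| := by
  rw [(y_eq N hd ct cx cdx hu hdu).2, ← Real.norm_eq_abs]
  refine intervalIntegral.norm_integral_le_of_norm_le_const fun t ht => ?_
  rw [integral_const_mul, norm_mul, Real.norm_two]
  exact mul_le_mul_of_nonneg_left (hB t (Set.uIoc_subset_uIcc ht)) zero_le_two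

variable {N : ℕ} {σ : V3 → ℝ} {e : ℝ} {ψ dψ : V3 → ℝ → ℂ} {Φ : V3 → ℝ → ℝ}
    {q : ℝ → GammaIdx N → V3} {S : Set ℝ} {K L : ℝ}

lemma LS.charge (hN : 0 < N) (h : LS N σ e ψ dψ Φ q S K L) {s t : ℝ} (hs : s ∈ S) (ht : t ∈ S) :
    nrm N (fun x => ψ x t) = nrm N (fun x => ψ x s) := by
  have hsub := h.conv.uIcc_subset hs ht
  have := y_le N (B := 0) h.hd h.ct h.cx h.cdx (a := s) (b := t) (fun τ hτ => h.b0 τ (hsub hτ))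
    (fun τ hτ => h.b1 τ (hsub hτ)) (fun τ hτ => by
      have p := h.ps τ (hsub hτ)
      simp_rw [h.sch τ (hsub hτ)]
      rw [skew N hN p.c2ψ p.perψ p.c2Φ.continuous, abs_zero])
  simp only [mul_zero, zero_mul, abs_nonpos_iff] at this
  have h2 := sub_eq_zero.1 this
  exact (pow_left_inj₀ (nrm_nonneg _ _) (nrm_nonneg _ _) two_ne_zero).1 h2

lemma LS.lipψ (h : LS N σ e ψ dψ Φ q S K L) {s t : ℝ} (hs : s ∈ S) (ht : t ∈ S) :
    nrm N (fun x => ψ x t - ψ x s) ≤ K * |t - s| := by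
  have hsub := h.conv.uIcc_subset hs ht
  set w : V3 → ℂ := fun x => ψ x t - ψ x s with hw
  have cw : Continuous w := (h.cx t).sub (h.cx s)
  have hb : ∀ τ ∈ Set.uIcc s t, nrm N w * nrm N (fun x => dψ x τ) ≤ nrm N w * K := fun τ hτ =>
    mul_le_mul_of_nonneg_left (h.b1 τ (hsub hτ)) (nrm_nonneg _ _)
  have := ff_le N (f := fun x τ => inner ℝ (w x) (ψ x τ)) (g := fun x τ => inner ℝ (w x) (dψ x τ))
    (a := s) (b := t) (K := nrm N w * K) (B := nrm N w * K)
    (fun τ => by have := h.cx τ; fun_prop)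
    (fun x τ _ => by
      have := (hasDerivAt_const τ (w x)).inner ℝ (h.hd x τ)
      simpa using this)
    (fun x => by have := h.ct x; fun_prop)
    (fun τ => by have := h.cdx τ; fun_prop)
    (fun τ hτ => by
      have c2 := h.cdx τ
      refine le_trans ?_ ((cs_norm N cw c2).trans (hb τ hτ))
      refine integral_mono (intQ N (by fun_prop)) (intQ N (by fun_prop)) fun x => ?_
      exact abs_real_inner_le_norm _ _)
    (fun τ hτ => (cs_inner N cw (h.cdx τ)).trans (hb τ hτ))
  have c1 := h.cx t
  have c2 := h.cx s
  rw [← integral_sub (intQ N (by fun_prop)) (intQ N (by fun_prop))] at this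
  have e1 : ∫ x in cubeN N, (inner ℝ (w x) (ψ x t) - inner ℝ (w x) (ψ x s)) = nrm N w ^ 2 := by
    rw [nrm_sq]; congr 1; ext x
    rw [← inner_sub_right, ← real_inner_self_eq_norm_sq]
  rw [e1, abs_of_nonneg (by positivity)] at this
  have h0 := nrm_nonneg N w
  by_contra hcon
  push Not at hcon
  have : 0 ≤ K * |t - s| := mul_nonneg h.K0 (abs_nonneg _)
  nlinarith

lemma int_abs_le {s τ c : ℝ} (hc : 0 ≤ c) {G : ℝ → ℝ}
    (hG : IntervalIntegrable G volume s τ) (hb : ∀ r ∈ Set.uIcc s τ, |G r| ≤ 2 * c * |r - s|) :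
    |∫ r in s..τ, G r| ≤ c * |τ - s| ^ 2 := by
  rcases le_total s τ with h | h
  · have h1 : |∫ r in s..τ, G r| ≤ ∫ r in s..τ, 2 * c * (r - s) := by
      rw [← Real.norm_eq_abs]
      refine intervalIntegral.norm_integral_le_of_norm_le h ?_ (Continuous.intervalIntegrable (by fun_prop) _ _)
      refine Eventually.of_forall fun r hr => ?_
      have := hb r (Set.uIoc_subset_uIcc (by rwa [Set.uIoc_of_le h]))
      rwa [abs_of_nonneg (by linarith [hr.1] : 0 ≤ r - s)] at this
    refine h1.trans (le_of_eq ?_)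
    rw [intervalIntegral.integral_const_mul, intervalIntegral.integral_sub (by simp) (by simp), integral_id]
    simp; ring
  · have h1 : |∫ r in τ..s, G r| ≤ ∫ r in τ..s, 2 * c * (s - r) := by
      rw [← Real.norm_eq_abs]
      refine intervalIntegral.norm_integral_le_of_norm_le h ?_ (Continuous.intervalIntegrable (by fun_prop) _ _)
      refine Eventually.of_forall fun r hr => ?_
      have := hb r (by rw [Set.uIcc_of_ge h]; exact Set.Ioc_subset_Icc_self hr)
      rwa [abs_of_nonpos (by linarith [hr.2] : r - s ≤ 0), neg_sub] at this
    rw [intervalIntegral.integral_symm, abs_neg]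
    refine h1.trans (le_of_eq ?_)
    rw [intervalIntegral.integral_const_mul, intervalIntegral.integral_sub (by simp) (by simp), integral_id]
    simp; ring

/-- key upper bound and short-time growth bound -/
lemma ls_growth (N : ℕ) (hN : 0 < N) (σ : V3 → ℝ) (hσ : ContDiff ℝ 2 σ) (hσp : IsPerN N σ)
    (e : ℝ) (he : 0 < e) (B L : ℝ) (hB0 : 0 ≤ B) (hL0 : 0 ≤ L) : ∃ C, 0 < C ∧
    ∀ ψ dψ Φ q S K, LS N σ e ψ dψ Φ q S K L → (∀ t ∈ S, n4 N (fun x => ψ x t) ≤ B) →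
    ∀ s ∈ S, ∀ t ∈ S,
      nrm N (fun x => ψ x t - ψ x s) ≤ |t - s| * (nrm N (fun x => dψ x s) + C * (L + K) * |t - s|) ∧
      (C * |t - s| ≤ 1 / 2 → nrm N (fun x => dψ x t) ^ 2 ≤ 2 * nrm N (fun x => dψ x s) ^ 2 + 1) := by
  obtain ⟨C1, hC10, hC1⟩ := skew_diff N hN σ hσ hσp e he
  set D : ℝ := C1 * (B * (1 + 2 * B)) with hD
  have hD0 : 0 ≤ D := by positivity
  refine ⟨2 * D * (L + 1) + D + 1, by positivity, ?_⟩
  intro ψ dψ Φ q S K h hB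
  have hK0 := h.K0
  have hsd : ∀ s ∈ S, ∀ t ∈ S, |∫ x in cubeN N, inner ℝ (ψ x t - ψ x s) (dψ x t - dψ x s)|
      ≤ D * nrm N (fun x => ψ x t - ψ x s) * (L * |t - s| + nrm N (fun x => ψ x t - ψ x s)) := by
    intro s hs t ht
    have := hC1 B _ _ _ _ _ _ (h.ps t ht) (h.ps s hs) (hB t ht) (hB s hs)
    simp_rw [h.sch t ht, h.sch s hs]
    refine this.trans ?_
    refine mul_le_mul_of_nonneg_left ?_ (mul_nonneg hD0 (nrm_nonneg _ _))
    linarith [h.lip t ht s hs]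
  have hup : ∀ s ∈ S, ∀ t ∈ S, nrm N (fun x => ψ x t - ψ x s) ≤
      |t - s| * (nrm N (fun x => dψ x s) + (2 * D * (L + 1) + D + 1) * (L + K) * |t - s|) := by
    intro s hs t ht
    have hsub := h.conv.uIcc_subset hs ht
    set m : ℝ := nrm N (fun x => dψ x s) + D * (L + K) * |t - s| with hm
    have hm0 : 0 ≤ m := add_nonneg (nrm_nonneg _ _) (by positivity)
    have hsr : ∀ r ∈ Set.uIcc s t, |r - s| ≤ |t - s| := fun r hr => Set.abs_sub_left_of_mem_uIcc hr
    have key := halving (I := Set.uIcc s t) (z := fun τ => nrm N (fun x => ψ x τ - ψ x s))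
      (w := fun τ => |τ - s|) (a := m / 2) (A0 := K) (by positivity) hK0
      (fun τ hτ => h.lipψ hs (hsub hτ))
      (fun A hA hPA τ hτ => by
        have hsubτ : Set.uIcc s τ ⊆ Set.uIcc s t := Set.uIcc_subset_uIcc_left hτ
        have hy := y_eq N (u := fun x r => ψ x r - ψ x s) (du := dψ) (a := s) (b := τ) (K := 2 * K)
          (fun x r => (h.hd x r).sub_const _) h.ct (fun r => (h.cx r).sub (h.cx s)) h.cdx
          (fun r hr => (nrm_sub_le N (h.cx r) (h.cx s)).trans (by
            linarith [h.b0 r (hsub (hsubτ hr)), h.b0 s hs]))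
          (fun r hr => by linarith [h.b1 r (hsub (hsubτ hr))])
        have hG := int_abs_le (c := A * m) (by positivity) hy.1 (fun r hr => by
          have hr' := hsub (hsubτ hr)
          have c1 := h.cx r
          have c2 := h.cx s
          have c3 := h.cdx r
          have c4 := h.cdx s
          rw [integral_const_mul, abs_mul, abs_two]
          have e1 : ∫ x in cubeN N, inner ℝ (ψ x r - ψ x s) (dψ x r)
              = (∫ x in cubeN N, inner ℝ (ψ x r - ψ x s) (dψ x s))
                + ∫ x in cubeN N, inner ℝ (ψ x r - ψ x s) (dψ x r - dψ x s) := by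
            rw [← integral_add (intQ N (by fun_prop)) (intQ N (by fun_prop))]
            congr 1; ext x; rw [← inner_add_right]; congr 1; ring
          rw [e1]
          have e2 := cs_inner N (f := fun x => ψ x r - ψ x s) (g := fun x => dψ x s) (by fun_prop) c4
          have e3 := hsd s hs r hr'
          have e4 := h.lipψ hs hr'
          have e5 := hPA r (hsubτ hr)
          have e6 := hsr r (hsubτ hr)
          set w := nrm N (fun x => ψ x r - ψ x s)
          have hw0 : 0 ≤ w := nrm_nonneg _ _
          have e7 : D * w * (L * |r - s| + w) ≤ w * (D * (L + K) * |t - s|) := by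
            have : L * |r - s| + w ≤ (L + K) * |t - s| := by
              have := mul_le_mul_of_nonneg_left e6 (add_nonneg hL0 hK0)
              nlinarith
            calc D * w * (L * |r - s| + w) ≤ D * w * ((L + K) * |t - s|) := by gcongr
              _ = _ := by ring
          have e8 := abs_add_le (∫ x in cubeN N, inner ℝ (ψ x r - ψ x s) (dψ x s))
            (∫ x in cubeN N, inner ℝ (ψ x r - ψ x s) (dψ x r - dψ x s))
          have e9 : w * m ≤ A * |r - s| * m := mul_le_mul_of_nonneg_right e5 hm0
          have e10 : w * m = w * nrm N (fun x => dψ x s) + w * (D * (L + K) * |t - s|) := by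
            rw [hm]; ring
          nlinarith)
        rw [← hy.2] at hG
        have z0 : nrm N (fun x => ψ x s - ψ x s) = 0 := by simp [nrm]
        rw [z0] at hG
        have hG' := (abs_le.1 hG).2
        refine abs_le_of_sq_le_sq' ?_ (by positivity) |>.2
        have : A * m ≤ (m / 2 + A / 2) ^ 2 := by nlinarith [sq_nonneg (A - m)]
        have h2 := mul_le_mul_of_nonneg_right this (sq_nonneg |τ - s|)
        rw [mul_pow]
        linarith) t Set.right_mem_uIcc
    refine (key).trans ?_
    have : D * (L + K) * |t - s| ≤ (2 * D * (L + 1) + D + 1) * (L + K) * |t - s| := by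
      gcongr
      nlinarith [mul_nonneg hD0 hL0]
    rw [mul_comm, mul_div_cancel₀ _ two_ne_zero]
    refine mul_le_mul_of_nonneg_left ?_ (abs_nonneg _)
    rw [hm]; linarith
  intro s hs t ht
  refine ⟨hup s hs t ht, fun hst => ?_⟩
  set C := 2 * D * (L + 1) + D + 1 with hC
  have hC0 : 0 < C := by positivity
  rcases eq_or_ne s t with rfl | hne
  · nlinarith [sq_nonneg (nrm N (fun x => dψ x s))]
  have hd0 : 0 < |t - s| := abs_pos.2 (sub_ne_zero.2 hne.symm)
  have hsub := h.conv.uIcc_subset hs ht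
  -- finite difference estimate
  have hfd : ∀ l : ℝ, 0 < l → l < 1 → nrm N (fun x => ψ x t - ψ x (t - l * (t - s))) ^ 2
      ≤ (l * |t - s|) ^ 2 * (2 * (nrm N (fun x => dψ x s) + C * (L + K) * (l * |t - s|)) ^ 2 + 1) := by
    intro l hl0 hl1
    set r : ℝ := l * (t - s) with hr
    have hrabs : |r| = l * |t - s| := by rw [hr, abs_mul, abs_of_pos hl0]
    have hI : ∀ τ ∈ Set.uIcc s (t - r), τ ∈ S ∧ τ + r ∈ S ∧ |τ - s| ≤ |t - s| := by
      intro τ hτ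
      have : τ ∈ Set.uIcc s t ∧ τ + r ∈ Set.uIcc s t := by
        rcases le_total s t with hle | hle
        · have h1 : 0 ≤ r := mul_nonneg hl0.le (by linarith)
          have h2 : r ≤ t - s := by nlinarith
          rw [Set.uIcc_of_le (by linarith)] at hτ
          rw [Set.uIcc_of_le hle]
          exact ⟨⟨hτ.1, by linarith [hτ.2]⟩, ⟨by linarith [hτ.1], by linarith [hτ.2]⟩⟩
        · have h1 : r ≤ 0 := mul_nonpos_of_nonneg_of_nonpos hl0.le (by linarith)
          have h2 : t - s ≤ r := by nlinarith
          rw [Set.uIcc_of_ge (by linarith)] at hτ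
          rw [Set.uIcc_of_ge hle]
          exact ⟨⟨by linarith [hτ.1], hτ.2⟩, ⟨by linarith [hτ.1], by linarith [hτ.2]⟩⟩
      exact ⟨hsub this.1, hsub this.2, Set.abs_sub_left_of_mem_uIcc this.1⟩
    set y : ℝ → ℝ := fun τ => nrm N (fun x => ψ x (τ + r) - ψ x τ) ^ 2 with hy
    have hy0 : ∀ τ, 0 ≤ y τ := fun τ => sq_nonneg _
    have hgr := halving (I := Set.uIcc s (t - r)) (z := y) (w := fun _ => 1)
      (a := y s + r ^ 2 / 2) (A0 := (2 * K) ^ 2) (by have := hy0 s; positivity) (by positivity)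
      (fun τ hτ => by
        rw [mul_one]
        refine pow_le_pow_left₀ (nrm_nonneg _ _) ((nrm_sub_le N (h.cx _) (h.cx _)).trans ?_) 2
        linarith [h.b0 _ (hI τ hτ).1, h.b0 _ (hI τ hτ).2.1])
      (fun A hA hPA τ hτ => by
        have hsubτ : Set.uIcc s τ ⊆ Set.uIcc s (t - r) := Set.uIcc_subset_uIcc_left hτ
        have hyl := y_le N (u := fun x v => ψ x (v + r) - ψ x v) (du := fun x v => dψ x (v + r) - dψ x v)
          (a := s) (b := τ) (K := 2 * K) (B := D * (L + 1) * (A + r ^ 2))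
          (fun x v => ((h.hd x (v + r)).comp_add_const v r).sub (h.hd x v))
          (fun x => by have := h.ct x; fun_prop)
          (fun v => (h.cx _).sub (h.cx _)) (fun v => (h.cdx _).sub (h.cdx _))
          (fun v hv => (nrm_sub_le N (h.cx _) (h.cx _)).trans (by
            linarith [h.b0 _ (hI v (hsubτ hv)).1, h.b0 _ (hI v (hsubτ hv)).2.1]))
          (fun v hv => (nrm_sub_le N (h.cdx _) (h.cdx _)).trans (by
            linarith [h.b1 _ (hI v (hsubτ hv)).1, h.b1 _ (hI v (hsubτ hv)).2.1]))
          (fun v hv => by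
            refine (hsd v (hI v (hsubτ hv)).1 (v + r) (hI v (hsubτ hv)).2.1).trans ?_
            rw [add_sub_cancel_left]
            have hyv : nrm N (fun x => ψ x (v + r) - ψ x v) ^ 2 ≤ A := by
              have := hPA v (hsubτ hv); rwa [mul_one] at this
            set w := nrm N (fun x => ψ x (v + r) - ψ x v)
            have hw0 : 0 ≤ w := nrm_nonneg _ _
            have h1 : w * (L * |r| + w) ≤ (L + 1) * (A + r ^ 2) := by
              have := sq_nonneg (w - |r|)
              have h2 := sq_abs r
              have h3 : w * |r| ≤ A + r ^ 2 := by nlinarith [sq_nonneg (w + |r|)]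
              nlinarith [mul_le_mul_of_nonneg_left h3 hL0, sq_nonneg r]
            calc D * w * (L * |r| + w) = D * (w * (L * |r| + w)) := by ring
              _ ≤ D * ((L + 1) * (A + r ^ 2)) := by gcongr
              _ = _ := by ring)
        have h1 := (abs_le.1 hyl).2
        have h2 : |τ - s| ≤ |t - s| := (hI τ hτ).2.2
        have h3 : 2 * (D * (L + 1) * (A + r ^ 2)) * |τ - s| ≤ 1 / 2 * (A + r ^ 2) := by
          have hAr : 0 ≤ A + r ^ 2 := by positivity
          calc 2 * (D * (L + 1) * (A + r ^ 2)) * |τ - s|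
              = (2 * D * (L + 1)) * |τ - s| * (A + r ^ 2) := by ring
            _ ≤ C * |t - s| * (A + r ^ 2) := by
                refine mul_le_mul_of_nonneg_right ?_ hAr
                refine mul_le_mul ?_ h2 (abs_nonneg _) hC0.le
                rw [hC]; linarith
            _ ≤ _ := mul_le_mul_of_nonneg_right hst hAr
        have h4 : y τ - y s ≤ 2 * (D * (L + 1) * (A + r ^ 2)) * |τ - s| := h1
        linarith) (t - r) Set.right_mem_uIcc
    have e1 : y (t - r) = nrm N (fun x => ψ x t - ψ x (t - r)) ^ 2 := by
      simp only [hy, sub_add_cancel]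
    rw [← e1]
    refine hgr.trans ?_
    have hsI := (hI s Set.left_mem_uIcc).2.1
    have e2 := hup s hs (s + r) hsI
    rw [add_sub_cancel_left] at e2
    have e3 := pow_le_pow_left₀ (nrm_nonneg _ _) e2 2
    have e4 : y s ≤ (|r| * (nrm N (fun x => dψ x s) + C * (L + K) * |r|)) ^ 2 := e3
    rw [mul_pow, hrabs] at e4
    have e5 : r ^ 2 = (l * |t - s|) ^ 2 := by rw [← hrabs, sq_abs]
    rw [e5]
    linarith
  -- pass to the limit
  set l : ℕ → ℝ := fun n => 1 / ((n : ℝ) + 2) with hl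
  have hl0 : ∀ n, 0 < l n := fun n => by simp only [hl]; positivity
  have hl1 : ∀ n, l n < 1 := fun n => by
    simp only [hl]; rw [div_lt_one (by positivity)]
    have : (0:ℝ) ≤ n := by positivity
    linarith
  have hlt : Tendsto l atTop (𝓝 0) := by
    have h1 := (tendsto_one_div_add_atTop_nhds_zero_nat (𝕜 := ℝ)).comp (tendsto_add_atTop_nat 1)
    refine h1.congr fun n => ?_
    simp only [hl, Function.comp]; push_cast; ring
  have hts : t - s ≠ 0 := sub_ne_zero.2 hne.symm
  have hF := fatou_nrm N (f := fun n x => (l n * (t - s))⁻¹ • (ψ x t - ψ x (t - l n * (t - s))))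
    (g := fun x => dψ x t)
    (m := fun n => Real.sqrt (2 * (nrm N (fun x => dψ x s) + C * (L + K) * (l n * |t - s|)) ^ 2 + 1))
    (m0 := Real.sqrt (2 * (nrm N (fun x => dψ x s) + C * (L + K) * (0 * |t - s|)) ^ 2 + 1))
    (fun n => by have c1 := h.cx t; have c2 := h.cx (t - l n * (t - s)); fun_prop) (h.cdx t)
    (fun x => by
      have h1 := (h.hd x t).tendsto_slope
      have h2 : Tendsto (fun n => t - l n * (t - s)) atTop (𝓝[≠] t) := by
        refine tendsto_nhdsWithin_iff.2 ⟨?_, Eventually.of_forall fun n => ?_⟩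
        · have := (hlt.mul_const (t - s)).const_sub t
          simpa using this
        · have : l n * (t - s) ≠ 0 := mul_ne_zero (hl0 n).ne' hts
          simp only [Set.mem_compl_iff, Set.mem_singleton_iff]
          intro hh; apply this; linarith
      refine (h1.comp h2).congr fun n => ?_
      simp only [Function.comp, slope, vsub_eq_sub]
      rw [sub_sub_cancel_left, inv_neg, neg_smul, ← smul_neg, neg_sub])
    (fun n => by
      rw [nrm_const_mul]
      have h1 := hfd (l n) (hl0 n) (hl1 n)
      have hp : 0 < l n * |t - s| := mul_pos (hl0 n) hd0
      rw [abs_inv, abs_mul, abs_of_pos (hl0 n)]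
      apply Real.le_sqrt_of_sq_le
      rw [mul_pow, inv_pow, inv_mul_le_iff₀ (by positivity)]
      exact h1)
    (by
      refine (Real.continuous_sqrt.tendsto _).comp ?_
      exact ((((hlt.mul_const _).const_mul _).const_add _).pow 2).const_mul 2 |>.add_const 1)
  have h2 := pow_le_pow_left₀ (nrm_nonneg _ _) hF 2
  rw [Real.sq_sqrt (by positivity)] at h2
  simpa using h2

end ls

end part6

section part7
open Filter Topology

section energy

lemma gsq_diff {E : Type*} [NormedAddCommGroup E] [InnerProductSpace ℝ E] (N : ℕ) (hN : 0 < N)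
    {f g : V3 → E} (hf : ContDiff ℝ 2 f)
    (hg : ContDiff ℝ 2 g) (hpf : IsPerN N f) (hpg : IsPerN N g) :
    gsq N f - gsq N g = - (∫ x in cubeN N, inner ℝ (f x - g x) (lapE f x + lapE g x)) ∧
    gsq N f - gsq N g = - (∫ x in cubeN N, inner ℝ (f x + g x) (lapE f x - lapE g x)) := by
  have c1 := hf.continuous
  have c2 := hg.continuous
  have c3 := cont_lap hf
  have c4 := cont_lap hg
  have hs : ∫ x in cubeN N, inner ℝ (f x) (lapE g x) = ∫ x in cubeN N, inner ℝ (g x) (lapE f x) := by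
    rw [green N hN (hf.of_le one_le_two) hg hpf hpg, green N hN (hg.of_le one_le_two) hf hpg hpf]
    simp_rw [real_inner_comm]
  rw [gsq_eq N hN hf hpf, gsq_eq N hN hg hpg]
  have i1 : IntegrableOn (fun x => inner ℝ (f x) (lapE f x)) (cubeN N) := intQ N (by fun_prop)
  have i2 : IntegrableOn (fun x => inner ℝ (f x) (lapE g x)) (cubeN N) := intQ N (by fun_prop)
  have i3 : IntegrableOn (fun x => inner ℝ (g x) (lapE f x)) (cubeN N) := intQ N (by fun_prop)
  have i4 : IntegrableOn (fun x => inner ℝ (g x) (lapE g x)) (cubeN N) := intQ N (by fun_prop)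
  constructor
  · simp_rw [inner_sub_left, inner_add_right]
    rw [integral_sub (intQ N (by fun_prop)) (intQ N (by fun_prop)), integral_add i1 i2, integral_add i3 i4]
    linarith
  · simp_rw [inner_add_left, inner_sub_right]
    rw [integral_add (intQ N (by fun_prop)) (intQ N (by fun_prop)), integral_sub i1 i2, integral_sub i3 i4]
    linarith

lemma static_id (N : ℕ) (hN : 0 < N) {σ : V3 → ℝ} (hσ : Continuous σ) {e : ℝ}
    {ψ ψ' : V3 → ℂ} {Φ Φ' : V3 → ℝ} {q q' : GammaIdx N → V3}
    (h : PS N σ e ψ Φ q) (h' : PS N σ e ψ' Φ' q') :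
    (1 / 2 * gsq N ψ + 1 / 2 * gsq N Φ) - (1 / 2 * gsq N ψ' + 1 / 2 * gsq N Φ') =
      (∫ x in cubeN N, inner ℝ (ψ x - ψ' x) (Complex.I * (rhsS e ψ Φ x + rhsS e ψ' Φ' x)))
      + (e / 2) * (∫ x in cubeN N, (Φ x - Φ' x) * ‖ψ x - ψ' x‖ ^ 2)
      + (1 / 2) * (∫ x in cubeN N, (Φ x - Φ' x) * (stot σ q x - stot σ q' x))
      + ((∫ x in cubeN N, Φ' x * stot σ q x) - ∫ x in cubeN N, Φ' x * stot σ q' x) := by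
  have h1 := (gsq_diff N hN h.c2ψ h'.c2ψ h.perψ h'.perψ).1
  have h2 := (gsq_diff N hN h.c2Φ h'.c2Φ h.perΦ h'.perΦ).2
  have c1 := h.c2ψ.continuous
  have c2 := h'.c2ψ.continuous
  have c3 := cont_lap h.c2ψ
  have c4 := cont_lap h'.c2ψ
  have d1 := h.c2Φ.continuous
  have d2 := h'.c2Φ.continuous
  have d3 := cont_lap h.c2Φ
  have d4 := cont_lap h'.c2Φ
  have s1 := cont_stot hσ q
  have s2 := cont_stot hσ q'
  have r1 : Continuous (rhsS e ψ Φ) := cont_rhs h.c2ψ d1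
  have r2 : Continuous (rhsS e ψ' Φ') := cont_rhs h'.c2ψ d2
  have e1 : (1 / 2 * gsq N ψ + 1 / 2 * gsq N Φ) - (1 / 2 * gsq N ψ' + 1 / 2 * gsq N Φ')
      = (-(1 / 2)) * (∫ x in cubeN N, inner ℝ (ψ x - ψ' x) (lapE ψ x + lapE ψ' x))
        + (-(1 / 2)) * (∫ x in cubeN N, inner ℝ (Φ x + Φ' x) (lapE Φ x - lapE Φ' x)) := by linarith
  rw [e1, ← integral_const_mul, ← integral_const_mul, ← integral_const_mul, ← integral_const_mul]
  rw [← integral_sub (intQ N (by fun_prop)) (intQ N (by fun_prop)),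
    ← integral_add (intQ N (by fun_prop)) (intQ N (by fun_prop)),
    ← integral_add (intQ N (by fun_prop)) (intQ N (by fun_prop)),
    ← integral_add (intQ N (by fun_prop)) (intQ N (by fun_prop)),
    ← integral_add (intQ N (by fun_prop)) (intQ N (by fun_prop))]
  congr 1; ext x
  have p1 := h.poi x
  have p2 := h'.poi x
  have e2 : lapE Φ x - lapE Φ' x = (stot σ q' x - e * ‖ψ' x‖ ^ 2) - (stot σ q x - e * ‖ψ x‖ ^ 2) := by
    linarith
  rw [e2]
  simp only [rhsS, Complex.inner, ← Complex.normSq_eq_norm_sq, Complex.normSq_apply]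
  simp
  ring

variable {N : ℕ} {σ : V3 → ℝ} {e : ℝ} {ψ dψ : V3 → ℝ → ℂ} {Φ : V3 → ℝ → ℝ}
    {q : ℝ → GammaIdx N → V3} {S : Set ℝ} {K L : ℝ}

lemma LS.weakd (h : LS N σ e ψ dψ Φ q S K L) {s : ℝ} (hs : s ∈ S) {φ : V3 → ℂ} (hφ : Continuous φ) :
    Tendsto (fun t => ∫ x in cubeN N, inner ℝ (φ x) (dψ x t)) (𝓝[S] s)
      (𝓝 (∫ x in cubeN N, inner ℝ (φ x) (dψ x s))) :=
  weak_conv N (f := fun t x => dψ x t) (g := fun x => dψ x s) h.cdx (h.cdx s)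
    (fun x => ((h.ct x).tendsto s).mono_left nhdsWithin_le_nhds)
    (K := K) (by filter_upwards [self_mem_nhdsWithin] with t ht using h.b1 t ht) (h.b1 s hs) hφ

lemma LS.strong (hN : 0 < N) (hσ : ContDiff ℝ 2 σ) (hσp : IsPerN N σ) (he : 0 < e)
    (h : LS N σ e ψ dψ Φ q S K L) {B : ℝ} (hB0 : 0 ≤ B) (hB : ∀ t ∈ S, n4 N (fun x => ψ x t) ≤ B)
    {s : ℝ} (hs : s ∈ S) {ε : ℝ} (hε : 0 < ε) :
    ∀ᶠ t in 𝓝[S] s, nrm N (fun x => (ψ x t - ψ x s) - (t - s) • dψ x s) ≤ ε * |t - s| := by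
  obtain ⟨C, hC0, hC⟩ := ls_growth N hN σ hσ hσp e he B L hB0 h.L0
  have hg := fun t ht => (hC ψ dψ Φ q S K h hB s hs t ht).1
  set X := nrm N (fun x => dψ x s) with hX
  have hX0 : 0 ≤ X := nrm_nonneg _ _
  set D := C * (L + K) with hD
  have hL0 := h.L0
  have hK0 := h.K0
  have hD0 : 0 ≤ D := by positivity
  have cds := h.cdx s
  have hw := (Metric.tendsto_nhds.1 (h.weakd hs cds)) (ε ^ 2 / 4) (by positivity)
  have hlim : Tendsto (fun t : ℝ => 2 * X * D * |t - s| + D ^ 2 * |t - s| ^ 2) (𝓝[S] s) (𝓝 0) := by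
    have : Continuous (fun t : ℝ => 2 * X * D * |t - s| + D ^ 2 * |t - s| ^ 2) := by fun_prop
    have h1 := this.tendsto s
    simp only [sub_self, abs_zero, mul_zero, ne_eq, OfNat.ofNat_ne_zero, not_false_eq_true,
      zero_pow, add_zero] at h1
    exact h1.mono_left nhdsWithin_le_nhds
  have hl2 := hlim.eventually (gt_mem_nhds (show (0 : ℝ) < ε ^ 2 / 2 by positivity))
  obtain ⟨δ, hδ, hball⟩ := Metric.mem_nhdsWithin_iff.1 hw
  filter_upwards [hl2, self_mem_nhdsWithin, mem_nhdsWithin_of_mem_nhds (Metric.ball_mem_nhds s hδ)]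
    with t ht htS htb
  have hsub := h.conv.uIcc_subset hs htS
  have cψ : ∀ t, Continuous fun x => ψ x t := h.cx
  have cψt := cψ t
  have cψs := cψ s
  -- inner product estimate
  have hin : |(∫ x in cubeN N, inner ℝ (dψ x s) (ψ x t - t • dψ x s))
      - ∫ x in cubeN N, inner ℝ (dψ x s) (ψ x s - s • dψ x s)| ≤ ε ^ 2 / 4 * |t - s| := by
    refine ff_le N (f := fun x τ => inner ℝ (dψ x s) (ψ x τ - τ • dψ x s))
      (g := fun x τ => inner ℝ (dψ x s) (dψ x τ - dψ x s)) (K := K * (2 * K))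
      (fun τ => by have := cψ τ; fun_prop) (fun x τ _ => ?_)
      (fun x => by have := h.ct x; fun_prop) (fun τ => by have := h.cdx τ; fun_prop) ?_ ?_
    · have h1 := ((h.hd x τ).sub ((hasDerivAt_id τ).smul_const (dψ x s)))
      have h2 := (hasDerivAt_const τ (dψ x s)).inner ℝ h1
      simpa using h2
    · intro τ hτ
      have := h.cdx τ
      calc _ ≤ ∫ x in cubeN N, ‖dψ x s‖ * ‖dψ x τ - dψ x s‖ := by
            refine integral_mono (intQ N (by fun_prop)) (intQ N (by fun_prop)) fun x => ?_
            exact abs_real_inner_le_norm _ _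
        _ ≤ nrm N (fun x => dψ x s) * nrm N (fun x => dψ x τ - dψ x s) :=
            cs_norm N cds (by fun_prop)
        _ ≤ K * (2 * K) := by
            refine mul_le_mul (h.b1 s hs) ?_ (nrm_nonneg _ _) hK0
            have := nrm_sub_le N (h.cdx τ) cds
            linarith [h.b1 s hs, h.b1 τ (hsub hτ)]
    · intro τ hτ
      have hc := h.cdx τ
      have hτb : τ ∈ Metric.ball s δ := by
        rw [Metric.mem_ball, Real.dist_eq] at htb ⊢
        exact (Set.abs_sub_left_of_mem_uIcc hτ).trans_lt htb
      have h3 : dist _ _ < _ := hball ⟨hτb, hsub hτ⟩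
      rw [Real.dist_eq, ← integral_sub (intQ N (by fun_prop)) (intQ N (by fun_prop))] at h3
      simp_rw [inner_sub_right]
      exact h3.le
  have hin2 : (∫ x in cubeN N, inner ℝ (dψ x s) (ψ x t - t • dψ x s))
      - ∫ x in cubeN N, inner ℝ (dψ x s) (ψ x s - s • dψ x s)
      = (∫ x in cubeN N, inner ℝ (dψ x s) (ψ x t - ψ x s)) - (t - s) * X ^ 2 := by
    rw [hX, nrm_sq, ← integral_const_mul, ← integral_sub (intQ N (by fun_prop)) (intQ N (by fun_prop)),
      ← integral_sub (intQ N (by fun_prop)) (intQ N (by fun_prop))]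
    congr 1; ext x
    simp only [inner_sub_right, inner_smul_right, real_inner_self_eq_norm_sq]
    ring
  rw [hin2] at hin
  set J := ∫ x in cubeN N, inner ℝ (dψ x s) (ψ x t - ψ x s) with hJ
  have hexp := nrm_sub_sq N (f := fun x => ψ x t - ψ x s) (g := fun x => (t - s) • dψ x s)
    (by fun_prop) (by fun_prop)
  have hcross : ∫ x in cubeN N, inner ℝ (ψ x t - ψ x s) ((t - s) • dψ x s) = (t - s) * J := by
    rw [hJ, ← integral_const_mul]
    congr 1; ext x
    rw [inner_smul_right, real_inner_comm]
  rw [hcross, nrm_const_mul, mul_pow, sq_abs] at hexp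
  have ha := pow_le_pow_left₀ (nrm_nonneg _ _) (hg t htS) 2
  rw [mul_pow, sq_abs] at ha
  have hJ2 : (t - s) * (t - s) * X ^ 2 - ε ^ 2 / 4 * (t - s) ^ 2 ≤ (t - s) * J := by
    have h5 : |(t - s) * (J - (t - s) * X ^ 2)| ≤ |t - s| * (ε ^ 2 / 4 * |t - s|) := by
      rw [abs_mul]; exact mul_le_mul_of_nonneg_left hin (abs_nonneg _)
    have h6 := (abs_le.1 h5).1
    have h7 : |t - s| * (ε ^ 2 / 4 * |t - s|) = ε ^ 2 / 4 * (t - s) ^ 2 := by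
      rw [← sq_abs (t - s)]; ring
    rw [h7] at h6
    nlinarith
  have hfin : nrm N (fun x => (ψ x t - ψ x s) - (t - s) • dψ x s) ^ 2 ≤ (ε * |t - s|) ^ 2 := by
    rw [hexp]
    have h8 : (t - s) ^ 2 * (X + D * |t - s|) ^ 2 ≤ (t - s) ^ 2 * (X ^ 2 + ε ^ 2 / 2) := by
      refine mul_le_mul_of_nonneg_left ?_ (sq_nonneg _)
      nlinarith
    rw [mul_pow, sq_abs]
    nlinarith
  exact (pow_le_pow_iff_left₀ (nrm_nonneg _ _) (by positivity) two_ne_zero).1 hfin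

end energy

end part7

section part8
open Filter Topology

section energy2

lemma hdw_zero {f : ℝ → ℝ} {S : Set ℝ} {s : ℝ}
    (h : ∀ ε > 0, ∀ᶠ t in 𝓝[S] s, |f t - f s| ≤ ε * |t - s|) : HasDerivWithinAt f 0 S s := by
  rw [hasDerivWithinAt_iff_isLittleO, Asymptotics.isLittleO_iff]
  intro ε hε
  filter_upwards [h ε hε] with t ht
  simpa using ht

lemma dG (N : ℕ) (hN : 0 < N) {σ φ : V3 → ℝ} (hσ : Continuous σ) (hσp : IsPerN N σ)
    (hφ : ContDiff ℝ 1 φ) (hφp : IsPerN N φ) (a v : V3) :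
    ∃ G' : V3 →L[ℝ] ℝ, HasFDerivAt (fun v => ∫ x in cubeN N, φ x * σ (x - a - v)) G' v ∧
      ∀ w, G' w = ∑ i, w i * ∫ x in cubeN N, pd i φ x * σ (x - a - v) := by
  have hsp : IsPerN N fun x => σ (x - a) := by
    simpa [sub_eq_add_neg] using per_add_fun hσp (-a)
  have hshift : ∀ f : V3 → ℝ, IsPerN N f → ∀ v, ∫ x in cubeN N, f x * σ (x - a - v)
      = ∫ x in cubeN N, σ (x - a) * f (x + v) := by
    intro f hf v
    have hp : IsPerN N (fun x => f x * σ (x - a - v)) := by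
      refine per_comp2 hf (?_ : IsPerN N fun x => σ (x - a - v)) (fun a b => a * b)
      simpa [sub_eq_add_neg, add_assoc] using per_add_fun hσp (-a - v)
    rw [← shift_int N hN hp v]
    congr 1; ext x
    rw [mul_comm, show x + v - a - v = x - a by abel]
  have hfd := hφ.continuous_fderiv one_ne_zero
  obtain ⟨C, hC0, hC⟩ := per_bdd N hN hfd (per_fderiv hφp)
  have hcφ := hφ.continuous
  refine ⟨∫ x in cubeN N, σ (x - a) • fderiv ℝ φ (x + v), ?_, ?_⟩
  · have := hasFDerivAt_integral_of_dominated_of_fderiv_le (μ := volume.restrict (cubeN N)) (𝕜 := ℝ)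
      (F := fun v x => σ (x - a) * φ (x + v)) (F' := fun v x => σ (x - a) • fderiv ℝ φ (x + v))
      (x₀ := v) (s := Set.univ) (bound := fun x => ‖σ (x - a)‖ * C) univ_mem
      (Eventually.of_forall fun v => (Continuous.aestronglyMeasurable (by fun_prop)))
      (intQ N (by fun_prop)) (Continuous.aestronglyMeasurable (by fun_prop))
      (Eventually.of_forall fun x v _ => by
        rw [norm_smul]; exact mul_le_mul_of_nonneg_left (hC _) (norm_nonneg _))
      (intQ N (by fun_prop))
      (Eventually.of_forall fun x v _ => by
        have h1 := (hφ.differentiable one_ne_zero (x + v)).hasFDerivAt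
        have h2 := h1.comp v ((hasFDerivAt_id v).const_add x)
        exact h2.const_mul (σ (x - a)))
    refine this.congr_of_eventuallyEq (Eventually.of_forall fun v => ?_)
    exact hshift φ hφp v
  · intro w
    have hint : Integrable (fun x => σ (x - a) • fderiv ℝ φ (x + v)) (volume.restrict (cubeN N)) :=
      intQ N (by fun_prop)
    rw [ContinuousLinearMap.integral_apply hint]
    simp_rw [hshift _ (per_pd hφp _)]
    simp_rw [← integral_const_mul]
    rw [← integral_finsetSum]
    · congr 1; ext x
      simp only [ContinuousLinearMap.smul_apply, smul_eq_mul, fderiv_eq_sum, Finset.mul_sum]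
      exact Finset.sum_congr rfl fun i _ => by ring
    · intro i _
      have := cont_pd hφ i
      exact intQ N (by fun_prop)

lemma dF (N : ℕ) (hN : 0 < N) {σ φ : V3 → ℝ} (hσ : Continuous σ) (hσp : IsPerN N σ)
    (hφ : ContDiff ℝ 1 φ) (hφp : IsPerN N φ) {q qd : ℝ → GammaIdx N → V3} {s : ℝ}
    (hq : ∀ n i, HasDerivAt (fun u => q u n i) (qd s n i) s) :
    HasDerivAt (fun t => ∫ x in cubeN N, φ x * stot σ (q t) x)
      (∑ n, ∑ i, qd s n i * ∫ x in cubeN N, pd i φ x * σ (x - embG n - q s n)) s := by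
  have hcφ := hφ.continuous
  have h1 : ∀ t, ∫ x in cubeN N, φ x * stot σ (q t) x
      = ∑ n, ∫ x in cubeN N, φ x * σ (x - embG n - q t n) := by
    intro t
    rw [← integral_finsetSum _ fun n _ => intQ N (by fun_prop)]
    simp_rw [stot, Finset.mul_sum]
  simp_rw [h1]
  refine HasDerivAt.fun_sum fun n _ => ?_
  obtain ⟨G', hG, hG'⟩ := dG N hN hσ hσp hφ hφp (embG n) (q s n)
  rw [← hG']
  have : HasDerivAt (fun u => q u n) (qd s n) s := hasDerivAt_pi.2 fun i => hq n i
  exact hG.comp_hasDerivAt s this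

/-- total energy -/
def en (N : ℕ) (M : ℝ) (ψ : V3 → ℂ) (Φ : V3 → ℝ) (p : GammaIdx N → V3) : ℝ :=
  1 / 2 * gsq N ψ + 1 / 2 * gsq N Φ + M / 2 * ∑ n, ∑ i, p n i ^ 2

variable {N : ℕ} {σ : V3 → ℝ} {e M : ℝ} {ψ dψ : V3 → ℝ → ℂ} {Φ : V3 → ℝ → ℝ}
    {q qd qdd : ℝ → GammaIdx N → V3} {S : Set ℝ} {K L : ℝ}

lemma LS.energy (hN : 0 < N) (hσ : ContDiff ℝ 2 σ) (hσp : IsPerN N σ) (he : 0 < e)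
    (h : LS N σ e ψ dψ Φ q S K L) {B : ℝ} (hB0 : 0 ≤ B) (hB : ∀ t ∈ S, n4 N (fun x => ψ x t) ≤ B)
    (hq : ∀ t n i, HasDerivAt (fun u => q u n i) (qd t n i) t)
    (hqd : ∀ t n i, HasDerivAt (fun u => qd u n i) (qdd t n i) t)
    (hnew : ∀ t ∈ S, ∀ n i, M * qdd t n i =
      - ∫ x in cubeN N, pd i (fun x => Φ x t) x * σ (x - embG n - q t n))
    {s t : ℝ} (hs : s ∈ S) (ht : t ∈ S) :
    en N M (fun x => ψ x t) (fun x => Φ x t) (qd t) = en N M (fun x => ψ x s) (fun x => Φ x s) (qd s) := by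
  have hK0 := h.K0
  have hL0 := h.L0
  have key : ∀ s ∈ S, HasDerivWithinAt
      (fun t => en N M (fun x => ψ x t) (fun x => Φ x t) (qd t)) 0 S s := by
    intro s hs
    obtain ⟨C, hC0, hC⟩ := poisson_stab N hN σ hσ hσp e he
    obtain ⟨Lσ, hLσ0, hLσ⟩ := per_lip N hN (hσ.of_le one_le_two) hσp
    have ps := h.ps s hs
    set A : ℝ → ℝ := fun t => ∫ x in cubeN N, inner ℝ (ψ x t - ψ x s)
      (Complex.I * (dψ x t + dψ x s)) with hA
    set R : ℝ → ℝ := fun t => (e / 2) * (∫ x in cubeN N, (Φ x t - Φ x s) * ‖ψ x t - ψ x s‖ ^ 2)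
      + (1 / 2) * (∫ x in cubeN N, (Φ x t - Φ x s) * (stot σ (q t) x - stot σ (q s) x)) with hR
    set W : ℝ → ℝ := fun t => (∫ x in cubeN N, Φ x s * stot σ (q t) x)
      + M / 2 * ∑ n, ∑ i, qd t n i ^ 2 with hWdef
    have hdec : ∀ t ∈ S, en N M (fun x => ψ x t) (fun x => Φ x t) (qd t)
        = A t + R t + W t + (1 / 2 * gsq N (fun x => ψ x s) + 1 / 2 * gsq N (fun x => Φ x s)
          - ∫ x in cubeN N, Φ x s * stot σ (q s) x) := by
      intro t ht
      have := static_id N hN hσ.continuous (h.ps t ht) ps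
      simp_rw [← h.sch t ht, ← h.sch s hs] at this
      simp only [en, hA, hR, hWdef]
      linarith
    -- A
    have hA0 : A s = 0 := by simp [hA]
    have dA : HasDerivWithinAt A 0 S s := by
      refine hdw_zero fun ε hε => ?_
      rw [hA0]
      have cds := h.cdx s
      have cψs := h.cx s
      have h1 := h.strong hN hσ hσp he hB0 hB hs (ε := ε / (2 * (2 * K + 1))) (by positivity)
      have h2 := h.weakd hs (φ := fun x => -(Complex.I * dψ x s)) (by fun_prop)
      have h3 : ∫ x in cubeN N, inner ℝ (-(Complex.I * dψ x s)) (dψ x s) = 0 := by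
        simp_rw [inner_neg_left, ← inner_I, inner_I_self]; simp
      rw [h3] at h2
      have h4 := (Metric.tendsto_nhds.1 h2) (ε / 2) (by positivity)
      filter_upwards [h1, h4, self_mem_nhdsWithin] with t h1 h4 ht
      have cdt := h.cdx t
      have cψt := h.cx t
      rw [Real.dist_eq, sub_zero] at h4
      have hsplit : A t = (∫ x in cubeN N, inner ℝ ((ψ x t - ψ x s) - (t - s) • dψ x s)
            (Complex.I * (dψ x t + dψ x s)))
          + (t - s) * ∫ x in cubeN N, inner ℝ (-(Complex.I * dψ x s)) (dψ x t) := by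
        rw [← integral_const_mul, ← integral_add (intQ N (by fun_prop)) (intQ N (by fun_prop))]
        simp only [hA]
        congr 1; ext x
        rw [inner_sub_left ((ψ x t - ψ x s)), inner_neg_left, ← inner_I, inner_smul_left, mul_add, inner_add_right (dψ x s),
          inner_I_self]
        simp
      rw [sub_zero, hsplit]
      have h5 : |∫ x in cubeN N, inner ℝ ((ψ x t - ψ x s) - (t - s) • dψ x s)
            (Complex.I * (dψ x t + dψ x s))| ≤ ε / (2 * (2 * K + 1)) * |t - s| * (2 * K) := by
        refine (cs_inner N (by fun_prop) (by fun_prop)).trans ?_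
        refine mul_le_mul h1 ?_ (nrm_nonneg _ _) (by positivity)
        have h6 : nrm N (fun x => Complex.I * (dψ x t + dψ x s)) ≤ nrm N (fun x => dψ x t + dψ x s) :=
          nrm_mono N (by fun_prop) (by fun_prop) fun x => by simp
        have h7 := nrm_add_le N cdt cds
        linarith [h.b1 t ht, h.b1 s hs]
      have h6 : ε / (2 * (2 * K + 1)) * |t - s| * (2 * K) ≤ ε / 2 * |t - s| := by
        have : ε / (2 * (2 * K + 1)) * (2 * K) ≤ ε / 2 := by
          rw [div_mul_eq_mul_div, div_le_div_iff₀ (by positivity) (by positivity)]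
          nlinarith
        nlinarith [abs_nonneg (t - s)]
      have h7 : |(t - s) * ∫ x in cubeN N, inner ℝ (-(Complex.I * dψ x s)) (dψ x t)|
          ≤ |t - s| * (ε / 2) := by
        rw [abs_mul]; exact mul_le_mul_of_nonneg_left h4.le (abs_nonneg _)
      refine (abs_add_le _ _).trans ?_
      linarith
    -- R
    have hR0 : R s = 0 := by simp [hR]
    set P : ℝ := C * (L + K * (B + B)) with hP
    have hP0 : 0 ≤ P := by positivity
    set D : ℝ := e / 2 * (K * (P * (B + B)))
      + 1 / 2 * ((Fintype.card (GammaIdx N)) * (Lσ * L) * (Real.sqrt ((N : ℝ) ^ 3) * P)) with hD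
    have hD0 : 0 ≤ D := by positivity
    have hRb : ∀ t ∈ S, |R t| ≤ D * |t - s| ^ 2 := by
      intro t ht
      have pt := h.ps t ht
      have c1 := pt.c2ψ.continuous
      have c2 := ps.c2ψ.continuous
      have c3 := pt.c2Φ.continuous
      have c4 := ps.c2Φ.continuous
      have s1 := cont_stot hσ.continuous (q t)
      have s2 := cont_stot hσ.continuous (q s)
      have hst := hC _ _ _ _ _ _ pt ps
      have hψl := h.lipψ hs ht
      have hql := h.lip t ht s hs
      have hPb : C * (‖q t - q s‖ + nrm N (fun x => ψ x t - ψ x s) *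
          (n4 N (fun x => ψ x t) + n4 N (fun x => ψ x s))) ≤ P * |t - s| := by
        rw [hP, mul_assoc, add_mul]
        refine mul_le_mul_of_nonneg_left (add_le_add hql ?_) hC0
        rw [show K * (B + B) * |t - s| = (K * |t - s|) * (B + B) by ring]
        exact mul_le_mul hψl (add_le_add (hB t ht) (hB s hs))
          (add_nonneg (n4_nonneg _ _) (n4_nonneg _ _)) (by positivity)
      have h4 := hst.2.2.trans hPb
      have h2 := hst.2.1.trans hPb
      have b1 : |∫ x in cubeN N, (Φ x t - Φ x s) * ‖ψ x t - ψ x s‖ ^ 2|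
          ≤ K * |t - s| * (P * |t - s| * (B + B)) := by
        calc _ ≤ ∫ x in cubeN N, (‖ψ x t - ψ x s‖ * (‖Φ x t - Φ x s‖ * ‖ψ x t‖)
                  + ‖ψ x t - ψ x s‖ * (‖Φ x t - Φ x s‖ * ‖ψ x s‖)) := by
              refine abs_integral_le_integral_abs.trans ?_
              refine integral_mono (intQ N (by fun_prop)) (intQ N (by fun_prop)) fun x => ?_
              simp only
              rw [abs_mul, abs_of_nonneg (sq_nonneg ‖ψ x t - ψ x s‖), ← Real.norm_eq_abs]
              have := norm_sub_le (ψ x t) (ψ x s)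
              have a1 := norm_nonneg (ψ x t - ψ x s)
              have a2 := norm_nonneg (Φ x t - Φ x s)
              have a3 := mul_nonneg a1 a2
              nlinarith
          _ = (∫ x in cubeN N, ‖ψ x t - ψ x s‖ * (‖Φ x t - Φ x s‖ * ‖ψ x t‖))
              + ∫ x in cubeN N, ‖ψ x t - ψ x s‖ * (‖Φ x t - Φ x s‖ * ‖ψ x s‖) :=
              integral_add (intQ N (by fun_prop)) (intQ N (by fun_prop))
          _ ≤ K * |t - s| * (P * |t - s| * B) + K * |t - s| * (P * |t - s| * B) := by
              refine add_le_add ?_ ?_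
              · refine (holder3 N (f := fun x => ψ x t - ψ x s) (g := fun x => Φ x t - Φ x s)
                  (h := fun x => ψ x t) (by fun_prop) (by fun_prop) c1).trans ?_
                have := n4_nonneg N (fun x => ψ x t)
                have := n4_nonneg N (fun x => Φ x t - Φ x s)
                have := hB t ht
                gcongr
              · refine (holder3 N (f := fun x => ψ x t - ψ x s) (g := fun x => Φ x t - Φ x s)
                  (h := fun x => ψ x s) (by fun_prop) (by fun_prop) c2).trans ?_
                have := n4_nonneg N (fun x => ψ x s)
                have := n4_nonneg N (fun x => Φ x t - Φ x s)
                have := hB s hs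
                gcongr
          _ = _ := by ring
      have b2 : |∫ x in cubeN N, (Φ x t - Φ x s) * (stot σ (q t) x - stot σ (q s) x)|
          ≤ (Fintype.card (GammaIdx N)) * (Lσ * (L * |t - s|)) * (Real.sqrt ((N : ℝ) ^ 3) * (P * |t - s|)) := by
        calc _ ≤ ∫ x in cubeN N, (Fintype.card (GammaIdx N)) * (Lσ * (L * |t - s|)) * ‖Φ x t - Φ x s‖ := by
              refine abs_integral_le_integral_abs.trans ?_
              refine integral_mono (intQ N (by fun_prop)) (intQ N (by fun_prop)) fun x => ?_
              simp only
              rw [abs_mul, mul_comm, ← Real.norm_eq_abs (Φ x t - Φ x s)]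
              refine mul_le_mul_of_nonneg_right ?_ (norm_nonneg _)
              rw [stot, stot, ← Finset.sum_sub_distrib]
              refine (Finset.abs_sum_le_sum_abs _ _).trans ?_
              have : ∀ n ∈ (Finset.univ : Finset (GammaIdx N)),
                  |σ (x - embG n - q t n) - σ (x - embG n - q s n)| ≤ Lσ * (L * |t - s|) := by
                intro n _
                refine (hLσ _ _).trans (mul_le_mul_of_nonneg_left ?_ hLσ0)
                rw [sub_sub_sub_cancel_left, norm_sub_rev]
                exact (norm_le_pi_norm (q t - q s) n).trans hql
              refine (Finset.sum_le_card_nsmul _ _ _ this).trans ?_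
              rw [nsmul_eq_mul, Finset.card_univ]
          _ = (Fintype.card (GammaIdx N)) * (Lσ * (L * |t - s|)) * ∫ x in cubeN N, ‖Φ x t - Φ x s‖ :=
              integral_const_mul _ _
          _ ≤ _ := by
              refine mul_le_mul_of_nonneg_left ?_ (by positivity)
              refine (int_norm_le N (f := fun x => Φ x t - Φ x s) (by fun_prop)).trans ?_
              gcongr
      simp only [hR]
      refine (abs_add_le _ _).trans ?_
      rw [abs_mul, abs_mul, abs_of_pos (by positivity : (0:ℝ) < e / 2),
        abs_of_pos (by norm_num : (0:ℝ) < 1 / 2)]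
      calc _ ≤ e / 2 * (K * |t - s| * (P * |t - s| * (B + B)))
          + 1 / 2 * ((Fintype.card (GammaIdx N)) * (Lσ * (L * |t - s|)) * (Real.sqrt ((N : ℝ) ^ 3) * (P * |t - s|))) := by
            gcongr
        _ = _ := by rw [hD]; ring
    have dR : HasDerivWithinAt R 0 S s := by
      refine hdw_zero fun ε hε => ?_
      have hlim : Tendsto (fun t : ℝ => D * |t - s|) (𝓝[S] s) (𝓝 0) := by
        have : Continuous (fun t : ℝ => D * |t - s|) := by fun_prop
        have h1 := this.tendsto s
        simp only [sub_self, abs_zero, mul_zero] at h1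
        exact h1.mono_left nhdsWithin_le_nhds
      filter_upwards [hlim.eventually (gt_mem_nhds hε), self_mem_nhdsWithin] with t h1 ht
      rw [hR0, sub_zero]
      refine (hRb t ht).trans ?_
      nlinarith [abs_nonneg (t - s)]
    have dW : HasDerivAt W 0 s := by
      have h1 := dF N hN hσ.continuous hσp (ps.c2Φ.of_le one_le_two) ps.perΦ (q := q) (qd := qd) (s := s) (hq s)
      have h2 : HasDerivAt (fun t => ∑ n, ∑ i, qd t n i ^ 2)
          (∑ n, ∑ i, 2 * qd s n i * qdd s n i) s := by
        refine HasDerivAt.fun_sum fun n _ => HasDerivAt.fun_sum fun i _ => ?_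
        have := (hqd s n i).fun_pow 2
        simpa using this
      have h3 := h1.add (h2.const_mul (M / 2))
      refine h3.congr_deriv ?_
      rw [Finset.mul_sum, ← Finset.sum_add_distrib]
      refine Finset.sum_eq_zero fun n _ => ?_
      rw [Finset.mul_sum, ← Finset.sum_add_distrib]
      refine Finset.sum_eq_zero fun i _ => ?_
      have := hnew s hs n i
      linear_combination (qd s n i) * this
    have := ((dA.add dR).add dW.hasDerivWithinAt).add_const (1 / 2 * gsq N (fun x => ψ x s) + 1 / 2 * gsq N (fun x => Φ x s)
          - ∫ x in cubeN N, Φ x s * stot σ (q s) x)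
    simp only [add_zero] at this
    exact this.congr hdec (hdec s hs)
  have hconv : Convex ℝ S := h.conv.convex
  have := hconv.norm_image_sub_le_of_norm_hasDerivWithin_le (C := 0) key (by simp) hs ht
  rw [zero_mul, norm_le_zero_iff, sub_eq_zero] at this
  exact this

end energy2

end part8

section part9
open Filter Topology

section gauge

/-- mean of the potential -/
def cav (N : ℕ) (Φ : V3 → ℝ → ℝ) (t : ℝ) : ℝ := avg N (fun x => Φ x t)

/-- normalised potential -/
def Phi0 (N : ℕ) (Φ : V3 → ℝ → ℝ) (x : V3) (t : ℝ) : ℝ := Φ x t - cav N Φ t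

/-- norm of the gauge-normalised time derivative -/
def Xn (N : ℕ) (e : ℝ) (ψ : V3 → ℝ → ℂ) (Φ : V3 → ℝ → ℝ) (t : ℝ) : ℝ :=
  nrm N (rhsS e (fun x => ψ x t) (fun x => Phi0 N Φ x t))

/-- the sets used in the Baire argument -/
def AK (N : ℕ) (ψ : V3 → ℝ → ℂ) (Φ : V3 → ℝ → ℝ) (K : ℝ) : Set ℝ :=
  {t | nrm N (fun x => ψ x t) ≤ K ∧ nrm N (fun x => deriv (ψ x) t) ≤ K ∧ nrm N (fun x => Φ x t) ≤ K}

variable {N : ℕ} {σ : V3 → ℝ} {e M : ℝ} {ψ : V3 → ℝ → ℂ} {Φ : V3 → ℝ → ℝ}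
    {q : ℝ → GammaIdx N → V3}

lemma AK_mono {K K' : ℝ} (h : K ≤ K') : AK N ψ Φ K ⊆ AK N ψ Φ K' :=
  fun _ ht => ⟨ht.1.trans h, ht.2.1.trans h, ht.2.2.trans h⟩

lemma deriv_eq (h : IsSPN N σ e M ψ Φ q) (x : V3) (t : ℝ) :
    deriv (ψ x) t = rhsS e (fun x => ψ x t) (fun x => Φ x t) x := by
  have h1 := h.schrodinger x t
  have h2 : lapE (fun y => ψ y t) x = lapC (fun y => ψ y t) x := rfl
  have h3 : deriv (ψ x) t = - (Complex.I * (Complex.I * deriv (fun s => ψ x s) t)) := by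
    rw [← mul_assoc, Complex.I_mul_I]; ring
  rw [h3, h1]
  simp only [rhsS, h2, Complex.real_smul]
  push_cast
  ring

lemma rhs_gauge {ψ' : V3 → ℂ} {Φ' : V3 → ℝ} (c : ℝ) (x : V3) :
    rhsS e ψ' (fun x => Φ' x - c) x = rhsS e ψ' Φ' x - (Complex.I * (e * c : ℝ)) * ψ' x := by
  simp only [rhsS, Complex.real_smul]
  push_cast; ring

lemma spn_ps (hN : 0 < N) (h : IsSPN N σ e M ψ Φ q) (t : ℝ) :
    PS N σ e (fun x => ψ x t) (fun x => Phi0 N Φ x t) (q t) where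
  c2ψ := h.regx_psi t
  perψ := h.per_psi t
  c2Φ := (h.regx_Phi t).sub contDiff_const
  perΦ := per_comp (h.per_Phi t) fun a => a - cav N Φ t
  mean := by
    have := (h.regx_Phi t).continuous
    have hN' : (N : ℝ) ≠ 0 := by exact_mod_cast hN.ne'
    simp only [Phi0, cav, avg]
    rw [integral_sub (intQ N (by fun_prop)) (intQ N (by fun_prop)), const_int]
    simp only [smul_eq_mul]
    field_simp
    ring
  poi := fun x => by
    have h1 := h.poisson x t
    have h2 : lapE (fun y => Phi0 N Φ y t) x = lapR (fun y => Φ y t) x := by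
      have h3 : ∀ i, pd i (fun y => Phi0 N Φ y t) = fun y => fderiv ℝ (fun y => Φ y t) y (Pi.single i 1) := by
        intro i; ext1 y
        unfold pd Phi0
        rw [fderiv_sub_const]
      unfold lapE lapR
      refine Finset.sum_congr rfl fun i _ => ?_
      rw [h3]; rfl
    rw [h2, h1, Complex.normSq_eq_norm_sq]
    rfl

lemma cder (h : IsSPN N σ e M ψ Φ q) (t : ℝ) : Continuous fun x => deriv (ψ x) t := by
  simp_rw [deriv_eq h]
  exact cont_rhs (h.regx_psi t) (h.regx_Phi t).continuous

lemma cdert (h : IsSPN N σ e M ψ Φ q) (x : V3) : Continuous (deriv (ψ x)) :=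
  (h.regt_psi x).continuous_deriv le_rfl

lemma hder (h : IsSPN N σ e M ψ Φ q) (x : V3) (t : ℝ) : HasDerivAt (ψ x) (deriv (ψ x) t) t :=
  ((h.regt_psi x).differentiable one_ne_zero t).hasDerivAt

lemma AK_closed (h : IsSPN N σ e M ψ Φ q) (K : ℝ) : IsClosed (AK N ψ Φ K) := by
  refine IsSeqClosed.isClosed fun u t hu hut => ?_
  refine ⟨?_, ?_, ?_⟩
  · exact fatou_nrm N (f := fun n x => ψ x (u n)) (m := fun _ => K)
      (fun n => (h.regx_psi _).continuous) (h.regx_psi t).continuous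
      (fun x => ((h.regt_psi x).continuous.tendsto t).comp hut) (fun n => (hu n).1) tendsto_const_nhds
  · exact fatou_nrm N (f := fun n x => deriv (ψ x) (u n)) (m := fun _ => K)
      (fun n => cder h _) (cder h t)
      (fun x => ((cdert h x).tendsto t).comp hut) (fun n => (hu n).2.1) tendsto_const_nhds
  · exact fatou_nrm N (f := fun n x => Φ x (u n)) (m := fun _ => K)
      (fun n => (h.regx_Phi _).continuous) (h.regx_Phi t).continuous
      (fun x => ((h.regt_Phi x).continuous.tendsto t).comp hut) (fun n => (hu n).2.2) tendsto_const_nhds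

lemma AK_exists (t : ℝ) : ∃ K, 0 ≤ K ∧ t ∈ AK N ψ Φ K := by
  refine ⟨nrm N (fun x => ψ x t) + nrm N (fun x => deriv (ψ x) t) + nrm N (fun x => Φ x t), ?_, ?_⟩
  · have := nrm_nonneg N (fun x => ψ x t)
    have := nrm_nonneg N (fun x => deriv (ψ x) t)
    have := nrm_nonneg N (fun x => Φ x t)
    positivity
  · have h1 := nrm_nonneg N (fun x => ψ x t)
    have h2 := nrm_nonneg N (fun x => deriv (ψ x) t)
    have h3 := nrm_nonneg N (fun x => Φ x t)
    refine ⟨?_, ?_, ?_⟩ <;> linarith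

lemma avg_le {E : Type*} [NormedAddCommGroup E] [InnerProductSpace ℝ E] (hN : 0 < N) {f : V3 → E}
    (hf : Continuous f) : ‖avg N f‖ ≤ nrm N f := by
  have h1 := int_norm_le N hf
  have hN1 : (1 : ℝ) ≤ (N : ℝ) ^ 3 := one_le_pow₀ (by exact_mod_cast hN)
  have hs : Real.sqrt ((N : ℝ) ^ 3) ≤ (N : ℝ) ^ 3 := by
    rw [Real.sqrt_le_left (by positivity)]; nlinarith
  rw [avg, norm_smul, norm_inv, Real.norm_of_nonneg (by positivity), inv_mul_le_iff₀ (by positivity)]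
  refine (norm_integral_le_integral_norm _).trans (h1.trans ?_)
  exact mul_le_mul_of_nonneg_right hs (nrm_nonneg _ _)

lemma cav_le (hN : 0 < N) (h : IsSPN N σ e M ψ Φ q) {K t : ℝ} (ht : t ∈ AK N ψ Φ K) :
    |cav N Φ t| ≤ K :=
  (avg_le hN (h.regx_Phi t).continuous).trans ht.2.2

lemma nrm_cmul (z : ℂ) (f : V3 → ℂ) : nrm N (fun x => z * f x) = ‖z‖ * nrm N f := by
  unfold nrm
  simp_rw [norm_mul, mul_pow]
  rw [integral_const_mul, Real.sqrt_mul (by positivity), Real.sqrt_sq (norm_nonneg _)]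

lemma AK_X (hN : 0 < N) (he : 0 < e) (h : IsSPN N σ e M ψ Φ q) {K t : ℝ} (ht : t ∈ AK N ψ Φ K) :
    Xn N e ψ Φ t ≤ K + e * K ^ 2 := by
  have hK0 : 0 ≤ K := (nrm_nonneg _ _).trans ht.1
  have c1 := cder h t
  have c2 := (h.regx_psi t).continuous
  have h1 : Xn N e ψ Φ t = nrm N (fun x => deriv (ψ x) t - (Complex.I * (e * cav N Φ t : ℝ)) * ψ x t) := by
    unfold Xn Phi0
    congr 1; ext x
    rw [rhs_gauge, deriv_eq h]
  rw [h1]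
  refine (nrm_sub_le N c1 (by fun_prop)).trans ?_
  rw [nrm_cmul, norm_mul, Complex.norm_I, Complex.norm_real, norm_mul, Real.norm_of_nonneg he.le,
    one_mul, Real.norm_eq_abs]
  refine add_le_add ht.2.1 ?_
  rw [mul_assoc]
  refine mul_le_mul_of_nonneg_left ?_ he.le
  rw [sq]
  exact mul_le_mul (cav_le hN h ht) ht.1 (nrm_nonneg _ _) hK0

lemma X_AK (hN : 0 < N) (he : 0 < e) (h : IsSPN N σ e M ψ Φ q) {t k c g : ℝ}
    (h0 : nrm N (fun x => ψ x t) ≤ k) (h1 : Xn N e ψ Φ t ≤ k) (hc : |cav N Φ t| ≤ c)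
    (hg : nrm N (fun x => Phi0 N Φ x t) ≤ g) :
    t ∈ AK N ψ Φ (k + e * c * k + g + c * Real.sqrt ((N : ℝ) ^ 3)) := by
  have hk0 : 0 ≤ k := (nrm_nonneg _ _).trans h0
  have hg0 : 0 ≤ g := (nrm_nonneg _ _).trans hg
  have hc0 : 0 ≤ c := (abs_nonneg _).trans hc
  have c1 := cder h t
  have c2 := (h.regx_psi t).continuous
  have c3 := (h.regx_Phi t).continuous
  have c4 : Continuous fun x => Phi0 N Φ x t := by unfold Phi0; fun_prop
  have a1 : 0 ≤ e * c * k := by positivity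
  have a2 : 0 ≤ c * Real.sqrt ((N : ℝ) ^ 3) := by positivity
  refine ⟨by linarith, ?_, ?_⟩
  · have h2 : nrm N (fun x => deriv (ψ x) t) = nrm N (fun x => rhsS e (fun x => ψ x t)
        (fun x => Phi0 N Φ x t) x + (Complex.I * (e * cav N Φ t : ℝ)) * ψ x t) := by
      congr 1; ext x
      unfold Phi0
      rw [rhs_gauge, deriv_eq h]; ring
    have c5 : Continuous (rhsS e (fun x => ψ x t) (fun x => Phi0 N Φ x t)) := cont_rhs (h.regx_psi t) c4
    rw [h2]
    refine (nrm_add_le N c5 (by fun_prop)).trans ?_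
    rw [nrm_cmul, norm_mul, Complex.norm_I, Complex.norm_real, norm_mul, Real.norm_of_nonneg he.le,
      one_mul, Real.norm_eq_abs]
    have h3 : e * |cav N Φ t| * nrm N (fun x => ψ x t) ≤ e * c * k := by
      have := nrm_nonneg N (fun x => ψ x t)
      gcongr
    unfold Xn at h1
    linarith
  · have h2 : nrm N (fun x => Φ x t) = nrm N (fun x => Phi0 N Φ x t + cav N Φ t) := by
      simp [Phi0]
    rw [h2]
    refine (nrm_add_le N c4 (by fun_prop)).trans ?_
    have h3 : nrm N (fun _ : V3 => cav N Φ t) = |cav N Φ t| * Real.sqrt ((N : ℝ) ^ 3) := by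
      unfold nrm
      rw [const_int, smul_eq_mul, mul_comm, Real.sqrt_mul (by positivity), Real.sqrt_sq (norm_nonneg _),
        Real.norm_eq_abs]
    rw [h3]
    have : |cav N Φ t| * Real.sqrt ((N : ℝ) ^ 3) ≤ c * Real.sqrt ((N : ℝ) ^ 3) := by gcongr
    linarith

/-- Lemma C : control of the mean of the potential -/
lemma cav_loc (hN : 0 < N) (h : IsSPN N σ e M ψ Φ q) (s D : ℝ) (hD : 0 ≤ D) :
    ∃ k, 0 ≤ k ∧ ∀ᶠ t in 𝓝 s, (∫ x in cubeN N, |Phi0 N Φ x t - Phi0 N Φ x s|) ≤ D → |cav N Φ t| ≤ k := by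
  have hN1 : (1 : ℝ) ≤ (N : ℝ) ^ 3 := one_le_pow₀ (by exact_mod_cast hN)
  set R : ℝ := 1 + 4 * D with hR
  have hR0 : 0 < R := by positivity
  refine ⟨|cav N Φ s| + R, by positivity, ?_⟩
  have hm := (Metric.tendsto_nhds.1 (min_conv N (f := fun t x => Φ x t) (g := fun x => Φ x s) (l := 𝓝 s)
    (fun t => (h.regx_Phi t).continuous) (h.regx_Phi s).continuous
    (fun x => (h.regt_Phi x).continuous.tendsto s) 1 zero_le_one)) (1 / 4) (by norm_num)
  filter_upwards [hm] with t ht hDt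
  have c1 := (h.regx_Phi t).continuous
  have c2 := (h.regx_Phi s).continuous
  have c3 : Continuous fun x => Phi0 N Φ x t := by unfold Phi0; fun_prop
  have c4 : Continuous fun x => Phi0 N Φ x s := by unfold Phi0; fun_prop
  rw [Real.dist_eq, sub_zero] at ht
  have ht' := (le_abs_self _).trans_lt ht
  set m := min 1 (|cav N Φ t - cav N Φ s| / R) with hmdef
  have h1 : (N : ℝ) ^ 3 * m ≤ 1 / 4 + R⁻¹ * D := by
    have e1 : ∫ x in cubeN N, m = (N : ℝ) ^ 3 * m := by rw [const_int, smul_eq_mul]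
    rw [← e1]
    calc ∫ x in cubeN N, m ≤ ∫ x in cubeN N, (min 1 ‖Φ x t - Φ x s‖ + R⁻¹ * |Phi0 N Φ x t - Phi0 N Φ x s|) := by
          refine integral_mono (intQ N (by fun_prop)) (intQ N (by fun_prop)) fun x => ?_
          simp only
          have hle : |cav N Φ t - cav N Φ s| ≤ ‖Φ x t - Φ x s‖ + |Phi0 N Φ x t - Phi0 N Φ x s| := by
            have : cav N Φ t - cav N Φ s = (Φ x t - Φ x s) - (Phi0 N Φ x t - Phi0 N Φ x s) := by
              unfold Phi0; ring
            rw [this]; exact abs_sub _ _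
          have p1 : 0 ≤ R⁻¹ * |Phi0 N Φ x t - Phi0 N Φ x s| := by positivity
          rcases le_total 1 ‖Φ x t - Φ x s‖ with h1 | h1
          · rw [min_eq_left h1]
            have := min_le_left 1 (|cav N Φ t - cav N Φ s| / R)
            linarith
          · rw [min_eq_right h1]
            have h2 := min_le_right 1 (|cav N Φ t - cav N Φ s| / R)
            have h3 : |cav N Φ t - cav N Φ s| / R ≤ R⁻¹ * ‖Φ x t - Φ x s‖ + R⁻¹ * |Phi0 N Φ x t - Phi0 N Φ x s| := by
              rw [← mul_add, div_eq_inv_mul]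
              exact mul_le_mul_of_nonneg_left hle (by positivity)
            have h4 : R⁻¹ * ‖Φ x t - Φ x s‖ ≤ ‖Φ x t - Φ x s‖ := by
              refine mul_le_of_le_one_left (norm_nonneg _) (inv_le_one_of_one_le₀ (by linarith))
            linarith
      _ = (∫ x in cubeN N, min 1 ‖Φ x t - Φ x s‖) + R⁻¹ * ∫ x in cubeN N, |Phi0 N Φ x t - Phi0 N Φ x s| := by
          rw [integral_add (intQ N (by fun_prop)) (intQ N (by fun_prop)), integral_const_mul]
      _ ≤ _ := add_le_add ht'.le (mul_le_mul_of_nonneg_left hDt (by positivity))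
  have h2 : R⁻¹ * D ≤ 1 / 4 := by
    rw [inv_mul_le_iff₀ hR0]; linarith
  have hm0 : 0 ≤ m := le_min zero_le_one (by positivity)
  have h3 : m < 1 := by nlinarith
  have h4 : |cav N Φ t - cav N Φ s| / R < 1 := by
    rcases min_lt_iff.1 h3 with h | h
    · exact absurd h (lt_irrefl _)
    · exact h
  rw [div_lt_one hR0] at h4
  have := abs_sub_abs_le_abs_sub (cav N Φ t) (cav N Φ s)
  linarith

lemma cav_cont (hN : 0 < N) (h : IsSPN N σ e M ψ Φ q) {S : Set ℝ} {K : ℝ} (hS : S ⊆ AK N ψ Φ K) :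
    ContinuousOn (cav N Φ) S := by
  intro s hs
  have h1 := l1_conv N (f := fun t x => Φ x t) (g := fun x => Φ x s) (l := 𝓝[S] s)
    (fun t => (h.regx_Phi t).continuous) (h.regx_Phi s).continuous
    (fun x => ((h.regt_Phi x).continuous.tendsto s).mono_left nhdsWithin_le_nhds) (K := K)
    (by filter_upwards [self_mem_nhdsWithin] with t ht using (hS ht).2.2) (hS hs).2.2
  rw [ContinuousWithinAt, tendsto_iff_dist_tendsto_zero]
  have h2 := h1.const_mul ((N : ℝ) ^ 3)⁻¹
  rw [mul_zero] at h2
  refine squeeze_zero (fun _ => dist_nonneg) (fun t => ?_) h2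
  have c1 := (h.regx_Phi t).continuous
  have c2 := (h.regx_Phi s).continuous
  rw [Real.dist_eq, cav, cav, avg, avg, smul_eq_mul, smul_eq_mul, ← mul_sub,
    ← integral_sub (intQ N (by fun_prop)) (intQ N (by fun_prop)), abs_mul,
    abs_of_nonneg (by positivity : (0:ℝ) ≤ ((N : ℝ) ^ 3)⁻¹)]
  exact mul_le_mul_of_nonneg_left abs_integral_le_integral_abs (by positivity)

lemma lap_cmul {f : V3 → ℂ} (hf : ContDiff ℝ 2 f) (z : ℂ) (x : V3) :
    lapE (fun x => z * f x) x = z * lapE f x := by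
  have h1 : ∀ (g : V3 → ℂ), ContDiff ℝ 1 g → ∀ i, pd i (fun x => z * g x) = fun x => z * pd i g x := by
    intro g hg i
    ext1 x
    unfold pd
    rw [fderiv_const_mul (hg.differentiable one_ne_zero x)]
    rfl
  unfold lapE
  rw [Finset.mul_sum]
  refine Finset.sum_congr rfl fun i _ => ?_
  rw [h1 f (hf.of_le one_le_two) i, h1 _ (contDiff_pd hf i) i]

lemma gsq_cmul {f : V3 → ℂ} (hf : ContDiff ℝ 1 f) {z : ℂ} (hz : ‖z‖ = 1) :
    gsq N (fun x => z * f x) = gsq N f := by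
  unfold gsq
  congr 1; ext x
  refine Finset.sum_congr rfl fun i _ => ?_
  have : pd i (fun x => z * f x) x = z * pd i f x := by
    unfold pd
    rw [fderiv_const_mul (hf.differentiable one_ne_zero x)]
    rfl
  rw [this, norm_mul, hz, one_mul]

lemma n4_cmul {f : V3 → ℂ} {z : ℂ} (hz : ‖z‖ = 1) :
    n4 N (fun x => z * f x) = n4 N f := by
  unfold n4
  simp only [norm_mul, hz, one_mul]

lemma lsmake (hN : 0 < N) (he : 0 < e) (h : IsSPN N σ e M ψ Φ q) {a b K L : ℝ}
    (hS : Set.uIcc a b ⊆ AK N ψ Φ K) (hK0 : 0 ≤ K) (hL0 : 0 ≤ L)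
    (hL : ∀ t ∈ Set.uIcc a b, ∀ s ∈ Set.uIcc a b, ‖q t - q s‖ ≤ L * |t - s|) :
    ∃ ψ' dψ' Φ', LS N σ e ψ' dψ' Φ' q (Set.uIcc a b) (K + e * K ^ 2) L ∧
      ∀ t ∈ Set.uIcc a b, nrm N (fun x => ψ' x t) = nrm N (fun x => ψ x t) ∧
        n4 N (fun x => ψ' x t) = n4 N (fun x => ψ x t) ∧
        gsq N (fun x => ψ' x t) = gsq N (fun x => ψ x t) ∧
        nrm N (fun x => dψ' x t) = Xn N e ψ Φ t ∧
        (fun x => Φ' x t) = (fun x => Phi0 N Φ x t) := by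
  set c : ℝ → ℝ := Set.IccExtend (inf_le_sup : a ⊓ b ≤ a ⊔ b) ((Set.uIcc a b).restrict (cav N Φ)) with hc
  have hcc : Continuous c := by
    have := continuousOn_iff_continuous_restrict.1 (cav_cont hN h hS)
    exact this.Icc_extend'
  have hcS : ∀ t ∈ Set.uIcc a b, c t = cav N Φ t := by
    intro t ht
    exact Set.IccExtend_of_mem (inf_le_sup : a ⊓ b ≤ a ⊔ b) _ ht
  set Cc : ℝ → ℝ := fun t => ∫ u in a..t, c u with hCc
  have hCd : ∀ t, HasDerivAt Cc (c t) t := fun t =>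
    intervalIntegral.integral_hasDerivAt_right (hcc.intervalIntegrable _ _)
      (hcc.stronglyMeasurableAtFilter _ _) hcc.continuousAt
  have hCcont : Continuous Cc := continuous_iff_continuousAt.2 fun t => (hCd t).continuousAt
  set Ex : ℝ → ℂ := fun t => Complex.exp (-(Complex.I * (e * Cc t : ℝ))) with hEx
  have hEn : ∀ t, ‖Ex t‖ = 1 := by
    intro t
    simp only [hEx]
    rw [← mul_neg, ← Complex.ofReal_neg, mul_comm]
    exact Complex.norm_exp_ofReal_mul_I _
  have hEd : ∀ t, HasDerivAt Ex (Ex t * -(Complex.I * (e * c t : ℝ))) t := by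
    intro t
    have h1 : HasDerivAt (fun t => ((e * Cc t : ℝ) : ℂ)) ((e * c t : ℝ) : ℂ) t :=
      ((hCd t).const_mul e).ofReal_comp
    exact ((h1.const_mul Complex.I).neg).cexp
  have hEc : Continuous Ex := continuous_iff_continuousAt.2 fun t => (hEd t).continuousAt
  have cψx := fun t => (h.regx_psi t).continuous
  have cψt := fun x => (h.regt_psi x).continuous
  have hrhs : ∀ t ∈ Set.uIcc a b, ∀ x, Ex t * (deriv (ψ x) t - Complex.I * (e * c t : ℝ) * ψ x t)
      = Ex t * rhsS e (fun x => ψ x t) (fun x => Phi0 N Φ x t) x := by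
    intro t ht x
    unfold Phi0
    rw [rhs_gauge, deriv_eq h, hcS t ht]
  have hnd : ∀ t ∈ Set.uIcc a b,
      nrm N (fun x => Ex t * (deriv (ψ x) t - Complex.I * (e * c t : ℝ) * ψ x t)) = Xn N e ψ Φ t := by
    intro t ht
    simp_rw [hrhs t ht]
    rw [nrm_cmul, hEn, one_mul]; rfl
  have hΦ : ∀ t ∈ Set.uIcc a b, (fun x => Φ x t - c t) = fun x => Phi0 N Φ x t := by
    intro t ht
    ext x; rw [hcS t ht]; rfl
  refine ⟨fun x t => Ex t * ψ x t, fun x t => Ex t * (deriv (ψ x) t - Complex.I * (e * c t : ℝ) * ψ x t),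
    fun x t => Φ x t - c t, ?_, ?_⟩
  · constructor
    · exact Set.ordConnected_uIcc
    · intro t ht
      have p := spn_ps hN h t
      refine ⟨contDiff_const.mul p.c2ψ, per_comp p.perψ _, ?_, ?_, ?_, ?_⟩
      · rw [hΦ t ht]; exact p.c2Φ
      · rw [hΦ t ht]; exact p.perΦ
      · have := p.mean
        rw [← hΦ t ht] at this; exact this
      · intro x
        rw [hΦ t ht, norm_mul, hEn, one_mul]
        exact p.poi x
    · intro t ht x
      rw [hΦ t ht, hrhs t ht]
      unfold rhsS
      rw [lap_cmul (h.regx_psi t)]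
      simp only [Complex.real_smul]
      ring
    · intro x t
      have := (hEd t).mul (hder h x t)
      refine this.congr_deriv ?_
      ring
    · intro x
      have := cdert h x
      have := cψt x
      fun_prop
    · intro t; have := cψx t; fun_prop
    · intro t; have := cψx t; have := cder h t; fun_prop
    · intro t ht
      rw [nrm_cmul, hEn, one_mul]
      have : 0 ≤ e * K ^ 2 := by positivity
      linarith [(hS ht).1]
    · intro t ht
      rw [hnd t ht]
      exact AK_X hN he h (hS ht)
    · exact hL
    · exact hL0
    · positivity
  · intro t ht
    refine ⟨by rw [nrm_cmul, hEn, one_mul], n4_cmul (hEn t), gsq_cmul ((h.regx_psi t).of_le one_le_two) (hEn t),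
      hnd t ht, hΦ t ht⟩

end gauge

end part9

section part10
open Filter Topology

section baire

lemma uI_avoid {α t u v : ℝ} (hu : u ∈ Set.uIcc α t) (hu' : u ≠ α) (hv : v ∈ Set.uIcc α t) (hv' : v ≠ α)
    {w : ℝ} (hw : w ∈ Set.uIcc u v) : w ∈ Set.uIcc α t ∧ w ≠ α := by
  refine ⟨Set.uIcc_subset_uIcc hu hv hw, ?_⟩
  rintro rfl
  rw [Set.mem_uIcc] at hu hv hw
  rcases hu with h1 | h1 <;> rcases hv with h2 | h2 <;> rcases hw with h3 | h3 <;>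
    first
    | exact hu' (by linarith [h1.1, h1.2, h2.1, h2.2, h3.1, h3.2])
    | exact hv' (by linarith [h1.1, h1.2, h2.1, h2.2, h3.1, h3.2])

lemma uI_dist {α t u : ℝ} (hu : u ∈ Set.uIcc α t) : |u - α| + |u - t| = |t - α| := by
  rw [Set.mem_uIcc] at hu
  rcases hu with h | h
  · rw [abs_of_nonneg (by linarith), abs_of_nonpos (by linarith), abs_of_nonneg (by linarith)]; ring
  · rw [abs_of_nonpos (by linarith), abs_of_nonneg (by linarith), abs_of_nonpos (by linarith)]; ring

theorem baire_prop (A : ℝ → Set ℝ) (m E X : ℝ → ℝ) (hX : ∀ t, 0 ≤ X t)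
    (hcl : ∀ K, IsClosed (A K)) (hmono : ∀ K K', K ≤ K' → A K ⊆ A K')
    (hun : ∀ t, ∃ K, t ∈ A K)
    (cons : ∀ K s t, Set.uIcc s t ⊆ A K → m t = m s ∧ E t = E s)
    (grow : ∀ m0 E0 T, ∃ τ > 0, ∀ s ∈ Set.Icc (-T) T, ∀ t ∈ Set.Icc (-T) T, |t - s| ≤ τ →
      (∃ K, Set.uIcc s t ⊆ A K) → m s ≤ m0 → E s ≤ E0 → X t ^ 2 ≤ 2 * X s ^ 2 + 1)
    (bd : ∀ K T, ∃ k, ∀ t ∈ A K, t ∈ Set.Icc (-T) T → m t ≤ k ∧ E t ≤ k ∧ X t ≤ k)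
    (cb : ∀ s k, ∃ K', ∀ᶠ t in 𝓝 s, m t ≤ k → X t ≤ k → t ∈ A K') :
    ∀ s t, m t = m s ∧ E t = E s := by
  set G : Set ℝ := {t | ∃ K, A K ∈ 𝓝 t} with hG
  have hGo : IsOpen G := by
    rw [isOpen_iff_mem_nhds]
    rintro t ⟨K, hK⟩
    filter_upwards [eventually_mem_nhds_iff.2 hK] with u hu
    exact ⟨K, hu⟩
  have hcomp : ∀ C : Set ℝ, IsCompact C → C ⊆ G → ∃ K, C ⊆ A K := by
    intro C hC hCG
    refine hC.induction_on (p := fun s => ∃ K, s ⊆ A K) ⟨0, Set.empty_subset _⟩ ?_ ?_ ?_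
    · rintro s t hst ⟨K, hK⟩; exact ⟨K, hst.trans hK⟩
    · rintro s t ⟨K, hK⟩ ⟨K', hK'⟩
      exact ⟨max K K', Set.union_subset (hK.trans (hmono _ _ (le_max_left _ _)))
        (hK'.trans (hmono _ _ (le_max_right _ _)))⟩
    · intro x hx
      obtain ⟨K, hK⟩ := hCG hx
      exact ⟨A K, mem_nhdsWithin_of_mem_nhds hK, K, subset_rfl⟩
  have hall : ∀ t, t ∈ G := by
    by_contra hcon
    push Not at hcon
    obtain ⟨t0, ht0⟩ := hcon
    have hFc : IsClosed Gᶜ := hGo.isClosed_compl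
    have : CompleteSpace (Gᶜ : Set ℝ) := hFc.completeSpace_coe
    have : Nonempty (Gᶜ : Set ℝ) := ⟨⟨t0, ht0⟩⟩
    obtain ⟨n, ⟨ts, htsF⟩, hts⟩ := nonempty_interior_of_iUnion_of_closed
      (f := fun n : ℕ => {x : (Gᶜ : Set ℝ) | x.1 ∈ A n})
      (fun n => (hcl n).preimage continuous_subtype_val) (by
        rw [Set.eq_univ_iff_forall]
        rintro ⟨x, hx⟩
        obtain ⟨K, hK⟩ := hun x
        obtain ⟨n, hn⟩ := exists_nat_ge K
        exact Set.mem_iUnion.2 ⟨n, hmono _ _ hn hK⟩)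
    set K : ℝ := (n : ℝ) with hKdef
    rw [mem_interior_iff_mem_nhds, Metric.mem_nhds_iff] at hts
    obtain ⟨ρ, hρ, hball⟩ := hts
    have hF : ∀ x, x ∉ G → |x - ts| < ρ → x ∈ A K := by
      intro x hx hd
      exact @hball ⟨x, hx⟩ (by rw [Metric.mem_ball, Subtype.dist_eq, Real.dist_eq]; exact hd)
    set T : ℝ := |ts| + 1 with hT
    obtain ⟨k, hk⟩ := bd K T
    obtain ⟨τ, hτ, hgrow⟩ := grow k k T
    have htsA : ts ∈ A K := hF ts htsF (by simpa using hρ)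
    obtain ⟨K4, hK4⟩ := cb ts (|k| + Real.sqrt (2 * k ^ 2 + 1))
    apply htsF
    refine ⟨K4, ?_⟩
    have hnear : ∀ᶠ t in 𝓝 ts, |t - ts| < min (min ρ τ) 1 := by
      have := Metric.ball_mem_nhds ts (show 0 < min (min ρ τ) 1 by positivity)
      filter_upwards [this] with t ht
      simpa [Real.dist_eq] using ht
    filter_upwards [hK4, hnear] with t ht4 htn
    have d1 : |t - ts| < ρ := htn.trans_le ((min_le_left _ _).trans (min_le_left _ _))
    have d2 : |t - ts| < τ := htn.trans_le ((min_le_left _ _).trans (min_le_right _ _))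
    have d3 : |t - ts| < 1 := htn.trans_le (min_le_right _ _)
    have hinT : ∀ u ∈ Set.uIcc ts t, u ∈ Set.Icc (-T) T := by
      intro u hu
      have h1 := uI_dist hu
      have h2 : |u - ts| ≤ 1 := by linarith [abs_nonneg (u - t)]
      rw [abs_le] at h2
      have := neg_abs_le ts
      have := le_abs_self ts
      constructor <;> linarith
    have hs0 := Real.sqrt_nonneg (2 * k ^ 2 + 1)
    by_cases htG : t ∈ G
    swap
    · obtain ⟨a1, -, a3⟩ := hk t (hF t htG d1) (hinT t Set.right_mem_uIcc)
      have := le_abs_self k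
      exact ht4 (by linarith) (by linarith)
    have hcpt : IsCompact (Gᶜ ∩ Set.uIcc ts t) := isCompact_uIcc.inter_left hFc
    obtain ⟨α, ⟨hαF, hαI⟩, hαmin⟩ := hcpt.exists_isMinOn ⟨ts, htsF, Set.left_mem_uIcc⟩
      (f := fun u => |u - t|) (by fun_prop)
    have hsub : Set.uIcc α t ⊆ Set.uIcc ts t := Set.uIcc_subset_uIcc hαI Set.right_mem_uIcc
    have hαt : t ≠ α := by rintro rfl; exact hαF htG
    have hH : ∀ u ∈ Set.uIcc α t, u ≠ α → u ∈ G := by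
      intro u hu hne
      by_contra hu'
      have h1 : |α - t| ≤ |u - t| := hαmin ⟨hu', hsub hu⟩
      have h2 := uI_dist hu
      rw [abs_sub_comm t α] at h2
      have h3 : |u - α| ≤ 0 := by linarith
      exact hne (by simpa [sub_eq_zero] using h3)
    have hαd : |α - ts| ≤ |t - ts| := by
      have := uI_dist hαI
      linarith [abs_nonneg (α - t)]
    have hαA : α ∈ A K := hF α hαF (by linarith)
    have hHK : ∀ u ∈ Set.uIcc α t, u ≠ α → ∀ v ∈ Set.uIcc α t, v ≠ α → ∃ K, Set.uIcc u v ⊆ A K := by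
      intro u hu hu' v hv hv'
      refine hcomp _ isCompact_uIcc fun w hw => ?_
      obtain ⟨w1, w2⟩ := uI_avoid hu hu' hv hv' hw
      exact hH w w1 w2
    have hcons : ∀ u ∈ Set.uIcc α t, u ≠ α → m u = m t ∧ E u = E t := by
      intro u hu hu'
      obtain ⟨K1, hK1⟩ := hHK t Set.right_mem_uIcc hαt u hu hu'
      exact cons K1 t u hK1
    obtain ⟨τ1, hτ1, hgrow1⟩ := grow (m t) (E t) T
    have hdpos : 0 < |t - α| := by simpa [sub_eq_zero] using hαt
    set θ : ℝ := min 1 (τ1 / |t - α|) with hθ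
    have hθ0 : 0 < θ := by positivity
    have hθ1 : θ ≤ 1 := min_le_left _ _
    set t' : ℝ := α + θ * (t - α) with ht'
    have ht'd : |t' - α| = θ * |t - α| := by
      rw [ht', add_sub_cancel_left, abs_mul, abs_of_pos hθ0]
    have ht'α : t' ≠ α := by
      intro h
      rw [h] at ht'd; simp at ht'd
      rcases ht'd with h | h
      · exact hθ0.ne' h
      · exact hdpos.ne' (by simpa using h)
    have ht'τ : |t' - α| ≤ τ1 := by
      rw [ht'd]
      calc θ * |t - α| ≤ τ1 / |t - α| * |t - α| := by gcongr; exact min_le_right _ _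
        _ = τ1 := by field_simp
    have ht'I : t' ∈ Set.uIcc α t := by
      rw [Set.mem_uIcc]
      rcases le_total α t with h | h
      · left; constructor <;> nlinarith
      · right; constructor <;> nlinarith
    obtain ⟨K', hK'⟩ := cb α (|m t| + Real.sqrt (2 * X t' ^ 2 + 1))
    rw [Metric.eventually_nhds_iff] at hK'
    obtain ⟨ρ1, hρ1, hK'⟩ := hK'
    have hnearα : ∀ u ∈ Set.uIcc α t', u ≠ α → |u - α| < ρ1 → u ∈ A K' := by
      intro u hu hne hd
      have huI : u ∈ Set.uIcc α t := Set.uIcc_subset_uIcc Set.left_mem_uIcc ht'I hu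
      have h1 := hgrow1 t' (hinT _ (hsub ht'I)) u (hinT _ (hsub huI)) (by
        have := uI_dist hu
        linarith [abs_nonneg (u - α)]) (hHK t' ht'I ht'α u huI hne) (hcons t' ht'I ht'α).1.le
          (hcons t' ht'I ht'α).2.le
      refine hK' (by rwa [Real.dist_eq]) ?_ ?_
      · rw [(hcons u huI hne).1]
        linarith [le_abs_self (m t), Real.sqrt_nonneg (2 * X t' ^ 2 + 1)]
      · have := Real.le_sqrt_of_sq_le h1
        linarith [abs_nonneg (m t)]
    set ρ2 : ℝ := min ρ1 |t' - α| with hρ2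
    obtain ⟨K2, hK2⟩ := hcomp (Set.uIcc α t ∩ {u | ρ2 ≤ |u - α|})
      (isCompact_uIcc.inter_right (isClosed_le continuous_const (by fun_prop))) (by
        rintro u ⟨hu, hu2⟩
        refine hH u hu ?_
        rintro rfl
        have : 0 < ρ2 := lt_min hρ1 (by simpa [sub_eq_zero] using ht'α)
        simp at hu2; linarith)
    have hfull : Set.uIcc α t ⊆ A (max K (max K' K2)) := by
      intro u hu
      by_cases h1 : u = α
      · rw [h1]; exact hmono _ _ (le_max_left _ _) hαA
      by_cases h2 : ρ2 ≤ |u - α|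
      · exact hmono _ _ ((le_max_right _ _).trans (le_max_right _ _)) (hK2 ⟨hu, h2⟩)
      · push Not at h2
        refine hmono _ _ ((le_max_left _ _).trans (le_max_right _ _)) (hnearα u ?_ h1
          (h2.trans_le (min_le_left _ _)))
        have h3 := h2.trans_le (min_le_right _ _)
        rw [Set.mem_uIcc] at hu ht'I ⊢
        rcases lt_or_gt_of_ne hαt with hlt | hlt
        · right
          have b1 : u ≤ α := by rcases hu with h | h <;> linarith [h.1, h.2]
          have b2 : t' ≤ α := by rcases ht'I with h | h <;> linarith [h.1, h.2]
          rw [abs_of_nonpos (by linarith), abs_of_nonpos (by linarith)] at h3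
          constructor <;> linarith
        · left
          have b1 : α ≤ u := by rcases hu with h | h <;> linarith [h.1, h.2]
          have b2 : α ≤ t' := by rcases ht'I with h | h <;> linarith [h.1, h.2]
          rw [abs_of_nonneg (by linarith), abs_of_nonneg (by linarith)] at h3
          constructor <;> linarith
    obtain ⟨a1, a2, a3⟩ := hk α hαA (hinT α hαI)
    have hc1 := cons _ _ _ hfull
    have hg := hgrow α (hinT α hαI) t (hinT t Set.right_mem_uIcc) (by
      have := uI_dist hαI
      rw [abs_sub_comm]
      linarith [abs_nonneg (α - ts)]) ⟨_, hfull⟩ a1 a2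
    refine ht4 ?_ ?_
    · rw [hc1.1]; linarith [le_abs_self k]
    · have h5 : X t ^ 2 ≤ 2 * k ^ 2 + 1 := by
        have : X α ^ 2 ≤ k ^ 2 := by
          have := hX α
          gcongr
        linarith
      have := Real.le_sqrt_of_sq_le h5
      linarith [abs_nonneg k]
  intro s t
  obtain ⟨K, hK⟩ := hcomp (Set.uIcc s t) isCompact_uIcc fun u _ => hall u
  exact cons K s t hK

end baire

end part10

section part11
open Filter Topology

section conserv

/-- velocities -/
def vel {N : ℕ} (q : ℝ → GammaIdx N → V3) (t : ℝ) : GammaIdx N → V3 :=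
  fun n i => deriv (fun u => q u n i) t

/-- energy along the flow -/
def Es (N : ℕ) (M : ℝ) (ψ : V3 → ℝ → ℂ) (Φ : V3 → ℝ → ℝ) (q : ℝ → GammaIdx N → V3) (t : ℝ) : ℝ :=
  en N M (fun x => ψ x t) (fun x => Phi0 N Φ x t) (vel q t)

/-- standing assumptions -/
structure Ctx (N : ℕ) (σ : V3 → ℝ) (e M : ℝ) (ψ : V3 → ℝ → ℂ) (Φ : V3 → ℝ → ℝ)
    (q : ℝ → GammaIdx N → V3) : Prop where
  hN : 0 < N
  hσ : ContDiff ℝ 2 σ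
  hσp : IsPerN N σ
  he : 0 < e
  hM : 0 < M
  h : IsSPN N σ e M ψ Φ q

variable {N : ℕ} {σ : V3 → ℝ} {e M : ℝ} {ψ : V3 → ℝ → ℂ} {Φ : V3 → ℝ → ℝ}
    {q : ℝ → GammaIdx N → V3}

lemma qcomp (H : Ctx N σ e M ψ Φ q) (n : GammaIdx N) (i : Fin 3) : ContDiff ℝ 2 (fun u => q u n i) := by
  have h1 := H.h.reg_q
  rw [contDiff_pi] at h1
  exact (contDiff_pi.1 (h1 n)) i

lemma qcomp1 (H : Ctx N σ e M ψ Φ q) (n : GammaIdx N) (i : Fin 3) :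
    ContDiff ℝ 1 (fun u => vel q u n i) := by
  have h1 := qcomp H n i
  have : (2 : WithTop ℕ∞) = 1 + 1 := by norm_num
  rw [this, contDiff_succ_iff_deriv] at h1
  exact h1.2.2

lemma q_lip (H : Ctx N σ e M ψ Φ q) (T : ℝ) :
    ∃ L, 0 ≤ L ∧ ∀ t ∈ Set.Icc (-T) T, ∀ s ∈ Set.Icc (-T) T, ‖q t - q s‖ ≤ L * |t - s| := by
  have hd := H.h.reg_q.differentiable two_ne_zero
  have hc : Continuous (deriv q) := H.h.reg_q.continuous_deriv one_le_two
  obtain ⟨L, hL⟩ := (isCompact_Icc (a := -T) (b := T)).exists_bound_of_continuousOn hc.continuousOn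
  refine ⟨max L 0, le_max_right _ _, fun t ht s hs => ?_⟩
  have := (convex_Icc (-T) T).norm_image_sub_le_of_norm_deriv_le (f := q) (C := max L 0)
    (fun x _ => hd x) (fun x hx => (hL x hx).trans (le_max_left _ _)) hs ht
  rwa [Real.norm_eq_abs] at this

lemma gsq_AK (H : Ctx N σ e M ψ Φ q) (K : ℝ) :
    ∃ C, 0 ≤ C ∧ ∀ t, nrm N (fun x => ψ x t) ≤ K → Xn N e ψ Φ t ≤ K →
      gsq N (fun x => ψ x t) ≤ C ∧ gsq N (fun x => Phi0 N Φ x t) ≤ C := by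
  obtain ⟨C, hC, hh⟩ := h1_static N H.hN σ H.hσ H.hσp e H.he
  refine ⟨2 * (K ^ 2 + C), by positivity, fun t h1 h2 => ?_⟩
  have h3 := hh _ _ _ (spn_ps H.hN H.h t)
  have h4 : nrm N (fun x => ψ x t) * Xn N e ψ Φ t ≤ K ^ 2 := by
    rw [sq]
    exact mul_le_mul h1 h2 (nrm_nonneg _ _) ((nrm_nonneg _ _).trans h1)
  have g1 := gsq_nonneg N (fun x => ψ x t)
  have g2 := gsq_nonneg N (fun x => Phi0 N Φ x t)
  unfold Xn at h4
  constructor <;> linarith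

lemma AK_bd (H : Ctx N σ e M ψ Φ q) (K : ℝ) : ∃ k, 0 ≤ k ∧ ∀ t ∈ AK N ψ Φ K,
    nrm N (fun x => ψ x t) ≤ k ∧ Xn N e ψ Φ t ≤ k := by
  refine ⟨max K 0 + e * K ^ 2, ?_, fun t ht => ⟨?_, ?_⟩⟩
  · have := H.he; positivity
  · have := H.he
    have h1 := ht.1
    have : 0 ≤ e * K ^ 2 := by positivity
    linarith [le_max_left K 0]
  · have := AK_X H.hN H.he H.h ht
    linarith [le_max_left K 0]

lemma n4_AK (H : Ctx N σ e M ψ Φ q) (K : ℝ) : ∃ B, 0 ≤ B ∧ ∀ t ∈ AK N ψ Φ K,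
    n4 N (fun x => ψ x t) ≤ B := by
  obtain ⟨k, hk0, hk⟩ := AK_bd H K
  obtain ⟨C, hC, hg⟩ := gsq_AK H k
  obtain ⟨Cs, hCs, hs⟩ := sobolev ℂ N H.hN
  refine ⟨Cs * (k + Real.sqrt C), by positivity, fun t ht => ?_⟩
  obtain ⟨h1, h2⟩ := hk t ht
  refine (hs _ ((H.h.regx_psi t).of_le one_le_two) (H.h.per_psi t)).trans ?_
  have := (hg t h1 h2).1
  gcongr

lemma pd_Phi0 (i : Fin 3) (t : ℝ) : pd i (fun x => Phi0 N Φ x t) = pd i (fun x => Φ x t) := by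
  ext1 y
  unfold pd Phi0
  rw [fderiv_sub_const]

lemma vel_has (H : Ctx N σ e M ψ Φ q) (t : ℝ) (n : GammaIdx N) (i : Fin 3) :
    HasDerivAt (fun u => q u n i) (vel q t n i) t :=
  ((qcomp H n i).differentiable two_ne_zero t).hasDerivAt

lemma cons1 (H : Ctx N σ e M ψ Φ q) (K s t : ℝ) (hS : Set.uIcc s t ⊆ AK N ψ Φ K) :
    nrm N (fun x => ψ x t) = nrm N (fun x => ψ x s) ∧ Es N M ψ Φ q t = Es N M ψ Φ q s := by
  have hK0 : 0 ≤ K := (nrm_nonneg _ _).trans (hS Set.left_mem_uIcc).1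
  obtain ⟨L, hL0, hL⟩ := q_lip H (|s| + |t|)
  have hsub : Set.uIcc s t ⊆ Set.Icc (-(|s| + |t|)) (|s| + |t|) := by
    intro u hu
    have := le_abs_self s; have := le_abs_self t
    have := neg_abs_le s; have := neg_abs_le t
    have := abs_nonneg s; have := abs_nonneg t
    rw [Set.mem_uIcc] at hu
    rcases hu with h | h <;> constructor <;> linarith [h.1, h.2]
  obtain ⟨ψ', dψ', Φ', hLS, hp⟩ := lsmake H.hN H.he H.h hS hK0 hL0
    (fun t ht s hs => hL t (hsub ht) s (hsub hs))
  obtain ⟨B, hB0, hB⟩ := n4_AK H K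
  have l := Set.left_mem_uIcc (a := s) (b := t)
  have r := Set.right_mem_uIcc (a := s) (b := t)
  constructor
  · rw [← (hp t r).1, ← (hp s l).1]
    exact hLS.charge H.hN l r
  · have := hLS.energy (M := M) (qd := vel q) (qdd := fun t n i => deriv (fun u => vel q u n i) t)
      H.hN H.hσ H.hσp H.he hB0 (fun u hu => by rw [(hp u hu).2.1]; exact hB u (hS hu))
      (vel_has H) (fun t n i => ((qcomp1 H n i).differentiable one_ne_zero t).hasDerivAt)
      (fun u hu n i => by
        rw [(hp u hu).2.2.2.2, pd_Phi0]
        exact H.h.newton n u i) l r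
    unfold Es
    unfold en at this ⊢
    rw [(hp t r).2.2.1, (hp s l).2.2.1, (hp t r).2.2.2.2, (hp s l).2.2.2.2] at this
    exact this

lemma vel_sq_nonneg (p : GammaIdx N → V3) : 0 ≤ ∑ n, ∑ i, p n i ^ 2 :=
  Finset.sum_nonneg fun n _ => Finset.sum_nonneg fun i _ => sq_nonneg _

lemma gsq_le_Es (H : Ctx N σ e M ψ Φ q) (t : ℝ) :
    gsq N (fun x => ψ x t) ≤ 2 * Es N M ψ Φ q t := by
  have h1 := gsq_nonneg N (fun x => Phi0 N Φ x t)
  have h2 : 0 ≤ M / 2 * ∑ n, ∑ i, vel q t n i ^ 2 :=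
    mul_nonneg (by linarith [H.hM]) (vel_sq_nonneg _)
  unfold Es en
  linarith

lemma grow1 (H : Ctx N σ e M ψ Φ q) (m0 E0 T : ℝ) : ∃ τ > 0, ∀ s ∈ Set.Icc (-T) T,
    ∀ t ∈ Set.Icc (-T) T, |t - s| ≤ τ → (∃ K, Set.uIcc s t ⊆ AK N ψ Φ K) →
      nrm N (fun x => ψ x s) ≤ m0 → Es N M ψ Φ q s ≤ E0 →
        Xn N e ψ Φ t ^ 2 ≤ 2 * Xn N e ψ Φ s ^ 2 + 1 := by
  obtain ⟨L, hL0, hL⟩ := q_lip H T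
  obtain ⟨Cs, hCs, hs⟩ := sobolev ℂ N H.hN
  obtain ⟨C, hC, hg⟩ := ls_growth N H.hN σ H.hσ H.hσp e H.he (Cs * (|m0| + Real.sqrt (2 * E0))) L
    (by positivity) hL0
  refine ⟨1 / (2 * C), by positivity, ?_⟩
  rintro s hsT t htT hst ⟨K, hS⟩ hm hE
  have hK0 : 0 ≤ K := (nrm_nonneg _ _).trans (hS Set.left_mem_uIcc).1
  have hsub : Set.uIcc s t ⊆ Set.Icc (-T) T := Set.uIcc_subset_Icc hsT htT
  obtain ⟨ψ', dψ', Φ', hLS, hp⟩ := lsmake H.hN H.he H.h hS hK0 hL0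
    (fun t ht s hs => hL t (hsub ht) s (hsub hs))
  have l := Set.left_mem_uIcc (a := s) (b := t)
  have r := Set.right_mem_uIcc (a := s) (b := t)
  have := (hg ψ' dψ' Φ' q _ _ hLS (fun u hu => by
    rw [(hp u hu).2.1]
    have hc := cons1 H K s u ((Set.uIcc_subset_uIcc_left hu).trans hS)
    refine (hs _ ((H.h.regx_psi u).of_le one_le_two) (H.h.per_psi u)).trans ?_
    have h1 : nrm N (fun x => ψ x u) ≤ |m0| := by rw [hc.1]; exact hm.trans (le_abs_self _)
    have h2 : gsq N (fun x => ψ x u) ≤ 2 * E0 := by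
      have := gsq_le_Es H u
      rw [hc.2] at this
      linarith
    gcongr) s l t r).2 (by
      calc C * |t - s| ≤ C * (1 / (2 * C)) := by gcongr
        _ = 1 / 2 := by field_simp)
  rwa [(hp t r).2.2.2.1, (hp s l).2.2.2.1] at this

lemma cb1 (H : Ctx N σ e M ψ Φ q) (s k : ℝ) : ∃ K', ∀ᶠ t in 𝓝 s,
    nrm N (fun x => ψ x t) ≤ k → Xn N e ψ Φ t ≤ k → t ∈ AK N ψ Φ K' := by
  obtain ⟨C, hC, hg⟩ := gsq_AK H k
  set g := 2 * N * Real.sqrt C with hgd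
  have hPn : ∀ t, nrm N (fun x => ψ x t) ≤ k → Xn N e ψ Φ t ≤ k → nrm N (fun x => Phi0 N Φ x t) ≤ g := by
    intro t h1 h2
    have p := spn_ps H.hN H.h t
    refine (poincare0 N H.hN (p.c2Φ.of_le one_le_two) p.perΦ p.mean).trans ?_
    have := (hg t h1 h2).2
    rw [hgd]; gcongr
  have hg0 : 0 ≤ g := by positivity
  obtain ⟨c, hc0, hc⟩ := cav_loc H.hN H.h s (Real.sqrt ((N : ℝ) ^ 3) * (g + nrm N (fun x => Phi0 N Φ x s)))
    (by have := nrm_nonneg N (fun x => Phi0 N Φ x s); positivity)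
  refine ⟨k + e * c * k + g + c * Real.sqrt ((N : ℝ) ^ 3), ?_⟩
  · filter_upwards [hc] with t ht h1 h2
    have c1 := (spn_ps H.hN H.h t).c2Φ.continuous
    have c2 := (spn_ps H.hN H.h s).c2Φ.continuous
    refine X_AK H.hN H.he H.h h1 h2 (ht ?_) (hPn t h1 h2)
    have h3 := int_norm_le N (f := fun x => Phi0 N Φ x t - Phi0 N Φ x s) (by fun_prop)
    simp only [Real.norm_eq_abs] at h3
    refine h3.trans ?_
    have := nrm_sub_le N c1 c2
    have := hPn t h1 h2
    gcongr
    linarith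

theorem conservation (H : Ctx N σ e M ψ Φ q) (s t : ℝ) :
    nrm N (fun x => ψ x t) = nrm N (fun x => ψ x s) ∧ Es N M ψ Φ q t = Es N M ψ Φ q s := by
  refine baire_prop (AK N ψ Φ) (fun t => nrm N (fun x => ψ x t)) (Es N M ψ Φ q) (Xn N e ψ Φ)
    (fun t => nrm_nonneg _ _) (AK_closed H.h) (fun _ _ => AK_mono)
    (fun t => (AK_exists t).imp fun K hK => hK.2) (cons1 H) (grow1 H) ?_ (cb1 H) s t
  intro K T
  obtain ⟨k, hk0, hk⟩ := AK_bd H K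
  obtain ⟨C, hC, hg⟩ := gsq_AK H k
  have hcv : Continuous fun t => ∑ n, ∑ i, vel q t n i ^ 2 := by
    refine continuous_finsetSum _ fun n _ => continuous_finsetSum _ fun i _ => ?_
    exact (qcomp1 H n i).continuous.pow 2
  obtain ⟨V, hV⟩ := (isCompact_Icc (a := -T) (b := T)).exists_bound_of_continuousOn hcv.continuousOn
  refine ⟨k + C + M / 2 * |V|, fun t ht htT => ?_⟩
  obtain ⟨h1, h2⟩ := hk t ht
  obtain ⟨h3, h4⟩ := hg t h1 h2
  have hV1 : ∑ n, ∑ i, vel q t n i ^ 2 ≤ |V| := (le_abs_self _).trans ((hV t htT).trans (le_abs_self _))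
  have hM := H.hM
  have hM1 : M / 2 * ∑ n, ∑ i, vel q t n i ^ 2 ≤ M / 2 * |V| := by gcongr
  have : 0 ≤ M / 2 * |V| := by positivity
  refine ⟨by linarith, ?_, by linarith⟩
  unfold Es en
  linarith

end conserv

end part11

section part12
open Filter Topology

section fourier

/-- characters of the torus -/
def ek (N : ℕ) (k : Fin 3 → ℤ) (x : V3) : ℂ := Complex.exp (Complex.I * ((dotP (xiN N k) x : ℝ) : ℂ))

lemma dotP_add (v x y : V3) : dotP v (x + y) = dotP v x + dotP v y := by
  simp [dotP, mul_add, Finset.sum_add_distrib]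

lemma ek_add (N : ℕ) (k : Fin 3 → ℤ) (x y : V3) : ek N k (x + y) = ek N k x * ek N k y := by
  unfold ek
  rw [dotP_add, ← Complex.exp_add]; push_cast; ring_nf

lemma ek_norm (N : ℕ) (k : Fin 3 → ℤ) (x : V3) : ‖ek N k x‖ = 1 := by
  unfold ek
  rw [mul_comm]; exact Complex.norm_exp_ofReal_mul_I _

lemma ek_ne (N : ℕ) (k : Fin 3 → ℤ) (x : V3) : ek N k x ≠ 0 := Complex.exp_ne_zero _

lemma ek_zero (N : ℕ) (k : Fin 3 → ℤ) : ek N k 0 = 1 := by simp [ek, dotP]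

lemma ek_zero' (N : ℕ) (x : V3) : ek N 0 x = 1 := by simp [ek, dotP, xiN]

lemma ek_lat {N : ℕ} (hN : 0 < N) (k m : Fin 3 → ℤ) : ek N k (fun i => (N : ℝ) * (m i : ℝ)) = 1 := by
  unfold ek
  rw [Complex.exp_eq_one_iff]
  refine ⟨∑ i, k i * m i, ?_⟩
  have hN' : (N : ℂ) ≠ 0 := by exact_mod_cast hN.ne'
  simp only [dotP, xiN]
  push_cast
  rw [Finset.mul_sum, Finset.sum_mul]
  refine Finset.sum_congr rfl fun i _ => ?_
  field_simp

lemma ek_per {N : ℕ} (hN : 0 < N) (k : Fin 3 → ℤ) : IsPerN N (ek N k) := by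
  intro x m
  rw [ek_add, ek_lat hN, mul_one]

lemma ek_smooth (N : ℕ) (k : Fin 3 → ℤ) : ContDiff ℝ 2 (ek N k) := by
  have h1 : ContDiff ℝ 2 (fun x : V3 => dotP (xiN N k) x) := by
    unfold dotP
    fun_prop
  have h2 : ContDiff ℝ 2 (fun x : V3 => ((dotP (xiN N k) x : ℝ) : ℂ)) :=
    Complex.ofRealCLM.contDiff.comp h1
  unfold ek
  exact (contDiff_const.mul h2).cexp

lemma ek_cont (N : ℕ) (k : Fin 3 → ℤ) : Continuous (ek N k) := (ek_smooth N k).continuous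

lemma ek_int_zero {N : ℕ} (hN : 0 < N) {k : Fin 3 → ℤ} (hk : k ≠ 0) : ∫ x in cubeN N, ek N k x = 0 := by
  obtain ⟨j, hj⟩ := Function.ne_iff.1 hk
  have hj : k j ≠ 0 := hj
  set v : V3 := Pi.single j ((N : ℝ) / (2 * k j)) with hv
  have h1 := shift_int N hN (ek_per hN k) v
  simp_rw [ek_add] at h1
  rw [integral_mul_const] at h1
  have h2 : ek N k v = -1 := by
    unfold ek
    have : dotP (xiN N k) v = π := by
      unfold dotP
      rw [Finset.sum_eq_single j]
      · have hN' : (N : ℝ) ≠ 0 := by exact_mod_cast hN.ne'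
        have : (k j : ℝ) ≠ 0 := by exact_mod_cast hj
        rw [hv, Pi.single_eq_same, xiN]; field_simp
      · intro b _ hb; rw [hv, Pi.single_eq_of_ne hb, mul_zero]
      · simp
    rw [this, mul_comm, Complex.exp_pi_mul_I]
  rw [h2] at h1
  have : (2 : ℂ) * ∫ x in cubeN N, ek N k x = 0 := by linear_combination -h1
  simpa using this

lemma fC_eq (N : ℕ) (f : V3 → ℝ) (k : Fin 3 → ℤ) :
    fCoeffR N f (xiN N k) = ∫ x in cubeN N, ek N k x * (f x : ℂ) := rfl

lemma fC_shift {N : ℕ} (hN : 0 < N) {f : V3 → ℝ} (hp : IsPerN N f) (k : Fin 3 → ℤ) (v : V3) :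
    ∫ x in cubeN N, ek N k x * (f (x - v) : ℂ) = ek N k v * fCoeffR N f (xiN N k) := by
  have hp' : IsPerN N (fun x => ek N k x * (f (x - v) : ℂ)) := by
    have h := per_comp2 (ek_per hN k) (per_add_fun hp (-v)) (fun a b => a * (b : ℂ))
    simpa [sub_eq_add_neg] using h
  rw [← shift_int N hN hp' v, fC_eq, ← integral_const_mul]
  congr 1; ext x
  rw [ek_add, add_sub_cancel_right]; ring

/-- structure factor -/
def Sk (N : ℕ) (k : Fin 3 → ℤ) (q : GammaIdx N → V3) : ℂ := ∑ n, ek N k (embG n + q n)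

lemma fC_stot {N : ℕ} (hN : 0 < N) {σ : V3 → ℝ} (hc : Continuous σ) (hp : IsPerN N σ) (k : Fin 3 → ℤ)
    (q : GammaIdx N → V3) :
    ∫ x in cubeN N, ek N k x * (stot σ q x : ℂ) = Sk N k q * fCoeffR N σ (xiN N k) := by
  have := ek_cont N k
  simp only [stot, Complex.ofReal_sum, Finset.mul_sum]
  rw [integral_finsetSum _ fun n _ => intQ N (by fun_prop), Sk, Finset.sum_mul]
  refine Finset.sum_congr rfl fun n _ => ?_
  have := fC_shift hN hp k (embG n + q n)
  rw [← this]
  simp only [sub_sub]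

lemma geom_zero {N : ℕ} (hN : 0 < N) {k : Fin 3 → ℤ} (hk : ¬ inGamma1 N k) :
    ∑ n : GammaIdx N, ek N k (embG n) = 0 := by
  have hN' : (N : ℂ) ≠ 0 := by exact_mod_cast hN.ne'
  set z : Fin 3 → ℂ := fun i => Complex.exp (2 * π * Complex.I * (k i / N)) with hz
  have h1 : ∀ n : GammaIdx N, ek N k (embG n) = ∏ i, z i ^ (n i : ℕ) := by
    intro n
    unfold ek
    simp only [hz, ← Complex.exp_nat_mul]
    rw [← Complex.exp_sum]
    congr 1
    simp only [dotP, xiN, embG]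
    push_cast
    rw [Finset.mul_sum]
    refine Finset.sum_congr rfl fun i _ => ?_
    field_simp
  simp_rw [h1]
  have h2 := Finset.prod_univ_sum (fun _ : Fin 3 => (Finset.univ : Finset (Fin N))) (fun i j => z i ^ (j : ℕ))
  rw [Fintype.piFinset_univ] at h2
  rw [← h2]
  unfold inGamma1 at hk
  push Not at hk
  obtain ⟨j, hj⟩ := hk
  refine Finset.prod_eq_zero (Finset.mem_univ j) ?_
  rw [Fin.sum_univ_eq_sum_range (fun m => z j ^ m) N]
  have hz1 : z j ≠ 1 := by
    intro h
    simp only [hz] at h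
    rw [Complex.exp_eq_one_iff] at h
    obtain ⟨m, hm⟩ := h
    apply hj
    refine ⟨m, ?_⟩
    have hpi : (2 * π * Complex.I : ℂ) ≠ 0 := Complex.two_pi_I_ne_zero
    rw [mul_comm (m : ℂ)] at hm
    have := mul_left_cancel₀ hpi hm
    rw [div_eq_iff hN'] at this
    have h3 : k j = m * N := by exact_mod_cast this
    rw [h3]; ring
  have hzN : z j ^ N = 1 := by
    simp only [hz, ← Complex.exp_nat_mul]
    rw [Complex.exp_eq_one_iff]
    exact ⟨k j, by field_simp⟩
  rw [geom_sum_eq hz1, hzN]; simp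

/-- discrete Fourier uniqueness -/
lemma dft_inj {N : ℕ} (hN : 0 < N) (w : GammaIdx N → ℂ) (h0 : ∑ n, w n = 0)
    (h : ∀ k, ¬ inGamma1 N k → ∑ n, ek N k (embG n) * w n = 0) : w = 0 := by
  set kz : GammaIdx N → (Fin 3 → ℤ) := fun n i => ((n i : ℕ) : ℤ) with hkz
  have hall : ∀ l : GammaIdx N, ∑ n, ek N (kz l) (embG n) * w n = 0 := by
    intro l
    by_cases hl : inGamma1 N (kz l)
    · have : kz l = 0 := by
        ext i
        obtain ⟨c, hc⟩ := hl i
        have h1 : ((l i : ℕ) : ℤ) < N := by exact_mod_cast (l i).2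
        have h2 : (0 : ℤ) ≤ ((l i : ℕ) : ℤ) := by positivity
        exact Int.eq_zero_of_dvd_of_nonneg_of_lt h2 h1 (hl i)
      rw [this]
      simpa [ek_zero'] using h0
    · exact h _ hl
  ext m
  have h1 : ∑ l : GammaIdx N, ek N (kz l) (-embG m) * ∑ n, ek N (kz l) (embG n) * w n = 0 := by
    simp [hall]
  have hsym : ∀ l n : GammaIdx N, ek N (kz l) (-embG m) * ek N (kz l) (embG n)
      = ek N (kz n - kz m) (embG l) := by
    intro l n
    rw [← ek_add]
    unfold ek
    congr 3
    simp only [dotP, xiN, embG, hkz]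
    refine Finset.sum_congr rfl fun i _ => ?_
    simp [embG]; ring
  simp_rw [Finset.mul_sum, ← mul_assoc, hsym] at h1
  rw [Finset.sum_comm] at h1
  simp_rw [← Finset.sum_mul] at h1
  rw [Finset.sum_eq_single m] at h1
  · simp [ek_zero'] at h1
    rcases h1 with h1 | h1
    · exact absurd h1 hN.ne'
    · simpa using h1
  · intro n _ hn
    rw [geom_zero hN, zero_mul]
    intro hg
    apply hn
    ext i
    have h3 := hg i
    simp only [hkz, Pi.sub_apply] at h3
    have h4 : (n i : ℕ) ≡ (m i : ℕ) [MOD N] := by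
      rw [Nat.ModEq.comm, Nat.modEq_iff_dvd]; exact h3
    exact Nat.ModEq.eq_of_lt_of_lt h4 (n i).2 (m i).2
  · simp

lemma fourier_unique {N : ℕ} (hN : 0 < N) {f : V3 → ℝ} (hc : Continuous f) (hp : IsPerN N f)
    (h : ∀ k, ∫ x in cubeN N, ek N k x * (f x : ℂ) = 0) : ∀ x, f x = 0 := by
  have hN' : (N : ℝ) ≠ 0 := by exact_mod_cast hN.ne'
  have hN'' : (N : ℂ) ≠ 0 := by exact_mod_cast hN.ne'
  set pr : V3 → UnitAddTorus (Fin 3) := Pi.map (fun _ (x : ℝ) => (x : UnitAddCircle)) with hpr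
  have hq : IsOpenQuotientMap pr :=
    IsOpenQuotientMap.piMap fun _ => QuotientAddGroup.isOpenQuotientMap_mk
  set pb : V3 → UnitAddTorus (Fin 3) := fun x => pr (fun i => x i / N) with hpb
  have hpbc : Continuous pb := hq.continuous.comp (by fun_prop)
  set g : C(V3, ℂ) := ⟨fun x => (f (fun i => N * x i) : ℂ), by fun_prop⟩ with hg
  set prc : C(V3, UnitAddTorus (Fin 3)) := ⟨pr, hq.continuous⟩ with hprc
  have hqc : IsQuotientMap prc := hq.isQuotientMap
  have hinv : Function.FactorsThrough g prc := by
    intro a b hab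
    have h1 : ∀ i, ∃ m : ℤ, a i = b i + m := by
      intro i
      have h2 : ((a i : ℝ) : UnitAddCircle) = ((b i : ℝ) : UnitAddCircle) := congrFun hab i
      rw [← sub_eq_zero, ← AddCircle.coe_sub, AddCircle.coe_eq_zero_iff] at h2
      obtain ⟨m, hm⟩ := h2
      exact ⟨m, by simp at hm; linarith⟩
    choose m hm using h1
    simp only [hg, ContinuousMap.coe_mk]
    have : (fun i => (N : ℝ) * a i) = (fun i => (N : ℝ) * b i) + fun i => (N : ℝ) * (m i : ℝ) := by
      ext i; simp [hm, mul_add]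
    rw [this, hp]
  set F : C(UnitAddTorus (Fin 3), ℂ) := hqc.lift g hinv with hF
  have hFx : ∀ x, F (pb x) = (f x : ℂ) := by
    intro x
    have h1 : F (pb x) = g (fun i => x i / N) :=
      congrArg (fun (G : C(V3, ℂ)) => G (fun i => x i / N)) (hqc.lift_comp g hinv)
    rw [h1]
    simp only [hg, ContinuousMap.coe_mk]
    congr 2
    ext i; field_simp
  have hmono : ∀ k x, UnitAddTorus.mFourier k (pb x) = ek N k x := by
    intro k x
    simp only [UnitAddTorus.mFourier, ContinuousMap.coe_mk, hpb, hpr, Pi.map_apply, fourier_coe_apply, ek]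
    rw [← Complex.exp_sum]
    congr 1
    simp only [dotP, xiN]
    push_cast
    rw [Finset.mul_sum]
    refine Finset.sum_congr rfl fun i _ => ?_
    field_simp
  have hspan : ∀ p ∈ Submodule.span ℂ (Set.range (UnitAddTorus.mFourier (d := Fin 3))),
      ∫ x in cubeN N, p (pb x) * (f x : ℂ) = 0 := by
    intro p hp
    induction hp using Submodule.span_induction with
    | mem p hp =>
      obtain ⟨k, rfl⟩ := hp
      simp_rw [hmono]; exact h k
    | zero => simp
    | add a b _ _ ha hb =>
      simp only [ContinuousMap.add_apply, add_mul]
      have := a.continuous.comp hpbc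
      have := b.continuous.comp hpbc
      rw [integral_add (intQ N (by fun_prop)) (intQ N (by fun_prop)), ha, hb, add_zero]
    | smul c a _ ha =>
      simp only [ContinuousMap.smul_apply, smul_eq_mul, mul_assoc]
      rw [integral_const_mul, ha, mul_zero]
  have hsq : nrm N f ^ 2 = 0 := by
    rw [nrm_sq]
    set I := ∫ x in cubeN N, ‖f x‖ with hI
    have hI0 : 0 ≤ I := integral_nonneg fun _ => norm_nonneg _
    have hle : ∀ ε > 0, ∫ x in cubeN N, ‖f x‖ ^ 2 ≤ ε * I := by
      intro ε hε
      have hFc : F ∈ closure (Submodule.span ℂ (Set.range (UnitAddTorus.mFourier (d := Fin 3))) : Set C(UnitAddTorus (Fin 3), ℂ)) := by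
        rw [← Submodule.topologicalClosure_coe, UnitAddTorus.span_mFourier_closure_eq_top]; trivial
      obtain ⟨p, hp, hd⟩ := Metric.mem_closure_iff.1 hFc ε hε
      have hpc := p.continuous.comp hpbc
      have e1 : ((∫ x in cubeN N, ‖f x‖ ^ 2 : ℝ) : ℂ) = ∫ x in cubeN N, (F (pb x) - p (pb x)) * (f x : ℂ) := by
        simp_rw [sub_mul]
        rw [integral_sub, hspan p hp, sub_zero, ← integral_complex_ofReal]
        · congr 1; ext x
          rw [hFx, Real.norm_eq_abs, sq_abs]; push_cast; ring
        · simp_rw [hFx]; exact intQ N (by fun_prop)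
        · exact intQ N (by fun_prop)
      have e2 : ∫ x in cubeN N, ‖f x‖ ^ 2 ≤ ‖∫ x in cubeN N, (F (pb x) - p (pb x)) * (f x : ℂ)‖ := by
        rw [← e1, Complex.norm_real]; exact Real.le_norm_self _
      refine e2.trans ((norm_integral_le_integral_norm _).trans ?_)
      rw [hI, ← integral_const_mul]
      have hFc' := F.continuous.comp hpbc
      refine integral_mono (intQ N (by fun_prop)) (intQ N (by fun_prop)) fun x => ?_
      simp only
      rw [norm_mul, Complex.norm_real]
      refine mul_le_mul_of_nonneg_right ?_ (norm_nonneg _)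
      rw [← dist_eq_norm]
      exact (ContinuousMap.dist_apply_le_dist _).trans hd.le
    refine le_antisymm ?_ (integral_nonneg fun _ => by positivity)
    refine le_of_forall_pos_le_add fun ε hε => ?_
    have := hle (ε / (I + 1)) (by positivity)
    refine this.trans ?_
    rw [zero_add, div_mul_eq_mul_div, div_le_iff₀ (by positivity)]
    nlinarith
  have hz0 : ∫ x in cubeN N, ‖f x‖ ^ 2 = 0 := by rw [← nrm_sq]; exact hsq
  intro x0
  set v : V3 := x0 - fun _ => (N : ℝ) / 2 with hv
  have h1 : ∫ x in cubeN N, ‖f (x + v)‖ ^ 2 = 0 := by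
    rw [shift_int N hN (f := fun x => ‖f x‖ ^ 2) (per_comp hp fun a => ‖a‖ ^ 2) v, hz0]
  rw [integral_eq_zero_iff_of_nonneg (fun _ => by positivity) (intQ N (by fun_prop))] at h1
  set U : Set V3 := Set.pi Set.univ (fun _ => Set.Ioo (0 : ℝ) N) with hU
  have hUo : IsOpen U := isOpen_set_pi Set.finite_univ fun _ _ => isOpen_Ioo
  have hUs : U ⊆ cubeN N := fun x hx i => ⟨(hx i trivial).1.le, (hx i trivial).2⟩
  have h2 := ae_restrict_of_ae_restrict_of_subset hUs h1
  have h3 := Measure.eqOn_open_of_ae_eq (μ := volume) (U := U) (f := fun x => ‖f (x + v)‖ ^ 2) (g := 0) h2 hUo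
    (by fun_prop) (by fun_prop)
  have hNp : (0 : ℝ) < N := by exact_mod_cast hN
  have h4 := h3 (show (fun _ => (N : ℝ) / 2) ∈ U from fun i _ => ⟨by positivity, by linarith⟩)
  simpa [hv] using h4

lemma jellium {N : ℕ} (hN : 0 < N) {σ : V3 → ℝ} {e Z : ℝ} (hc : Continuous σ) (hp : IsPerN N σ)
    (hint : (∫ x in cubeN N, σ x) = e * Z) (hJ : JelliumCond N σ) (r x : V3) :
    stot σ (fun _ : GammaIdx N => r) x = e * Z := by
  have key : ∀ x, stot σ (fun _ : GammaIdx N => (0 : V3)) x - e * Z = 0 := by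
    have cs : Continuous (fun x => stot σ (fun _ : GammaIdx N => (0 : V3)) x) := by
      unfold stot; fun_prop
    refine fourier_unique hN (by fun_prop) ?_ ?_
    · intro x m
      simp only [stot]
      congr 1
      refine Finset.sum_congr rfl fun n _ => ?_
      rw [← hp (x - embG n - 0) m]
      congr 1; ext i; simp; ring
    · intro k
      have := ek_cont N k
      simp only [Complex.ofReal_sub, mul_sub]
      rw [integral_sub (intQ N (by fun_prop)) (intQ N (by fun_prop)), fC_stot hN hc hp, integral_mul_const]
      by_cases hk : k = 0
      · subst hk
        simp only [Sk, ek_zero', fC_eq, one_mul]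
        rw [integral_complex_ofReal, hint, const_int]
        simp
      rw [ek_int_zero hN hk]
      by_cases hg : inGamma1 N k
      · choose m hm using hg
        have hm0 : m ≠ 0 := by
          rintro rfl; apply hk; ext i; simp [hm]
        have h1 := hJ m hm0
        have h2 : xiN N k = fun i => 2 * π * (m i : ℝ) := by
          ext i
          have hN' : (N : ℝ) ≠ 0 := by exact_mod_cast hN.ne'
          simp only [xiN, hm]; push_cast; field_simp
        rw [h2, h1]; simp
      · have : Sk N k (fun _ => (0 : V3)) = 0 := by
          simp only [Sk, add_zero]; exact geom_zero hN hg
        rw [this]; simp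
  have := key (x - r)
  rw [sub_eq_zero] at this
  rw [← this]
  simp only [stot]
  refine Finset.sum_congr rfl fun n _ => ?_
  congr 1; abel

end fourier

end part12

section part13
open Filter Topology

section dist

lemma nsqV_nonneg (v : V3) : 0 ≤ nsqV v := Finset.sum_nonneg fun _ _ => sq_nonneg _

lemma gradSq_eq (f : V3 → ℂ) (x : V3) : gradSq f x = ∑ i, ‖pd i f x‖ ^ 2 := by
  simp [gradSq, pd, Complex.normSq_eq_norm_sq]

lemma dist_int {N : ℕ} {f : V3 → ℂ} (hf : ContDiff ℝ 1 f) (c : ℂ) :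
    ∫ x in cubeN N, (Complex.normSq (f x - c) + gradSq f x) = nrm N (fun x => f x - c) ^ 2 + gsq N f := by
  have h1 := hf.continuous
  have h2 := fun i => cont_pd hf i
  simp only [Complex.normSq_eq_norm_sq, gradSq_eq]
  rw [integral_add (intQ N (by fun_prop)) (intQ N (by fun_prop)), nrm_sq]
  rfl

lemma dist_decode {N : ℕ} {Z : ℝ} {f : V3 → ℂ} (hf : ContDiff ℝ 1 f) {q p : GammaIdx N → V3} {δ : ℝ}
    (h : distS N Z f q p < δ) :
    ∃ (α : ℝ) (r : V3) (k : GammaIdx N → Fin 3 → ℤ),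
      nrm N (fun x => f x - Complex.exp (Complex.I * (α : ℂ)) * ((Real.sqrt Z : ℝ) : ℂ)) < δ ∧
      gsq N f < δ ^ 2 ∧ (∀ n, nsqV (fun i => q n i - r i - (N : ℝ) * (k n i : ℝ)) < δ ^ 2) ∧
      ∑ n, nsqV (p n) < δ ^ 2 := by
  obtain ⟨α, h⟩ := exists_lt_of_ciInf_lt h
  obtain ⟨r, h⟩ := exists_lt_of_ciInf_lt h
  rw [dist_int hf] at h
  set a := nrm N (fun x => f x - Complex.exp (Complex.I * (α : ℂ)) * ((Real.sqrt Z : ℝ) : ℂ)) with ha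
  have ha0 : 0 ≤ a := nrm_nonneg _ _
  have hg := gsq_nonneg N f
  set S := ∑ n : GammaIdx N, ⨅ k : Fin 3 → ℤ, nsqV (fun i => q n i - r i - (N : ℝ) * (k i : ℝ)) with hS
  set P := ∑ n : GammaIdx N, nsqV (p n) with hP
  have s1 := Real.sqrt_nonneg (a ^ 2 + gsq N f)
  have s2 := Real.sqrt_nonneg S
  have s3 := Real.sqrt_nonneg P
  have t1 : a ^ 2 + gsq N f < δ ^ 2 := Real.sqrt_lt_sqrt_iff_of_pos (by nlinarith) |>.1 (by
    rw [Real.sqrt_sq (by linarith)]; linarith)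
  have hδ : 0 < δ := by linarith
  have t2 : S < δ ^ 2 := Real.sqrt_lt_sqrt_iff_of_pos (by positivity) |>.1 (by
    rw [Real.sqrt_sq (by linarith)]; linarith)
  have t3 : P < δ ^ 2 := Real.sqrt_lt_sqrt_iff_of_pos (by positivity) |>.1 (by
    rw [Real.sqrt_sq (by linarith)]; linarith)
  have hk : ∀ n : GammaIdx N, ∃ k : Fin 3 → ℤ, nsqV (fun i => q n i - r i - (N : ℝ) * (k i : ℝ)) < δ ^ 2 := by
    intro n
    have : (⨅ k : Fin 3 → ℤ, nsqV (fun i => q n i - r i - (N : ℝ) * (k i : ℝ))) ≤ S :=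
      Finset.single_le_sum (f := fun n : GammaIdx N => ⨅ k : Fin 3 → ℤ,
        nsqV (fun i => q n i - r i - (N : ℝ) * (k i : ℝ)))
        (fun m _ => Real.iInf_nonneg fun k => nsqV_nonneg _) (Finset.mem_univ n)
    exact exists_lt_of_ciInf_lt (this.trans_lt t2)
  choose k hk using hk
  refine ⟨α, r, k, ?_, by nlinarith, hk, t3⟩
  exact lt_of_pow_lt_pow_left₀ 2 hδ.le (by linarith)

lemma dist_le {N : ℕ} {Z : ℝ} {f : V3 → ℂ} (hf : ContDiff ℝ 1 f) (q p : GammaIdx N → V3)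
    (α : ℝ) (r : V3) (k : GammaIdx N → Fin 3 → ℤ) :
    distS N Z f q p ≤ Real.sqrt (nrm N (fun x => f x -
        Complex.exp (Complex.I * (α : ℂ)) * ((Real.sqrt Z : ℝ) : ℂ)) ^ 2 + gsq N f)
      + Real.sqrt (∑ n, nsqV (fun i => q n i - r i - (N : ℝ) * (k n i : ℝ)))
      + Real.sqrt (∑ n, nsqV (p n)) := by
  refine (ciInf_le ⟨0, ?_⟩ α).trans ((ciInf_le ⟨0, ?_⟩ r).trans ?_)
  · rintro _ ⟨a, rfl⟩
    exact Real.iInf_nonneg fun r => by positivity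
  · rintro _ ⟨a, rfl⟩
    positivity
  · rw [dist_int hf]
    gcongr with n
    exact ciInf_le ⟨0, by rintro _ ⟨a, rfl⟩; exact nsqV_nonneg _⟩ (k n)

lemma stot_lat {N : ℕ} {σ : V3 → ℝ} (hp : IsPerN N σ) (q : GammaIdx N → V3) (k : GammaIdx N → Fin 3 → ℤ)
    (x : V3) : stot σ (fun n i => q n i - (N : ℝ) * (k n i : ℝ)) x = stot σ q x := by
  unfold stot
  refine Finset.sum_congr rfl fun n _ => ?_
  rw [← hp (x - embG n - q n) (k n)]
  congr 1
  ext i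
  simp only [Pi.sub_apply, Pi.add_apply]
  ring

lemma nsqV_norm {v : V3} {δ : ℝ} (hδ : 0 ≤ δ) (h : nsqV v ≤ δ ^ 2) : ‖v‖ ≤ δ := by
  rw [pi_norm_le_iff_of_nonneg hδ]
  intro i
  have : v i ^ 2 ≤ nsqV v := Finset.single_le_sum (f := fun i => v i ^ 2) (fun _ _ => sq_nonneg _) (Finset.mem_univ i)
  exact abs_le_of_sq_le_sq (this.trans h) hδ

lemma nrm_const {N : ℕ} (c : ℂ) : nrm N (fun _ => c) = Real.sqrt ((N : ℝ) ^ 3) * ‖c‖ := by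
  unfold nrm
  rw [const_int, smul_eq_mul, Real.sqrt_mul (by positivity), Real.sqrt_sq (norm_nonneg _)]

lemma gsq_const {E : Type*} [NormedAddCommGroup E] [InnerProductSpace ℝ E] {N : ℕ} (c : E) :
    gsq N (fun _ => c) = 0 := by
  simp [gsq, pd]

lemma ps_ground {N : ℕ} (hN : 0 < N) {σ : V3 → ℝ} {e Z : ℝ} (hZ : 0 < Z) (hc : Continuous σ) (hp : IsPerN N σ)
    (hint : (∫ x in cubeN N, σ x) = e * Z) (hJ : JelliumCond N σ) (α : ℝ) (r : V3) :
    PS N σ e (fun _ => Complex.exp (Complex.I * (α : ℂ)) * ((Real.sqrt Z : ℝ) : ℂ)) (fun _ => 0)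
      (fun _ : GammaIdx N => r) where
  c2ψ := contDiff_const
  perψ := fun _ _ => rfl
  c2Φ := contDiff_const
  perΦ := fun _ _ => rfl
  mean := by simp
  poi := by
    intro x
    rw [jellium hN hc hp hint hJ, norm_mul, mul_comm Complex.I, Complex.norm_exp_ofReal_mul_I, one_mul,
      Complex.norm_real, Real.norm_of_nonneg (Real.sqrt_nonneg _), Real.sq_sqrt hZ.le]
    have : lapE (fun _ : V3 => (0 : ℝ)) x = 0 := by
      have hz : ∀ i, pd i (fun _ : V3 => (0 : ℝ)) = fun _ => 0 := by
        intro i; ext y; simp [pd]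
      simp [lapE, hz]
    rw [this]; ring

lemma nrm_mass {N : ℕ} {Z : ℝ} {f : V3 → ℂ} 
    (h : (∫ x in cubeN N, Complex.normSq (f x)) = Z * (N : ℝ) ^ 3) :
    nrm N f = Real.sqrt (Z * (N : ℝ) ^ 3) := by
  unfold nrm; simp only [← Complex.normSq_eq_norm_sq, h]

theorem init_small {N : ℕ} (hN : 0 < N) {σ : V3 → ℝ} {e Z M : ℝ} (he : 0 < e) (hZ : 0 < Z) (hM : 0 < M)
    (hp : IsPerN N σ) (hreg : ContDiff ℝ 2 σ) (hint : (∫ x in cubeN N, σ x) = e * Z) (hJ : JelliumCond N σ) :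
    ∃ C, 0 ≤ C ∧ ∀ δ, 0 < δ → δ ≤ 1 → ∀ ψ Φ q, IsSPN N σ e M ψ Φ q →
      (∫ x in cubeN N, Complex.normSq (ψ x 0)) = Z * (N : ℝ) ^ 3 →
      distS N Z (fun x => ψ x 0) (q 0) (fun n i => deriv (fun u => q u n i) 0) < δ →
      Es N M ψ Φ q 0 ≤ C * δ ^ 2 ∧ ∃ (r : V3) (k : GammaIdx N → Fin 3 → ℤ), ∀ n,
        nsqV (fun i => q 0 n i - r i - (N : ℝ) * (k n i : ℝ)) < δ ^ 2 := by
  obtain ⟨C, hC0, hC⟩ := poisson_stab N hN σ hreg hp e he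
  obtain ⟨S, hS0, hS⟩ := sobolev ℂ N hN
  set A : ℝ := S * (Real.sqrt (Z * (N : ℝ) ^ 3) + 1) with hA
  have hA0 : 0 ≤ A := by positivity
  refine ⟨1 / 2 + 1 / 2 * (C * (1 + (A + A))) ^ 2 + M / 2, by positivity, ?_⟩
  intro δ hδ hδ1 ψ Φ q h hm hd
  obtain ⟨α, r, k, h1, h2, h3, h4⟩ := dist_decode ((h.regx_psi 0).of_le one_le_two) hd
  refine ⟨?_, r, k, h3⟩
  set c : ℂ := Complex.exp (Complex.I * (α : ℂ)) * ((Real.sqrt Z : ℝ) : ℂ) with hc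
  have hcn : ‖c‖ = Real.sqrt Z := by
    rw [hc, norm_mul, mul_comm Complex.I, Complex.norm_exp_ofReal_mul_I, one_mul,
      Complex.norm_real, Real.norm_of_nonneg (Real.sqrt_nonneg _)]
  have ps := spn_ps hN h 0
  have ps' : PS N σ e (fun x => ψ x 0) (fun x => Phi0 N Φ x 0) (fun n i => q 0 n i - (N : ℝ) * (k n i : ℝ)) :=
    ⟨ps.c2ψ, ps.perψ, ps.c2Φ, ps.perΦ, ps.mean, fun x => by rw [stot_lat hp]; exact ps.poi x⟩
  have key := (hC _ _ _ _ _ _ ps' (ps_ground hN hZ hreg.continuous hp hint hJ α r)).1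
  simp only [sub_zero] at key
  have n1 : n4 N (fun x => ψ x 0) ≤ A := by
    refine (hS _ ((h.regx_psi 0).of_le one_le_two) (h.per_psi 0)).trans ?_
    rw [nrm_mass hm, hA]
    gcongr
    rw [Real.sqrt_le_one]
    nlinarith
  have n2 : n4 N (fun _ : V3 => c) ≤ A := by
    refine (hS _ contDiff_const (fun _ _ => rfl)).trans ?_
    rw [nrm_const, gsq_const, hcn, ← Real.sqrt_mul (by positivity), mul_comm _ Z, hA, Real.sqrt_zero]
    gcongr
    norm_num
  have n3 : ‖(fun n i => q 0 n i - (N : ℝ) * (k n i : ℝ)) - (fun _ : GammaIdx N => r)‖ ≤ δ := by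
    rw [pi_norm_le_iff_of_nonneg hδ.le]
    intro n
    apply nsqV_norm hδ.le
    refine le_trans (le_of_eq ?_) (h3 n).le
    congr 1
    ext i
    simp only [Pi.sub_apply]
    ring
  have k2 : Real.sqrt (gsq N fun x => Phi0 N Φ x 0) ≤ C * (1 + (A + A)) * δ := by
    refine key.trans ?_
    rw [mul_assoc]
    gcongr
    have : nrm N (fun x => ψ x 0 - c) * (n4 N (fun x => ψ x 0) + n4 N (fun _ : V3 => c)) ≤ δ * (A + A) := by
      have := n4_nonneg N (fun x => ψ x 0)
      have := n4_nonneg N (fun _ : V3 => c)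
      gcongr
    linarith
  have k3 : gsq N (fun x => Phi0 N Φ x 0) ≤ (C * (1 + (A + A)) * δ) ^ 2 := by
    rw [← Real.sq_sqrt (gsq_nonneg N _)]
    exact pow_le_pow_left₀ (Real.sqrt_nonneg _) k2 2
  have k4 : M / 2 * ∑ n, ∑ i, vel q 0 n i ^ 2 ≤ M / 2 * δ ^ 2 := by
    have : ∑ n, ∑ i, vel q 0 n i ^ 2 ≤ δ ^ 2 := h4.le
    gcongr
  unfold Es en
  rw [mul_pow] at k3
  linarith

end dist

end part13

section part14
open Filter Topology

section static

lemma psi_close {N : ℕ} (hN : 0 < N) {Z : ℝ} (hZ : 0 < Z) {f : V3 → ℂ} (hf : ContDiff ℝ 1 f) (hp : IsPerN N f)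
    (hm : nrm N f = Real.sqrt (Z * (N : ℝ) ^ 3)) :
    ∃ α : ℝ, nrm N (fun x => f x - Complex.exp (Complex.I * (α : ℂ)) * ((Real.sqrt Z : ℝ) : ℂ))
      ≤ 4 * N * Real.sqrt (gsq N f) := by
  set m := avg N f with hmd
  have hfc := hf.continuous
  have hpo := poincare N hN hf hp
  rw [← hmd] at hpo
  refine ⟨Complex.arg m, ?_⟩
  set c : ℂ := Complex.exp (Complex.I * (Complex.arg m : ℂ)) * ((Real.sqrt Z : ℝ) : ℂ) with hc
  have hmc : m - c = Complex.exp (Complex.I * (Complex.arg m : ℂ)) * ((‖m‖ - Real.sqrt Z : ℝ) : ℂ) := by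
    have := Complex.norm_mul_exp_arg_mul_I m
    rw [hc]
    push_cast
    rw [mul_sub, mul_comm Complex.I]
    rw [mul_comm (Complex.exp _) (‖m‖ : ℂ), this]
  have hn : ‖m - c‖ = |‖m‖ - Real.sqrt Z| := by
    rw [hmc, norm_mul, mul_comm Complex.I, Complex.norm_exp_ofReal_mul_I, one_mul, Complex.norm_real,
      Real.norm_eq_abs]
  have e1 : nrm N f = Real.sqrt ((N : ℝ) ^ 3) * Real.sqrt Z := by
    rw [hm, mul_comm, Real.sqrt_mul (by positivity)]
  have e2 := nrm_const (N := N) m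
  have e3 := nrm_const (N := N) (m - c)
  have t1 : nrm N f ≤ nrm N (fun x => f x - m) + nrm N (fun _ => m) := by
    have := nrm_add_le N (f := fun x => f x - m) (g := fun _ => m) (by fun_prop) (by fun_prop)
    simpa using this
  have t2 : nrm N (fun _ : V3 => m) ≤ nrm N f + nrm N (fun x => f x - m) := by
    have := nrm_sub_le N (f := f) (g := fun x => f x - m) (by fun_prop) (by fun_prop)
    simpa using this
  have t3 : nrm N (fun x => f x - c) ≤ nrm N (fun x => f x - m) + nrm N (fun _ => m - c) := by
    have := nrm_add_le N (f := fun x => f x - m) (g := fun _ => m - c) (by fun_prop) (by fun_prop)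
    simpa using this
  have t4 : nrm N (fun _ : V3 => m - c) ≤ nrm N (fun x => f x - m) := by
    rw [e3, hn]
    have hs := Real.sqrt_nonneg ((N : ℝ) ^ 3)
    rw [← abs_of_nonneg hs, ← abs_mul, abs_le]
    constructor <;> nlinarith
  linarith

lemma nrm_pd_le {E : Type*} [NormedAddCommGroup E] [InnerProductSpace ℝ E] {N : ℕ} {f : V3 → E}
    (hf : ContDiff ℝ 1 f) (i : Fin 3) :
    nrm N (pd i f) ≤ Real.sqrt (gsq N f) := by
  have h2 := fun i => cont_pd hf i
  refine Real.sqrt_le_sqrt (integral_mono (intQ N (by fun_prop)) (intQ N (by fun_prop)) fun x => ?_)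
  exact Finset.single_le_sum (f := fun i => ‖pd i f x‖ ^ 2) (fun _ _ => sq_nonneg _) (Finset.mem_univ i)

lemma green_bd {N : ℕ} (hN : 0 < N) {f g : V3 → ℝ} (hf : ContDiff ℝ 1 f) (hg : ContDiff ℝ 2 g)
    (hpf : IsPerN N f) (hpg : IsPerN N g) :
    |∫ x in cubeN N, f x * lapE g x| ≤ 3 * (Real.sqrt (gsq N f) * Real.sqrt (gsq N g)) := by
  have hg1 : ContDiff ℝ 1 g := hg.of_le one_le_two
  have h2 := fun i => cont_pd hf i
  have h3 := fun i => cont_pd hg1 i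
  have h := green N hN hf hg hpf hpg
  have h' : ∫ x in cubeN N, f x * lapE g x = ∫ x in cubeN N, inner ℝ (f x) (lapE g x) := by
    congr 1; ext x; simp [mul_comm]
  rw [h', h, abs_neg, integral_finsetSum _ fun i _ => intQ N (by fun_prop)]
  refine (Finset.abs_sum_le_sum_abs _ _).trans ?_
  refine (Finset.sum_le_sum (g := fun _ => Real.sqrt (gsq N f) * Real.sqrt (gsq N g)) fun i _ => ?_).trans
    (le_of_eq (by simp))
  refine (cs_inner N (h2 i) (h3 i)).trans ?_
  exact mul_le_mul (nrm_pd_le hf i) (nrm_pd_le hg1 i) (nrm_nonneg _ _) (Real.sqrt_nonneg _)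

lemma four_bd {N : ℕ} (hN : 0 < N) {σ : V3 → ℝ} {e : ℝ} (he : 0 < e) (hc : Continuous σ) (hp : IsPerN N σ)
    (B : ℝ) (hB : 0 ≤ B) {k : Fin 3 → ℤ} (hk : k ≠ 0) :
    ∃ C, 0 ≤ C ∧ ∀ ψ Φ q, PS N σ e ψ Φ q → nrm N ψ ≤ B →
      ‖Sk N k q * fCoeffR N σ (xiN N k)‖ ≤ C * (Real.sqrt (gsq N Φ) + Real.sqrt (gsq N ψ)) := by
  have ekc := ek_cont N k
  have ers : ContDiff ℝ 1 (fun x => (ek N k x).re) := (Complex.reCLM.contDiff.comp (ek_smooth N k)).of_le one_le_two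
  have eis : ContDiff ℝ 1 (fun x => (ek N k x).im) := (Complex.imCLM.contDiff.comp (ek_smooth N k)).of_le one_le_two
  have erp : IsPerN N (fun x => (ek N k x).re) := per_comp (ek_per hN k) Complex.re
  have eip : IsPerN N (fun x => (ek N k x).im) := per_comp (ek_per hN k) Complex.im
  set a := Real.sqrt (gsq N fun x => (ek N k x).re) with ha
  set b := Real.sqrt (gsq N fun x => (ek N k x).im) with hb
  set D := e * (2 * N * (B + Real.sqrt ((N : ℝ) ^ 3) * B)) with hD
  have ha0 : 0 ≤ a := Real.sqrt_nonneg _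
  have hb0 : 0 ≤ b := Real.sqrt_nonneg _
  have hD0 : 0 ≤ D := by positivity
  refine ⟨3 * a + 3 * b + D, by positivity, ?_⟩
  intro ψ Φ q ps hn
  have hψc := ps.c2ψ.continuous
  have hlap := cont_lap ps.c2Φ
  set m := avg N ψ with hm
  have hst : ∀ x, (stot σ q x : ℂ) = -((lapE Φ x : ℝ) : ℂ) + e * ((‖ψ x‖ ^ 2 - ‖m‖ ^ 2 : ℝ) : ℂ) + e * (‖m‖ ^ 2 : ℝ) := by
    intro x
    have := ps.poi x
    have : stot σ q x = -lapE Φ x + e * (‖ψ x‖ ^ 2 - ‖m‖ ^ 2) + e * ‖m‖ ^ 2 := by linarith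
    rw [this]; push_cast; ring
  rw [← fC_stot hN hc hp]
  have hsplit : ∫ x in cubeN N, ek N k x * (stot σ q x : ℂ) =
      -(∫ x in cubeN N, ek N k x * ((lapE Φ x : ℝ) : ℂ)) +
        e * (∫ x in cubeN N, ek N k x * ((‖ψ x‖ ^ 2 - ‖m‖ ^ 2 : ℝ) : ℂ)) := by
    have : ∀ x, ek N k x * (stot σ q x : ℂ) = (-(ek N k x * ((lapE Φ x : ℝ) : ℂ)) +
        e * (ek N k x * ((‖ψ x‖ ^ 2 - ‖m‖ ^ 2 : ℝ) : ℂ))) + ek N k x * ((e : ℂ) * (‖m‖ ^ 2 : ℝ)) := by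
      intro x; rw [hst]; ring
    simp_rw [this]
    rw [integral_add (intQ N (by fun_prop)) (intQ N (by fun_prop)),
      integral_add (intQ N (by fun_prop)) (intQ N (by fun_prop)), integral_neg, integral_const_mul,
      integral_mul_const, ek_int_zero hN hk]
    ring
  rw [hsplit]
  have b1 : ‖∫ x in cubeN N, ek N k x * ((lapE Φ x : ℝ) : ℂ)‖ ≤ (3 * a + 3 * b) * Real.sqrt (gsq N Φ) := by
    have hi : IntegrableOn (fun x => ek N k x * ((lapE Φ x : ℝ) : ℂ)) (cubeN N) := intQ N (by fun_prop)
    have r1 : (∫ x in cubeN N, ek N k x * ((lapE Φ x : ℝ) : ℂ)).re =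
        ∫ x in cubeN N, (ek N k x).re * lapE Φ x := by
      have := Complex.reCLM.integral_comp_comm hi
      simp only [Complex.reCLM_apply, Complex.re_mul_ofReal] at this
      exact this.symm
    have r2 : (∫ x in cubeN N, ek N k x * ((lapE Φ x : ℝ) : ℂ)).im =
        ∫ x in cubeN N, (ek N k x).im * lapE Φ x := by
      have := Complex.imCLM.integral_comp_comm hi
      simp only [Complex.imCLM_apply, Complex.im_mul_ofReal] at this
      exact this.symm
    refine (Complex.norm_le_abs_re_add_abs_im _).trans ?_
    rw [r1, r2]
    have g1 := green_bd hN ers ps.c2Φ erp ps.perΦ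
    have g2 := green_bd hN eis ps.c2Φ eip ps.perΦ
    linarith
  have b2 : ‖∫ x in cubeN N, ek N k x * ((‖ψ x‖ ^ 2 - ‖m‖ ^ 2 : ℝ) : ℂ)‖ ≤
      2 * N * (B + Real.sqrt ((N : ℝ) ^ 3) * B) * Real.sqrt (gsq N ψ) := by
    refine (norm_integral_le_integral_norm _).trans ?_
    have : ∫ x in cubeN N, ‖ek N k x * ((‖ψ x‖ ^ 2 - ‖m‖ ^ 2 : ℝ) : ℂ)‖ ≤
        ∫ x in cubeN N, ‖ψ x - m‖ * ‖‖ψ x‖ + ‖m‖‖ := by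
      refine integral_mono (intQ N (by fun_prop)) (intQ N (by fun_prop)) fun x => ?_
      simp only
      rw [norm_mul, ek_norm, one_mul, Complex.norm_real, Real.norm_eq_abs, sq_sub_sq, abs_mul, mul_comm,
        Real.norm_eq_abs]
      exact mul_le_mul_of_nonneg_right (abs_norm_sub_norm_le _ _) (abs_nonneg _)
    refine this.trans ((cs_norm N (f := fun x => ψ x - m) (g := fun x => ‖ψ x‖ + ‖m‖) (by fun_prop) (by fun_prop)).trans ?_)
    have p1 := poincare N hN (ps.c2ψ.of_le one_le_two) ps.perψ
    have p2 : nrm N (fun x => ‖ψ x‖ + ‖m‖) ≤ B + Real.sqrt ((N : ℝ) ^ 3) * B := by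
      refine (nrm_add_le N (f := fun x => ‖ψ x‖) (g := fun _ => ‖m‖) (by fun_prop) (by fun_prop)).trans ?_
      have q1 : nrm N (fun x => ‖ψ x‖) = nrm N ψ := nrm_congr N (by simp)
      have q2 : nrm N (fun _ : V3 => ‖m‖) = nrm N (fun _ : V3 => m) := nrm_congr N (by simp)
      rw [q1, q2, nrm_const]
      have := avg_le hN hψc
      gcongr
      exact this.trans hn
    calc _ ≤ (2 * N * Real.sqrt (gsq N ψ)) * (B + Real.sqrt ((N : ℝ) ^ 3) * B) :=
          mul_le_mul p1 p2 (nrm_nonneg _ _) (by positivity)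
      _ = _ := by ring
  have b3 : ‖(e : ℂ) * ∫ x in cubeN N, ek N k x * ((‖ψ x‖ ^ 2 - ‖m‖ ^ 2 : ℝ) : ℂ)‖ ≤ D * Real.sqrt (gsq N ψ) := by
    rw [norm_mul, Complex.norm_real, Real.norm_of_nonneg he.le, hD, mul_assoc]
    gcongr
  refine (norm_add_le _ _).trans ?_
  rw [norm_neg]
  have s1 := Real.sqrt_nonneg (gsq N Φ)
  have s2 := Real.sqrt_nonneg (gsq N ψ)
  have u1 : 0 ≤ D * Real.sqrt (gsq N Φ) := by positivity
  have u2 : 0 ≤ (3 * a + 3 * b) * Real.sqrt (gsq N ψ) := by positivity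
  linarith

end static

end part14

section part15
open Filter Topology

section wiener

lemma sig_zero {N : ℕ} {σ : V3 → ℝ} {θ : V3} (hP : (SigMat N σ θ).PosDef) (u : V3)
    (h : ∀ m : Fin 3 → ℤ, (∑ a, (θ a + 2 * π * (m a : ℝ)) * u a) = 0 ∨
      fCoeffR N σ (fun i => θ i + 2 * π * (m i : ℝ)) = 0) : u = 0 := by
  by_contra hu
  have hpos := hP.dotProduct_mulVec_pos hu
  set T : Fin 3 → Fin 3 → (Fin 3 → ℤ) → ℝ := fun a b m =>
    ((θ a + 2 * π * (m a : ℝ)) * (θ b + 2 * π * (m b : ℝ))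
        / nsqV (fun i => θ i + 2 * π * (m i : ℝ)))
      * Complex.normSq (fCoeffR N σ (fun i => θ i + 2 * π * (m i : ℝ))) with hT
  have hS : ∀ a b, SigMat N σ θ a b = ∑' m, T a b m := fun a b => rfl
  have hd : ∀ a, Summable (T a a) := by
    intro a
    by_contra hns
    have h1 := hP.diag_pos (i := a)
    rw [hS, tsum_eq_zero_of_not_summable hns] at h1
    exact lt_irrefl _ h1
  have hod : ∀ a b, Summable (T a b) := by
    intro a b
    refine Summable.of_norm_bounded ((hd a).add (hd b)) fun m => ?_
    simp only [hT]
    set x := θ a + 2 * π * (m a : ℝ)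
    set y := θ b + 2 * π * (m b : ℝ)
    have hn := nsqV_nonneg (fun i => θ i + 2 * π * (m i : ℝ))
    set n := nsqV (fun i => θ i + 2 * π * (m i : ℝ))
    have hs := Complex.normSq_nonneg (fCoeffR N σ (fun i => θ i + 2 * π * (m i : ℝ)))
    set s := Complex.normSq (fCoeffR N σ (fun i => θ i + 2 * π * (m i : ℝ)))
    rw [Real.norm_eq_abs, abs_mul, abs_div, abs_of_nonneg hn, abs_of_nonneg hs, ← add_mul, ← add_div]
    gcongr
    rw [abs_le]
    constructor <;> nlinarith [sq_nonneg (x + y), sq_nonneg (x - y), sq_nonneg x, sq_nonneg y]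
  have hq : star u ⬝ᵥ (SigMat N σ θ).mulVec u = ∑' m, ∑ a, ∑ b, u a * (T a b m * u b) := by
    have hs2 : ∀ a b, Summable fun m => u a * (T a b m * u b) := fun a b => ((hod a b).mul_right _).mul_left _
    rw [Summable.tsum_finsetSum fun a _ => summable_sum fun b _ => hs2 a b]
    simp only [dotProduct, Matrix.mulVec, star_trivial, Finset.mul_sum]
    refine Finset.sum_congr rfl fun a _ => ?_
    rw [Summable.tsum_finsetSum fun b _ => hs2 a b]
    refine Finset.sum_congr rfl fun b _ => ?_
    rw [tsum_mul_left, tsum_mul_right, hS]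
  have hz : ∀ m, ∑ a, ∑ b, u a * (T a b m * u b) = 0 := by
    intro m
    have : ∑ a, ∑ b, u a * (T a b m * u b) = (∑ a, (θ a + 2 * π * (m a : ℝ)) * u a) ^ 2 /
        nsqV (fun i => θ i + 2 * π * (m i : ℝ)) *
        Complex.normSq (fCoeffR N σ (fun i => θ i + 2 * π * (m i : ℝ))) := by
      rw [sq, Finset.sum_mul_sum, Finset.sum_div, Finset.sum_mul]
      refine Finset.sum_congr rfl fun a _ => ?_
      rw [Finset.sum_div, Finset.sum_mul]
      refine Finset.sum_congr rfl fun b _ => ?_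
      simp only [hT]; ring
    rw [this]
    rcases h m with h | h
    · rw [h]; simp
    · rw [h]; simp
  rw [hq] at hpos
  simp [hz] at hpos

lemma ek_shiftk {N : ℕ} (hN : 0 < N) (k m : Fin 3 → ℤ) (n : GammaIdx N) :
    ek N (fun i => k i + N * m i) (embG n) = ek N k (embG n) := by
  have hN' : (N : ℝ) ≠ 0 := by exact_mod_cast hN.ne'
  have h1 : dotP (xiN N (fun i => k i + N * m i)) (embG n) = dotP (xiN N k) (embG n) +
      2 * π * ((∑ i, m i * ((n i : ℕ) : ℤ) : ℤ) : ℝ) := by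
    simp only [dotP, xiN, embG]
    push_cast
    rw [Finset.mul_sum, ← Finset.sum_add_distrib]
    refine Finset.sum_congr rfl fun i _ => ?_
    field_simp
  unfold ek
  rw [h1]
  push_cast
  rw [mul_add, Complex.exp_add]
  have : Complex.exp (Complex.I * (2 * π * ((∑ i, m i * ((n i : ℕ) : ℤ) : ℤ) : ℂ))) = 1 := by
    rw [Complex.exp_eq_one_iff]
    exact ⟨_, by ring⟩
  push_cast at this
  rw [this, mul_one]

lemma xi_shiftk {N : ℕ} (hN : 0 < N) (k m : Fin 3 → ℤ) :
    xiN N (fun i => k i + N * m i) = fun i => xiN N k i + 2 * π * (m i : ℝ) := by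
  have hN' : (N : ℝ) ≠ 0 := by exact_mod_cast hN.ne'
  ext i
  simp only [xiN]
  push_cast
  field_simp

/-- linearized structure factor -/
def Lk (N : ℕ) (k : Fin 3 → ℤ) (w : GammaIdx N → V3) : ℂ :=
  ∑ n, ek N k (embG n) * ((dotP (xiN N k) (w n) : ℝ) : ℂ)

lemma lin_nonzero {N : ℕ} (hN : 0 < N) {σ : V3 → ℝ} (hW : WienerCond N σ) (w : GammaIdx N → V3)
    (h0 : ∑ n, w n = 0) (hw : w ≠ 0) :
    ∃ k, ¬ inGamma1 N k ∧ fCoeffR N σ (xiN N k) ≠ 0 ∧ Lk N k w ≠ 0 := by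
  by_contra hcon
  push Not at hcon
  apply hw
  have hWa : ∀ k, ¬ inGamma1 N k → ∀ a, ∑ n, ek N k (embG n) * ((w n a : ℝ) : ℂ) = 0 := by
    intro k hk
    set W : Fin 3 → ℂ := fun a => ∑ n, ek N k (embG n) * ((w n a : ℝ) : ℂ) with hWdef
    have hm : ∀ m : Fin 3 → ℤ, (∑ a, ((xiN N k a + 2 * π * (m a : ℝ) : ℝ) : ℂ) * W a) = 0 ∨
      fCoeffR N σ (fun i => xiN N k i + 2 * π * (m i : ℝ)) = 0 := by
      intro m
      by_cases hf : fCoeffR N σ (fun i => xiN N k i + 2 * π * (m i : ℝ)) = 0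
      · exact Or.inr hf
      left
      have hk' : ¬ inGamma1 N (fun i => k i + N * m i) := by
        intro h
        apply hk
        intro i
        have := h i
        exact (dvd_add_left (dvd_mul_right (N : ℤ) (m i))).1 this
      have := hcon _ hk' (by rw [xi_shiftk hN]; exact hf)
      rw [← this]
      simp only [Lk, hWdef, ek_shiftk hN, xi_shiftk hN, dotP, Finset.mul_sum]
      push_cast
      simp only [Finset.mul_sum]
      rw [Finset.sum_comm]
      refine Finset.sum_congr rfl fun n _ => Finset.sum_congr rfl fun a _ => ?_
      ring
    have hre : (fun a => (W a).re) = 0 := by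
      refine sig_zero (hW k hk) _ fun m => (hm m).imp_left fun h => ?_
      have := congrArg Complex.re h
      simpa only [Complex.re_sum, Complex.re_ofReal_mul, Complex.zero_re] using this
    have him : (fun a => (W a).im) = 0 := by
      refine sig_zero (hW k hk) _ fun m => (hm m).imp_left fun h => ?_
      have := congrArg Complex.im h
      simpa only [Complex.im_sum, Complex.im_ofReal_mul, Complex.zero_im] using this
    intro a
    exact Complex.ext (congrFun hre a) (congrFun him a)
  ext n a
  have := dft_inj hN (fun n => ((w n a : ℝ) : ℂ)) (by
    have := congrFun h0 a
    rw [Finset.sum_apply] at this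
    rw [← Complex.ofReal_sum, this]; simp) (fun k hk => hWa k hk a)
  have := congrFun this n
  simpa using this

lemma Lk_cont (N : ℕ) (k : Fin 3 → ℤ) : Continuous (Lk N k) := by
  unfold Lk dotP
  fun_prop

lemma Sk_cont (N : ℕ) (k : Fin 3 → ℤ) : Continuous (Sk N k) := by
  unfold Sk
  exact continuous_finsetSum _ fun n _ => (ek_cont N k).comp (by fun_prop)

lemma Sk_taylor {N : ℕ} (hN : 0 < N) {k : Fin 3 → ℤ} (hk : ¬ inGamma1 N k) :
    ∃ s1 > (0:ℝ), ∃ D : ℝ, 0 ≤ D ∧ ∀ s : ℝ, 0 ≤ s → s ≤ s1 → ∀ w : GammaIdx N → V3, ‖w‖ ≤ 1 →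
      ‖Sk N k (s • w) - Complex.I * s * Lk N k w‖ ≤ D * s ^ 2 := by
  set X := ∑ i, |xiN N k i| with hX
  have hX0 : 0 ≤ X := Finset.sum_nonneg fun _ _ => abs_nonneg _
  refine ⟨(X + 1)⁻¹, by positivity, Fintype.card (GammaIdx N) * X ^ 2, by positivity, ?_⟩
  intro s hs0 hs1 w hw
  have hd : ∀ n, |dotP (xiN N k) (w n)| ≤ X := by
    intro n
    refine (Finset.abs_sum_le_sum_abs _ _).trans (Finset.sum_le_sum fun i _ => ?_)
    rw [abs_mul]
    have : |w n i| ≤ 1 := ((norm_le_pi_norm (w n) i).trans (norm_le_pi_norm w n)).trans hw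
    exact mul_le_of_le_one_right (abs_nonneg _) this
  have hsX : s * X ≤ 1 := by
    have : s * (X + 1) ≤ (X + 1)⁻¹ * (X + 1) := by gcongr
    rw [inv_mul_cancel₀ (by positivity)] at this
    nlinarith
  have e1 : Sk N k (s • w) - Complex.I * s * Lk N k w = ∑ n, ek N k (embG n) *
      (Complex.exp (Complex.I * ((s * dotP (xiN N k) (w n) : ℝ) : ℂ)) - 1 -
        Complex.I * ((s * dotP (xiN N k) (w n) : ℝ) : ℂ)) := by
    have g := geom_zero hN hk
    have : ∀ n : GammaIdx N, ek N k ((s • w) n) = Complex.exp (Complex.I * ((s * dotP (xiN N k) (w n) : ℝ) : ℂ)) := by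
      intro n
      unfold ek
      congr 3
      simp only [dotP, Pi.smul_apply, smul_eq_mul, Finset.mul_sum]
      exact Finset.sum_congr rfl fun i _ => by ring
    simp only [Sk, Lk, ek_add, mul_sub, mul_one, Finset.sum_sub_distrib, g, sub_zero, this]
    congr 1
    rw [Finset.mul_sum]
    refine Finset.sum_congr rfl fun n _ => ?_
    push_cast; ring
  rw [e1]
  refine (norm_sum_le _ _).trans ((Finset.sum_le_sum (g := fun _ => X ^ 2 * s ^ 2) fun n _ => ?_).trans
    (le_of_eq (by rw [Finset.sum_const, nsmul_eq_mul, Finset.card_univ]; ring)))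
  rw [norm_mul, ek_norm, one_mul]
  have hle : ‖Complex.I * ((s * dotP (xiN N k) (w n) : ℝ) : ℂ)‖ ≤ s * X := by
    rw [norm_mul, Complex.norm_I, one_mul, Complex.norm_real, Real.norm_eq_abs, abs_mul, abs_of_nonneg hs0]
    exact mul_le_mul_of_nonneg_left (hd n) hs0
  refine (Complex.norm_exp_sub_one_sub_id_le (hle.trans hsX)).trans ?_
  rw [← mul_pow, mul_comm X]
  exact pow_le_pow_left₀ (norm_nonneg _) hle 2

/-- mean-zero unit sphere -/
def sph (N : ℕ) : Set (GammaIdx N → V3) := {w | ∑ n, w n = 0} ∩ Metric.sphere 0 1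

lemma sph_compact (N : ℕ) : IsCompact (sph N) := by
  refine (isCompact_sphere _ _).inter_left ?_
  exact isClosed_eq (by fun_prop) continuous_const

lemma wiener_nonzero {N : ℕ} (hN : 0 < N) {σ : V3 → ℝ} (hW : WienerCond N σ) :
    ∃ s1 > (0:ℝ), ∀ s : ℝ, 0 < s → s ≤ s1 → ∀ w ∈ sph N, ∃ k, ¬ inGamma1 N k ∧
      Sk N k (s • w) * fCoeffR N σ (xiN N k) ≠ 0 := by
  suffices h : ∃ s1 > (0:ℝ), ∀ s : ℝ, 0 < s → s ≤ s1 → ∀ w ∈ sph N, w ∈ sph N → ∃ k, ¬ inGamma1 N k ∧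
      Sk N k (s • w) * fCoeffR N σ (xiN N k) ≠ 0 by
    obtain ⟨s1, h1, h⟩ := h
    exact ⟨s1, h1, fun s a b w c => h s a b w c c⟩
  refine IsCompact.induction_on (sph_compact N) (p := fun A => ∃ s1 > (0:ℝ), ∀ s : ℝ, 0 < s → s ≤ s1 →
    ∀ w ∈ A, w ∈ sph N → ∃ k, ¬ inGamma1 N k ∧ Sk N k (s • w) * fCoeffR N σ (xiN N k) ≠ 0) ?_ ?_ ?_ ?_
  · exact ⟨1, one_pos, fun s _ _ w hw => absurd hw (by simp)⟩
  · rintro A B hAB ⟨s1, h1, h⟩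
    exact ⟨s1, h1, fun s a b w hw => h s a b w (hAB hw)⟩
  · rintro A B ⟨s1, h1, h⟩ ⟨s2, h2, h'⟩
    refine ⟨min s1 s2, lt_min h1 h2, fun s a b w hw => ?_⟩
    rcases hw with hw | hw
    · exact h s a (b.trans (min_le_left _ _)) w hw
    · exact h' s a (b.trans (min_le_right _ _)) w hw
  · intro w0 hw0
    have hne : w0 ≠ 0 := by
      rintro rfl
      have := hw0.2
      simp at this
    obtain ⟨k, hk, hf, hL⟩ := lin_nonzero hN hW w0 hw0.1 hne
    obtain ⟨s1, hs1, D, hD0, hD⟩ := Sk_taylor hN hk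
    set c := ‖Lk N k w0‖ / 2 with hc
    have hc0 : 0 < c := by have := norm_pos_iff.2 hL; positivity
    refine ⟨{w | c < ‖Lk N k w‖}, mem_nhdsWithin_of_mem_nhds ?_, min s1 (c / (D + 1)), by positivity, ?_⟩
    · exact (isOpen_lt continuous_const (Lk_cont N k).norm).mem_nhds (by
        change c < ‖Lk N k w0‖
        rw [hc] at hc0 ⊢; linarith)
    · intro s hs hss w hw hws
      refine ⟨k, hk, mul_ne_zero (fun h => ?_) hf⟩
      have hw1 : ‖w‖ = 1 := by simpa using hws.2
      have := hD s hs.le (hss.trans (min_le_left _ _)) w hw1.le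
      rw [h, zero_sub, norm_neg, norm_mul, norm_mul, Complex.norm_I, one_mul, Complex.norm_real,
        Real.norm_of_nonneg hs.le] at this
      have hw : c < ‖Lk N k w‖ := hw
      have h2 : s * (D + 1) ≤ c := by
        have := hss.trans (min_le_right _ _)
        rwa [le_div_iff₀ (by positivity)] at this
      have h3 : ‖Lk N k w‖ ≤ D * s := by
        by_contra h4
        push Not at h4
        nlinarith
      nlinarith

lemma wiener_gap {N : ℕ} (hN : 0 < N) {σ : V3 → ℝ} (hW : WienerCond N σ) (C : (Fin 3 → ℤ) → ℝ)
    (hC : ∀ k, 0 ≤ C k) :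
    ∃ s1 > (0:ℝ), ∀ s : ℝ, 0 < s → s ≤ s1 → ∃ η > (0:ℝ), ∀ w : GammaIdx N → V3, ∑ n, w n = 0 → ‖w‖ = s →
      ∃ k, ¬ inGamma1 N k ∧ C k * η < ‖Sk N k w * fCoeffR N σ (xiN N k)‖ := by
  obtain ⟨s1, hs1, h⟩ := wiener_nonzero hN hW
  refine ⟨s1, hs1, fun s hs hss => ?_⟩
  have key : ∃ η > (0:ℝ), ∀ w ∈ sph N, ∃ k, ¬ inGamma1 N k ∧
      C k * η < ‖Sk N k (s • w) * fCoeffR N σ (xiN N k)‖ := by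
    refine IsCompact.induction_on (sph_compact N) (p := fun A => ∃ η > (0:ℝ), ∀ w ∈ A, ∃ k, ¬ inGamma1 N k ∧
      C k * η < ‖Sk N k (s • w) * fCoeffR N σ (xiN N k)‖) ?_ ?_ ?_ ?_
    · exact ⟨1, one_pos, fun w hw => absurd hw (by simp)⟩
    · rintro A B hAB ⟨s1, h1, h⟩
      exact ⟨s1, h1, fun w hw => h w (hAB hw)⟩
    · rintro A B ⟨η1, h1, h⟩ ⟨η2, h2, h'⟩
      refine ⟨min η1 η2, lt_min h1 h2, fun w hw => ?_⟩
      rcases hw with hw | hw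
      · obtain ⟨k, hk, hl⟩ := h w hw
        exact ⟨k, hk, lt_of_le_of_lt (mul_le_mul_of_nonneg_left (min_le_left _ _) (hC k)) hl⟩
      · obtain ⟨k, hk, hl⟩ := h' w hw
        exact ⟨k, hk, lt_of_le_of_lt (mul_le_mul_of_nonneg_left (min_le_right _ _) (hC k)) hl⟩
    · intro w0 hw0
      obtain ⟨k, hk, hne⟩ := h s hs hss w0 hw0
      have hp := norm_pos_iff.2 hne
      set c := ‖Sk N k (s • w0) * fCoeffR N σ (xiN N k)‖ / 2 with hc
      have hCk := hC k
      refine ⟨{w | c < ‖Sk N k (s • w) * fCoeffR N σ (xiN N k)‖}, mem_nhdsWithin_of_mem_nhds ?_,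
        c / (C k + 1), by positivity, ?_⟩
      · have := Sk_cont N k
        exact (isOpen_lt continuous_const (by fun_prop)).mem_nhds (by
          change c < ‖Sk N k (s • w0) * fCoeffR N σ (xiN N k)‖
          rw [hc]; linarith)
      · intro w hw
        refine ⟨k, hk, lt_of_le_of_lt ?_ hw⟩
        have hc0 : 0 < c := by positivity
        rw [← mul_div_assoc, div_le_iff₀ (by positivity)]
        nlinarith
  obtain ⟨η, hη, hk⟩ := key
  refine ⟨η, hη, fun w hw hn => ?_⟩
  have := hk (s⁻¹ • w) ⟨by
    change ∑ n, (s⁻¹ • w) n = 0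
    simp only [Pi.smul_apply, ← Finset.smul_sum, hw, smul_zero], by
    rw [mem_sphere_zero_iff_norm, norm_smul, norm_inv, Real.norm_of_nonneg hs.le, hn, inv_mul_cancel₀ hs.ne']⟩
  rwa [smul_inv_smul₀ hs.ne'] at this

end wiener

end part15

section part16
open Filter Topology

section final

/-- shift by lattice vectors -/
def qsh {N : ℕ} (q : GammaIdx N → V3) (k : GammaIdx N → Fin 3 → ℤ) : GammaIdx N → V3 :=
  fun n i => q n i - (N : ℝ) * (k n i : ℝ)

/-- mean position -/
def mu {N : ℕ} (q : GammaIdx N → V3) : V3 := ((Fintype.card (GammaIdx N) : ℝ))⁻¹ • ∑ n, q n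

/-- deviations from the mean -/
def kap {N : ℕ} (q : GammaIdx N → V3) : GammaIdx N → V3 := fun n => q n - mu q

lemma card_pos {N : ℕ} (hN : 0 < N) : (0 : ℝ) < Fintype.card (GammaIdx N) := by
  haveI : Nonempty (Fin N) := ⟨⟨0, hN⟩⟩
  exact_mod_cast Fintype.card_pos

lemma kap_sum {N : ℕ} (hN : 0 < N) (q : GammaIdx N → V3) : ∑ n, kap q n = 0 := by
  have := card_pos hN
  simp only [kap, Finset.sum_sub_distrib, Finset.sum_const, Finset.card_univ, mu]
  rw [← Nat.cast_smul_eq_nsmul ℝ, smul_inv_smul₀ this.ne', sub_self]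

lemma kap_cont {N : ℕ} : Continuous (kap (N := N)) := by
  unfold kap mu
  fun_prop

lemma qsh_cont {N : ℕ} (k : GammaIdx N → Fin 3 → ℤ) : Continuous (fun q => qsh (N := N) q k) := by
  unfold qsh
  fun_prop

lemma kap_bd {N : ℕ} (hN : 0 < N) (q : GammaIdx N → V3) (r : V3) {δ : ℝ} (hδ : 0 ≤ δ)
    (h : ∀ n, ‖q n - r‖ ≤ δ) : ‖kap q‖ ≤ 2 * δ := by
  have hc := card_pos hN
  have h1 : mu q - r = ((Fintype.card (GammaIdx N) : ℝ))⁻¹ • ∑ n, (q n - r) := by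
    simp only [Finset.sum_sub_distrib, Finset.sum_const, Finset.card_univ, mu, smul_sub]
    rw [← Nat.cast_smul_eq_nsmul ℝ, inv_smul_smul₀ hc.ne']
  have h2 : ‖mu q - r‖ ≤ δ := by
    rw [h1, norm_smul, norm_inv, Real.norm_of_nonneg hc.le, inv_mul_le_iff₀ hc]
    refine (norm_sum_le _ _).trans ((Finset.sum_le_sum fun n _ => h n).trans (le_of_eq ?_))
    rw [Finset.sum_const, nsmul_eq_mul, Finset.card_univ]
  rw [pi_norm_le_iff_of_nonneg (by positivity)]
  intro n
  have : kap q n = (q n - r) - (mu q - r) := by simp [kap]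
  rw [this]
  refine (norm_sub_le _ _).trans ?_
  linarith [h n]

lemma Sk_kap {N : ℕ} (hN : 0 < N) (k : Fin 3 → ℤ) (q : GammaIdx N → V3) (l : GammaIdx N → Fin 3 → ℤ) :
    ‖Sk N k (kap (qsh q l))‖ = ‖Sk N k q‖ := by
  have : Sk N k q = ek N k (mu (qsh q l)) * Sk N k (kap (qsh q l)) := by
    unfold Sk
    rw [Finset.mul_sum]
    refine Finset.sum_congr rfl fun n _ => ?_
    have h1 : embG n + q n = (mu (qsh q l) + (embG n + kap (qsh q l) n)) + fun i => (N : ℝ) * (l n i : ℝ) := by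
      ext i
      simp only [kap, Pi.add_apply, Pi.sub_apply]
      simp only [qsh]
      ring
    rw [h1, ek_per hN k, ek_add]
  rw [this, norm_mul, ek_norm, one_mul]

lemma small_ev (A : ℝ) {c : ℝ} (hc : 0 < c) : ∀ᶠ δ in 𝓝[>] (0 : ℝ), A * δ < c := by
  have : Tendsto (fun δ : ℝ => A * δ) (𝓝[>] 0) (𝓝 (A * 0)) :=
    (Continuous.tendsto (by fun_prop) 0).mono_left nhdsWithin_le_nhds
  rw [mul_zero] at this
  exact this.eventually_lt_const hc

lemma nsqV_le {v : V3} {s : ℝ} (h : ‖v‖ ≤ s) : nsqV v ≤ 3 * s ^ 2 := by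
  have : ∀ i, v i ^ 2 ≤ s ^ 2 := fun i => by
    rw [← sq_abs]
    exact pow_le_pow_left₀ (abs_nonneg _) ((norm_le_pi_norm v i).trans h) 2
  refine (Finset.sum_le_sum fun i _ => this i).trans (le_of_eq (by simp))

theorem main_stab (N : ℕ) (hN : 0 < N) (σ : V3 → ℝ) (e Z M : ℝ)
    (he : 0 < e) (hZ : 0 < Z) (hM : 0 < M)
    (hper : IsPerN N σ) (hreg : ContDiff ℝ 2 σ)
    (hint : (∫ x in cubeN N, σ x) = e * Z)
    (hJ : JelliumCond N σ) (hW : WienerCond N σ) (ε : ℝ) (hε : 0 < ε) :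
    ∃ δ > (0 : ℝ),
      ∀ (ψ : V3 → ℝ → ℂ) (Φ : V3 → ℝ → ℝ) (q : ℝ → GammaIdx N → V3),
        IsSPN N σ e M ψ Φ q →
        (∫ x in cubeN N, Complex.normSq (ψ x 0)) = Z * (N : ℝ) ^ 3 →
        distS N Z (fun x => ψ x 0) (q 0) (fun n i => deriv (fun u => q u n i) 0) < δ →
        ∀ t : ℝ,
          distS N Z (fun x => ψ x t) (q t) (fun n i => deriv (fun u => q u n i) t) < ε := by
  obtain ⟨C, hC0, hC⟩ := init_small hN he hZ hM hper hreg hint hJ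
  set B := Real.sqrt (Z * (N : ℝ) ^ 3) with hB
  have hex : ∀ k : Fin 3 → ℤ, ∃ D, 0 ≤ D ∧ (k ≠ 0 → ∀ ψ Φ q, PS N σ e ψ Φ q → nrm N ψ ≤ B →
      ‖Sk N k q * fCoeffR N σ (xiN N k)‖ ≤ D * (Real.sqrt (gsq N Φ) + Real.sqrt (gsq N ψ))) := by
    intro k
    by_cases hk : k = 0
    · exact ⟨0, le_rfl, fun h => absurd hk h⟩
    · obtain ⟨D, h1, h2⟩ := four_bd hN he hreg.continuous hper B (Real.sqrt_nonneg _) hk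
      exact ⟨D, h1, fun _ => h2⟩
  choose D hD0 hD using hex
  obtain ⟨s1, hs1, hgap⟩ := wiener_gap hN hW D hD0
  set K := Real.sqrt (Fintype.card (GammaIdx N) * 3) with hK
  have hK0 : 0 ≤ K := Real.sqrt_nonneg _
  set s0 := min s1 (ε / (3 * (K + 1))) with hs0
  have hs0p : 0 < s0 := lt_min hs1 (by positivity)
  obtain ⟨η, hη, hgap⟩ := hgap s0 hs0p (min_le_left _ _)
  set G := Real.sqrt (2 * C) with hG
  have hG0 : 0 ≤ G := Real.sqrt_nonneg _
  have hev : ∀ᶠ δ in 𝓝[>] (0 : ℝ), 0 < δ ∧ 1 * δ < 1 ∧ 2 * δ < s0 ∧ (2 * G) * δ < η ∧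
      ((4 * N + 1) * G) * δ < ε / 3 ∧ (Real.sqrt M⁻¹ * G) * δ < ε / 3 := by
    filter_upwards [self_mem_nhdsWithin, small_ev 1 one_pos, small_ev 2 hs0p, small_ev (2 * G) hη,
      small_ev ((4 * N + 1) * G) (by positivity : 0 < ε / 3),
      small_ev (Real.sqrt M⁻¹ * G) (by positivity : 0 < ε / 3)] with δ h1 h2 h3 h4 h5 h6
    exact ⟨h1, h2, h3, h4, h5, h6⟩
  obtain ⟨δ, hδ, d1, d2, d3, d4, d5⟩ := hev.exists
  refine ⟨δ, hδ, ?_⟩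
  intro ψ Φ q h hm hd
  have H : Ctx N σ e M ψ Φ q := ⟨hN, hreg, hper, he, hM, h⟩
  obtain ⟨hE0, r, l, hrl⟩ := hC δ hδ (by linarith) ψ Φ q h hm hd
  have hEt : ∀ t, Es N M ψ Φ q t ≤ C * δ ^ 2 := fun t => by rw [(conservation H 0 t).2]; exact hE0
  have hmt : ∀ t, nrm N (fun x => ψ x t) = B := fun t => by
    rw [(conservation H 0 t).1, nrm_mass hm]
  have hvel : ∀ t, 0 ≤ M / 2 * ∑ n, ∑ i, vel q t n i ^ 2 := fun t =>
    mul_nonneg (by linarith) (vel_sq_nonneg _)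
  have hg2 : (G * δ) ^ 2 = 2 * (C * δ ^ 2) := by
    rw [mul_pow, hG, Real.sq_sqrt (by positivity)]; ring
  have hψ : ∀ t, gsq N (fun x => ψ x t) ≤ (G * δ) ^ 2 := fun t => by
    linarith [gsq_le_Es H t, hEt t]
  have hΦ : ∀ t, gsq N (fun x => Phi0 N Φ x t) ≤ (G * δ) ^ 2 := fun t => by
    have h1 := gsq_nonneg N (fun x => ψ x t)
    have h2 := hvel t
    have h3 := hEt t
    unfold Es en at h3
    linarith
  have hv : ∀ t, ∑ n, nsqV (vel q t n) ≤ M⁻¹ * (G * δ) ^ 2 := fun t => by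
    have h1 := gsq_nonneg N (fun x => ψ x t)
    have h2 := gsq_nonneg N (fun x => Phi0 N Φ x t)
    have h3 := hEt t
    unfold Es en at h3
    have h4 : M * ∑ n, ∑ i, vel q t n i ^ 2 ≤ (G * δ) ^ 2 := by linarith
    rw [inv_mul_eq_div, le_div_iff₀ hM, mul_comm]
    exact h4
  have hGδ : 0 ≤ G * δ := by positivity
  have sq1 : ∀ t, Real.sqrt (gsq N (fun x => ψ x t)) ≤ G * δ := fun t => by
    rw [← Real.sqrt_sq hGδ]; exact Real.sqrt_le_sqrt (hψ t)
  have sq2 : ∀ t, Real.sqrt (gsq N (fun x => Phi0 N Φ x t)) ≤ G * δ := fun t => by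
    rw [← Real.sqrt_sq hGδ]; exact Real.sqrt_le_sqrt (hΦ t)
  -- the deviation never reaches the level `s0`
  have hne : ∀ t, ‖kap (qsh (q t) l)‖ ≠ s0 := by
    intro t ht
    obtain ⟨k, hk, hlt⟩ := hgap _ (kap_sum hN _) ht
    have hk0 : k ≠ 0 := by
      rintro rfl
      exact hk fun i => dvd_zero _
    have hb := hD k hk0 _ _ _ (spn_ps hN h t) (hmt t).le
    rw [norm_mul, Sk_kap hN, ← norm_mul] at hlt
    have : D k * (Real.sqrt (gsq N fun x => Phi0 N Φ x t) + Real.sqrt (gsq N fun x => ψ x t)) ≤ D k * η :=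
      mul_le_mul_of_nonneg_left (by linarith [sq1 t, sq2 t]) (hD0 k)
    linarith
  have hcont : Continuous fun t => ‖kap (qsh (q t) l)‖ :=
    (kap_cont.comp ((qsh_cont l).comp h.reg_q.continuous)).norm
  have h00 : ‖kap (qsh (q 0) l)‖ < s0 := by
    refine lt_of_le_of_lt (kap_bd hN _ r hδ.le fun n => ?_) d2
    apply nsqV_norm hδ.le
    refine le_trans (le_of_eq ?_) (hrl n).le
    congr 1
    ext i
    simp only [Pi.sub_apply, qsh]
    ring
  have hlt : ∀ t, ‖kap (qsh (q t) l)‖ < s0 := by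
    intro t
    by_contra hcon
    push Not at hcon
    obtain ⟨u, hu⟩ := mem_range_of_exists_le_of_exists_ge hcont ⟨0, h00.le⟩ ⟨t, hcon⟩
    exact hne u hu
  intro t
  have hc1 : ContDiff ℝ 1 (fun x => ψ x t) := (h.regx_psi t).of_le one_le_two
  obtain ⟨α, hα⟩ := psi_close hN hZ hc1 (h.per_psi t) (hmt t)
  refine lt_of_le_of_lt (dist_le hc1 (q t) _ α (mu (qsh (q t) l)) l) ?_
  set a := nrm N (fun x => ψ x t - Complex.exp (Complex.I * (α : ℂ)) * ((Real.sqrt Z : ℝ) : ℂ)) with ha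
  have ha0 : 0 ≤ a := nrm_nonneg _ _
  have ha1 : a ≤ 4 * N * (G * δ) := hα.trans (mul_le_mul_of_nonneg_left (sq1 t) (by positivity))
  have e1 : Real.sqrt (a ^ 2 + gsq N (fun x => ψ x t)) < ε / 3 := by
    refine lt_of_le_of_lt ?_ d4
    rw [Real.sqrt_le_left (by positivity)]
    have h1 := hψ t
    have h2 : a ^ 2 ≤ (4 * N * (G * δ)) ^ 2 := pow_le_pow_left₀ ha0 ha1 2
    have h3 : 0 ≤ 2 * (4 * N * (G * δ)) * (G * δ) := by positivity
    nlinarith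
  have e2 : Real.sqrt (∑ n, nsqV (fun i => q t n i - mu (qsh (q t) l) i - (N : ℝ) * (l n i : ℝ))) < ε / 3 := by
    have h1 : ∑ n, nsqV (fun i => q t n i - mu (qsh (q t) l) i - (N : ℝ) * (l n i : ℝ)) ≤
        (Fintype.card (GammaIdx N) * 3) * s0 ^ 2 := by
      refine (Finset.sum_le_sum (g := fun _ => 3 * s0 ^ 2) fun n _ => ?_).trans (le_of_eq (by
        rw [Finset.sum_const, nsmul_eq_mul, Finset.card_univ]; ring))
      have : (fun i => q t n i - mu (qsh (q t) l) i - (N : ℝ) * (l n i : ℝ)) = kap (qsh (q t) l) n := by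
        ext i
        simp only [kap, Pi.sub_apply]
        simp only [qsh]
        ring
      rw [this]
      exact nsqV_le ((norm_le_pi_norm _ n).trans (hlt t).le)
    refine lt_of_le_of_lt (Real.sqrt_le_sqrt h1) ?_
    rw [Real.sqrt_mul (by positivity), Real.sqrt_sq hs0p.le, ← hK]
    have h2 : s0 * (3 * (K + 1)) ≤ ε := by
      have := min_le_right s1 (ε / (3 * (K + 1)))
      rwa [← hs0, le_div_iff₀ (by positivity)] at this
    nlinarith
  have e3 : Real.sqrt (∑ n, nsqV ((fun n i => deriv (fun u => q u n i) t : GammaIdx N → V3) n)) < ε / 3 := by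
    refine lt_of_le_of_lt (Real.sqrt_le_sqrt (hv t)) ?_
    rw [Real.sqrt_mul (by positivity), Real.sqrt_sq hGδ]
    linarith
  linarith

end final

end part16

/-- orbital stability of the ground states. -/
theorem stmt19 (N : ℕ) (hN : 0 < N) (σ : V3 → ℝ) (e Z M : ℝ)
    (he : 0 < e) (hZ : 0 < Z) (hM : 0 < M)
    (hper : IsPerN N σ) (hreg : ContDiff ℝ 2 σ)
    (hint : (∫ x in cubeN N, σ x) = e * Z)
    (hJ : JelliumCond N σ) (hW : WienerCond N σ) :
    ∀ ε > (0 : ℝ), ∃ δ > (0 : ℝ),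
      ∀ (ψ : V3 → ℝ → ℂ) (Φ : V3 → ℝ → ℝ) (q : ℝ → GammaIdx N → V3),
        IsSPN N σ e M ψ Φ q →
        (∫ x in cubeN N, Complex.normSq (ψ x 0)) = Z * (N : ℝ) ^ 3 →
        distS N Z (fun x => ψ x 0) (q 0) (fun n i => deriv (fun u => q u n i) 0) < δ →
        ∀ t : ℝ,
          distS N Z (fun x => ψ x t) (q t) (fun n i => deriv (fun u => q u n i) t) < ε := by
  intro ε hε
  exact main_stab N hN σ e Z M he hZ hM hper hreg hint hJ hW ε hε

end SPN
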